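/- Let 1 < p < q < ∞. There exists a constant C (depending only on p, q and φ₀) such that for every finite set E of Haar indices whose Haar frequency exponent set A = HF(E) satisfies #A ≥ 2, and every Schwartz function f : ℝ → ℂ, one has ‖P_E f‖_{F^{1/q}_{p,q}} ≤ C · (log₂ #A)^{1/q} · Z̄(A)^{1−1/q} · ‖f‖_{F^{1/q}_{p,q}}, where Z̄(A) = max_{n ∈ ℤ} #{ j ∈ A : |j − n| ≤ log₂ #A }. -/

import Mathlib

open MeasureTheory Real FourierTransform
open scoped ENNReal

noncomputable section

def haarFn (j : ℕ) (μ : ℤ) : ℝ → ℂ := fun x =>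
  (Set.Ico ((2:ℝ)^(-(j:ℤ)) * μ) ((2:ℝ)^(-(j:ℤ)) * (μ + 1/2))).indicator (fun _ => (1:ℂ)) x
  - (Set.Ico ((2:ℝ)^(-(j:ℤ)) * (μ + 1/2)) ((2:ℝ)^(-(j:ℤ)) * (μ + 1))).indicator (fun _ => (1:ℂ)) x

def haarProj (E : Finset (ℕ × ℤ)) (f : ℝ → ℂ) : ℝ → ℂ := fun x =>
  ∑ e ∈ E, (2:ℂ)^e.1 * (∫ y : ℝ, f y * haarFn e.1 e.2 y) * haarFn e.1 e.2 x

def HFset (E : Finset (ℕ × ℤ)) : Finset ℕ := E.image Prod.fst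

def conv (f g : ℝ → ℂ) : ℝ → ℂ := fun x => ∫ t : ℝ, f t * g (x - t)

def LPop (φ₀ : ℝ → ℂ) (k : ℕ) (g : ℝ → ℂ) : ℝ → ℂ :=
  if k = 0 then conv g (𝓕⁻ φ₀)
  else conv g (fun x => (2:ℂ)^k * (𝓕⁻ (fun ξ => φ₀ ξ - φ₀ (2*ξ))) ((2:ℝ)^k * x))

def FNorm (φ₀ : ℝ → ℂ) (p q s : ℝ) (g : ℝ → ℂ) : ℝ≥0∞ :=
  (∫⁻ x : ℝ, (∑' k : ℕ, ENNReal.ofReal ((2:ℝ)^((k:ℝ)*s*q)) *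
      (ENNReal.ofReal ‖LPop φ₀ k g x‖)^q)^(p/q) ∂volume)^(1/p)

/-- $\bar{\mathcal Z}(A)=\max_{n\in\mathbb Z}\#\{j\in A: |j-n|\le \log_2\#A\}$. -/
def Zbar (A : Finset ℕ) : ℕ :=
  sSup {c : ℕ | ∃ n : ℤ, c = (A.filter (fun (j : ℕ) => |(j:ℝ) - (n:ℝ)| ≤ Real.logb 2 (A.card : ℝ))).card}

/-- The weight `1 + 2^t |z|`. -/
def peetre (t : ℕ) (z : ℝ) : ℝ≥0∞ := 1 + 2 ^ t * ‖z‖ₑ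

lemma one_le_peetre (t : ℕ) (z : ℝ) : 1 ≤ peetre t z := le_self_add

lemma peetre_ne_zero (t : ℕ) (z : ℝ) : peetre t z ≠ 0 :=
  (lt_of_lt_of_le zero_lt_one (one_le_peetre t z)).ne'

lemma peetre_ne_top (t : ℕ) (z : ℝ) : peetre t z ≠ ⊤ := by
  unfold peetre
  finiteness

lemma peetre_sub_comm (t : ℕ) (x y : ℝ) : peetre t (x - y) = peetre t (y - x) := by
  simp [peetre, enorm_sub_rev x y]

lemma peetre_mono {s t : ℕ} (h : s ≤ t) (z : ℝ) : peetre s z ≤ peetre t z := by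
  unfold peetre
  gcongr
  norm_num

lemma peetre_sub_le_mul (t : ℕ) (x y z : ℝ) :
    peetre t (x - z) ≤ peetre t (x - y) * peetre t (y - z) := by
  have h : ‖x - z‖ₑ ≤ ‖x - y‖ₑ + ‖y - z‖ₑ := by
    simpa using enorm_add_le (x - y) (y - z)
  unfold peetre
  calc 1 + 2 ^ t * ‖x - z‖ₑ ≤ 1 + 2 ^ t * (‖x - y‖ₑ + ‖y - z‖ₑ) := by gcongr
    _ ≤ 1 + 2 ^ t * (‖x - y‖ₑ + ‖y - z‖ₑ) + (2 ^ t * ‖x - y‖ₑ) * (2 ^ t * ‖y - z‖ₑ) :=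
        le_self_add
    _ = _ := by ring

lemma peetre_le_two {t j : ℕ} (h : t ≤ j) {z : ℝ} (hz : |z| ≤ (2 : ℝ) ^ (-(j : ℤ))) :
    peetre t z ≤ 2 := by
  have h1 : ‖z‖ₑ ≤ (2 ^ j)⁻¹ := by
    rw [Real.enorm_eq_ofReal_abs]
    refine (ENNReal.ofReal_le_ofReal hz).trans ?_
    rw [zpow_neg, zpow_natCast, ENNReal.ofReal_inv_of_pos (by positivity),
      ENNReal.ofReal_pow (by norm_num)]
    simp
  have h2 : (2 : ℝ≥0∞) ^ t * ‖z‖ₑ ≤ 1 := by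
    calc (2 : ℝ≥0∞) ^ t * ‖z‖ₑ ≤ 2 ^ j * (2 ^ j)⁻¹ := by
          gcongr
          norm_num
      _ = 1 := ENNReal.mul_inv_cancel (by simp) (by simp)
  unfold peetre
  calc 1 + 2 ^ t * ‖z‖ₑ ≤ 1 + 1 := by gcongr
    _ = 2 := by norm_num

@[fun_prop]
lemma measurable_peetre (t : ℕ) : Measurable (peetre t) := by
  unfold peetre
  fun_prop

/-- If `1 + 2^t|x-y|` is comparable, so are the quadratic decay weights. -/
lemma inv_peetre_sq_le (t : ℕ) (x y z : ℝ) :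
    ((peetre t (y - z))⁻¹) ^ 2 ≤ (peetre t (x - y)) ^ 2 * ((peetre t (x - z))⁻¹) ^ 2 := by
  rw [← mul_pow]
  gcongr
  rw [← div_eq_mul_inv,
    ENNReal.le_div_iff_mul_le (Or.inl (peetre_ne_zero _ _)) (Or.inl (peetre_ne_top _ _)),
    mul_comm, ← div_eq_mul_inv,
    ENNReal.div_le_iff_le_mul (Or.inl (peetre_ne_zero _ _)) (Or.inl (peetre_ne_top _ _))]
  exact peetre_sub_le_mul t x y z

/-- The total mass of the kernel `(1 + |z|)^{-2}`. -/
def decayMass : ℝ≥0∞ := ∫⁻ z : ℝ, ((peetre 0 z)⁻¹) ^ 2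

lemma decayMass_ne_top : decayMass ≠ ⊤ := by
  have h := finite_integral_one_add_norm (E := ℝ) (μ := volume) (r := 2) (by simp)
  unfold decayMass
  refine (lt_of_le_of_lt (le_of_eq (lintegral_congr fun z => ?_)) h).ne
  have : peetre 0 z = ENNReal.ofReal (1 + ‖z‖) := by
    rw [ENNReal.ofReal_add zero_le_one (norm_nonneg _)]
    simp [peetre, Real.enorm_eq_ofReal_abs]
  rw [this, ← ENNReal.ofReal_inv_of_pos (by positivity), ← ENNReal.ofReal_pow (by positivity),
    Real.rpow_neg (by positivity)]
  norm_num

/-- The averaging kernel `2^t (1 + 2^t |z|)^{-2}`. -/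
def avgKer (t : ℕ) (z : ℝ) : ℝ≥0∞ := 2 ^ t * ((peetre t z)⁻¹) ^ 2

@[fun_prop]
lemma measurable_avgKer (t : ℕ) : Measurable (avgKer t) := by
  unfold avgKer
  fun_prop

lemma avgKer_ne_top (t : ℕ) (z : ℝ) : avgKer t z ≠ ⊤ := by
  unfold avgKer
  have := peetre_ne_zero t z
  finiteness

lemma avgKer_ne_zero (t : ℕ) (z : ℝ) : avgKer t z ≠ 0 := by
  simp [avgKer, peetre_ne_top]

lemma lintegral_decay (t : ℕ) :
    ∫⁻ z : ℝ, 2 ^ t * ((peetre t z)⁻¹) ^ 2 = decayMass := by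
  have h2 : (2 : ℝ) ^ t ≠ 0 := by positivity
  unfold decayMass
  conv_rhs => rw [← Real.smul_map_volume_mul_left h2]
  rw [lintegral_smul_measure, lintegral_map (by fun_prop) (by fun_prop),
    lintegral_const_mul _ (by fun_prop)]
  rw [smul_eq_mul, abs_of_pos (by positivity), ENNReal.ofReal_pow (by norm_num)]
  have e2 : ‖(2 : ℝ)‖ₑ = 2 := by simp [Real.enorm_eq_ofReal_abs]
  simp [peetre, enorm_mul, enorm_pow, e2]

lemma lintegral_avgKer_sub (t : ℕ) (x : ℝ) : ∫⁻ y : ℝ, avgKer t (x - y) = decayMass := by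
  rw [lintegral_sub_left_eq_self (avgKer t) x]
  exact lintegral_decay t

lemma lintegral_inv_peetre_sq (t : ℕ) (b : ℝ) :
    ∫⁻ x : ℝ, ((peetre t (x - b))⁻¹) ^ 2 = (2 ^ t)⁻¹ * decayMass := by
  rw [lintegral_sub_right_eq_self (fun z => ((peetre t z)⁻¹) ^ 2) b, ← lintegral_decay t,
    lintegral_const_mul _ (by fun_prop), ← mul_assoc, ENNReal.inv_mul_cancel (by simp) (by simp),
    one_mul]

/-- Breakpoints of the Haar functions of frequency `2^j`. -/
def node (j : ℕ) (i : Fin 3) (μ : ℤ) : ℝ := (2 : ℝ) ^ (-(j : ℤ)) * (μ + (i : ℕ) / 2)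

lemma tsum_inv_peetre_sq_node_le (n j : ℕ) (i : Fin 3) (y : ℝ) :
    ∑' μ : ℤ, ((peetre n (y - node j i μ))⁻¹) ^ 2 ≤
      4 * decayMass * (2 ^ j * (2 ^ (min n j))⁻¹) := by
  set m := min n j
  have hI : ∀ μ : ℤ, ((peetre n (y - node j i μ))⁻¹) ^ 2 ≤
      2 ^ j * ∫⁻ z in Set.Ico (node j i μ) (node j i (μ + 1)), 4 * ((peetre m (z - y))⁻¹) ^ 2 := by
    intro μ
    have hvol : volume (Set.Ico (node j i μ) (node j i (μ + 1))) = (2 ^ j)⁻¹ := by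
      rw [Real.volume_Ico]
      have : node j i (μ + 1) - node j i μ = ((2 : ℝ) ^ j)⁻¹ := by
        simp [node]; ring
      rw [this, ENNReal.ofReal_inv_of_pos (by positivity), ENNReal.ofReal_pow (by norm_num)]
      simp
    have h1 : ∫⁻ z in Set.Ico (node j i μ) (node j i (μ + 1)),
        ((peetre m (y - node j i μ))⁻¹) ^ 2 = (2 ^ j)⁻¹ * ((peetre m (y - node j i μ))⁻¹) ^ 2 := by
      rw [setLIntegral_const, hvol, mul_comm]
    have h2 : ((peetre m (y - node j i μ))⁻¹) ^ 2 = 2 ^ j *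
        ∫⁻ z in Set.Ico (node j i μ) (node j i (μ + 1)), ((peetre m (y - node j i μ))⁻¹) ^ 2 := by
      rw [h1, ← mul_assoc, ENNReal.mul_inv_cancel (by simp) (by simp), one_mul]
    calc ((peetre n (y - node j i μ))⁻¹) ^ 2 ≤ ((peetre m (y - node j i μ))⁻¹) ^ 2 := by
          gcongr
          exact peetre_mono (min_le_left _ _) _
      _ = _ := h2
      _ ≤ _ := by
          gcongr 2 ^ j * ?_
          refine setLIntegral_mono (by fun_prop) fun z hz => ?_
          refine (peetre_sub_comm m y _ ▸ inv_peetre_sq_le m z (node j i μ) y).trans ?_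
          gcongr
          have : peetre m (z - node j i μ) ≤ 2 := by
            refine peetre_le_two (min_le_right n j) ?_
            rw [abs_of_nonneg (by linarith [hz.1])]
            have := hz.2.le
            have e : node j i (μ + 1) = node j i μ + (2 : ℝ) ^ (-(j : ℤ)) := by
              simp [node]; ring
            linarith
          calc peetre m (z - node j i μ) ^ 2 ≤ 2 ^ 2 := by gcongr
            _ = 4 := by norm_num
  have hdisj : Pairwise (Function.onFun Disjoint
      fun μ : ℤ => Set.Ico (node j i μ) (node j i (μ + 1))) := by
    have hmono : Monotone (node j i) := by
      intro a b hab
      unfold node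
      gcongr
    exact hmono.pairwise_disjoint_on_Ico_succ
  calc ∑' μ : ℤ, ((peetre n (y - node j i μ))⁻¹) ^ 2
      ≤ ∑' μ : ℤ, 2 ^ j * ∫⁻ z in Set.Ico (node j i μ) (node j i (μ + 1)),
          4 * ((peetre m (z - y))⁻¹) ^ 2 := ENNReal.tsum_le_tsum hI
    _ = 2 ^ j * ∫⁻ z in ⋃ μ, Set.Ico (node j i μ) (node j i (μ + 1)),
          4 * ((peetre m (z - y))⁻¹) ^ 2 := by
        rw [ENNReal.tsum_mul_left, lintegral_iUnion (fun _ => measurableSet_Ico) hdisj]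
    _ ≤ 2 ^ j * ∫⁻ z, 4 * ((peetre m (z - y))⁻¹) ^ 2 := by
        gcongr
        exact Measure.restrict_le_self
    _ = _ := by
        rw [lintegral_const_mul _ (by fun_prop), lintegral_inv_peetre_sq]
        ring

/-- Averages of a nonnegative function at scale `2^{-t}`. -/
def avgOp (t : ℕ) (u : ℝ → ℝ≥0∞) (x : ℝ) : ℝ≥0∞ := ∫⁻ y, avgKer t (x - y) * u y

@[fun_prop]
lemma measurable_avgOp (t : ℕ) {u : ℝ → ℝ≥0∞} (hu : Measurable u) : Measurable (avgOp t u) := by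
  unfold avgOp
  refine Measurable.lintegral_prod_right' (f := fun z : ℝ × ℝ => avgKer t (z.1 - z.2) * u z.2) ?_
  fun_prop

/-- Transfer of an average from one point and scale to a coarser scale at another point. -/
lemma avgOp_le_avgOp {m n : ℕ} (h : m ≤ n) (u : ℝ → ℝ≥0∞) (x b : ℝ) :
    avgOp n u b ≤ 2 ^ (n - m) * peetre m (x - b) ^ 2 * avgOp m u x := by
  unfold avgOp
  have hx := peetre_ne_top m (x - b)
  rw [← lintegral_const_mul' _ _ (by finiteness)]
  refine lintegral_mono fun y => ?_
  simp only
  rw [← mul_assoc]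
  gcongr
  unfold avgKer
  have e : (2 : ℝ≥0∞) ^ n = 2 ^ (n - m) * 2 ^ m := by rw [← pow_add, Nat.sub_add_cancel h]
  calc 2 ^ n * ((peetre n (b - y))⁻¹) ^ 2
      ≤ 2 ^ n * ((peetre m (b - y))⁻¹) ^ 2 := by
        gcongr
        exact peetre_mono h _
    _ ≤ 2 ^ n * ((peetre m (x - b)) ^ 2 * ((peetre m (x - y))⁻¹) ^ 2) := by
        gcongr
        exact inv_peetre_sq_le m x b y
    _ = _ := by rw [e]; ring

/-- Weighted Hölder inequality for infinite sums. -/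
lemma tsum_mul_rpow_le {ι : Type*} {r : ℝ} (hr : 1 ≤ r) (α c : ι → ℝ≥0∞) :
    (∑' i, α i * c i) ^ r ≤ (∑' i, α i) ^ (r - 1) * ∑' i, α i * c i ^ r := by
  have hr0 : 0 < r := by linarith
  have h : ∑' i, α i * c i ≤ (∑' i, α i) ^ (1 - r⁻¹) * (∑' i, α i * c i ^ r) ^ r⁻¹ := by
    rw [ENNReal.tsum_eq_iSup_sum]
    refine iSup_le fun s => (ENNReal.inner_le_weight_mul_Lp_of_nonneg s hr α c).trans ?_
    have : 0 ≤ 1 - r⁻¹ := by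
      have := inv_le_one_of_one_le₀ hr
      linarith
    gcongr
    · exact ENNReal.sum_le_tsum s
    · exact ENNReal.sum_le_tsum s
  calc (∑' i, α i * c i) ^ r
      ≤ ((∑' i, α i) ^ (1 - r⁻¹) * (∑' i, α i * c i ^ r) ^ r⁻¹) ^ r := by gcongr
    _ = _ := by
      rw [ENNReal.mul_rpow_of_nonneg _ _ hr0.le, ← ENNReal.rpow_mul, ← ENNReal.rpow_mul,
        inv_mul_cancel₀ hr0.ne', ENNReal.rpow_one, sub_mul, one_mul, inv_mul_cancel₀ hr0.ne']

lemma avgOp_rpow_le {r σ : ℝ} (hσ : 0 ≤ σ) (hσr : σ + 1 ≤ r) {g : ℝ → ℝ≥0∞} (hg : Measurable g)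
    (hg0 : ∀ᵐ x, g x ≠ 0 ∧ g x ≠ ⊤) {u : ℝ → ℝ≥0∞} (hu : Measurable u) (n : ℕ) (b : ℝ) :
    avgOp n u b ^ r ≤ decayMass ^ (r - 1 - σ) * avgOp n g b ^ σ *
      avgOp n (fun y => u y ^ r * g y ^ (-σ)) b := by
  have hr0 : 0 < r := by linarith
  let F : Fin 3 → ℝ → ℝ≥0∞ := ![fun y => avgKer n (b - y) * (u y ^ r * g y ^ (-σ)),
    fun y => avgKer n (b - y) * g y, fun y => avgKer n (b - y)]
  let P : Fin 3 → ℝ := ![1 / r, σ / r, (r - 1 - σ) / r]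
  have hF : ∀ i ∈ Finset.univ, AEMeasurable (F i) volume := by
    intro i _
    fin_cases i <;> simp only [F] <;> dsimp <;> fun_prop
  have hP : ∑ i, P i = 1 := by
    simp [P, Fin.sum_univ_three]
    field_simp
    ring
  have hP0 : ∀ i ∈ Finset.univ, 0 ≤ P i := by
    intro i _
    fin_cases i <;> dsimp [P] <;> apply div_nonneg <;> linarith
  have key := ENNReal.lintegral_prod_norm_pow_le (μ := volume) Finset.univ hF hP hP0
  simp only [Fin.prod_univ_three, F, P, Matrix.cons_val_zero, Matrix.cons_val_one,
    Matrix.cons_val] at key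
  have hle : avgOp n u b ≤ avgOp n (fun y => u y ^ r * g y ^ (-σ)) b ^ (1 / r) *
      avgOp n g b ^ (σ / r) * decayMass ^ ((r - 1 - σ) / r) := by
    rw [← lintegral_avgKer_sub n b]
    refine le_trans (le_of_eq ?_) key
    refine lintegral_congr_ae ?_
    filter_upwards [hg0] with y hy
    have hK0 := avgKer_ne_zero n (b - y)
    have hKt := avgKer_ne_top n (b - y)
    have e1 : (avgKer n (b - y) * (u y ^ r * g y ^ (-σ))) ^ (1 / r) =
        avgKer n (b - y) ^ (1 / r) * (u y * g y ^ (-σ / r)) := by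
      rw [ENNReal.mul_rpow_of_nonneg _ _ (by positivity),
        ENNReal.mul_rpow_of_nonneg _ _ (by positivity), ← ENNReal.rpow_mul, ← ENNReal.rpow_mul,
        mul_one_div_cancel hr0.ne', ENNReal.rpow_one, mul_one_div]
    have e2 : (avgKer n (b - y) * g y) ^ (σ / r) =
        avgKer n (b - y) ^ (σ / r) * g y ^ (σ / r) :=
      ENNReal.mul_rpow_of_nonneg _ _ (by positivity)
    rw [e1, e2]
    calc avgKer n (b - y) * u y
        = (avgKer n (b - y) ^ (1 / r) * avgKer n (b - y) ^ (σ / r) *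
            avgKer n (b - y) ^ ((r - 1 - σ) / r)) * (g y ^ (-σ / r) * g y ^ (σ / r)) * u y := by
          rw [← ENNReal.rpow_add _ _ hK0 hKt, ← ENNReal.rpow_add _ _ hK0 hKt,
            ← ENNReal.rpow_add _ _ hy.1 hy.2]
          have a1 : 1 / r + σ / r + (r - 1 - σ) / r = 1 := by field_simp; ring
          have a2 : -σ / r + σ / r = 0 := by ring
          rw [a1, a2]
          simp
      _ = _ := by ring
  calc avgOp n u b ^ r ≤ (avgOp n (fun y => u y ^ r * g y ^ (-σ)) b ^ (1 / r) *
      avgOp n g b ^ (σ / r) * decayMass ^ ((r - 1 - σ) / r)) ^ r := by gcongr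
    _ = _ := by
      rw [ENNReal.mul_rpow_of_nonneg _ _ hr0.le, ENNReal.mul_rpow_of_nonneg _ _ hr0.le,
        ← ENNReal.rpow_mul, ← ENNReal.rpow_mul, ← ENNReal.rpow_mul, div_mul_cancel₀ _ hr0.ne',
        div_mul_cancel₀ _ hr0.ne', div_mul_cancel₀ _ hr0.ne', ENNReal.rpow_one]
      ring

lemma rpow_neg_mul_rpow_le_one (a : ℝ≥0∞) (σ : ℝ) : a ^ (-σ) * a ^ σ ≤ 1 := by
  rw [ENNReal.rpow_neg]
  exact ENNReal.inv_mul_le_one _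

lemma weight_mul_avgOp_rpow_le {r σ : ℝ} (hσ : 0 ≤ σ) (hσr : σ + 1 ≤ r) {g : ℝ → ℝ≥0∞}
    (hg : Measurable g) (hg0 : ∀ᵐ x, g x ≠ 0 ∧ g x ≠ ⊤) {G : ℝ≥0∞}
    (hG : ∀ m x, avgOp m g x ≤ G * g x) {u : ℝ → ℝ≥0∞} (hu : Measurable u) {m n : ℕ} (hmn : m ≤ n)
    (x b : ℝ) :
    g x ^ (-σ) * avgOp n u b ^ r ≤ decayMass ^ (r - 1 - σ) * G ^ σ *
      ((2 ^ (n - m)) ^ σ * (peetre m (x - b) ^ 2) ^ σ) *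
      avgOp n (fun y => u y ^ r * g y ^ (-σ)) b := by
  have h1 : avgOp n g b ^ σ ≤ ((2 ^ (n - m)) ^ σ * (peetre m (x - b) ^ 2) ^ σ) *
      (G ^ σ * g x ^ σ) := by
    rw [← ENNReal.mul_rpow_of_nonneg _ _ hσ, ← ENNReal.mul_rpow_of_nonneg _ _ hσ,
      ← ENNReal.mul_rpow_of_nonneg _ _ hσ]
    gcongr
    refine (avgOp_le_avgOp hmn g x b).trans ?_
    gcongr
    exact hG m x
  calc g x ^ (-σ) * avgOp n u b ^ r
      ≤ g x ^ (-σ) * (decayMass ^ (r - 1 - σ) *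
        (((2 ^ (n - m)) ^ σ * (peetre m (x - b) ^ 2) ^ σ) * (G ^ σ * g x ^ σ)) *
        avgOp n (fun y => u y ^ r * g y ^ (-σ)) b) := by
        gcongr
        refine (avgOp_rpow_le hσ hσr hg hg0 hu n b).trans ?_
        gcongr
    _ = (g x ^ (-σ) * g x ^ σ) * (decayMass ^ (r - 1 - σ) * G ^ σ *
      ((2 ^ (n - m)) ^ σ * (peetre m (x - b) ^ 2) ^ σ) *
      avgOp n (fun y => u y ^ r * g y ^ (-σ)) b) := by ring
    _ ≤ 1 * _ := by
        gcongr
        exact rpow_neg_mul_rpow_le_one _ _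
    _ = _ := one_mul _

/-- Majorant of the frequency-`2^k` part of a Haar projection at level `j` of a function `u`
living at frequency `2^n`. -/
def nodeSum (M k j n : ℕ) (u : ℝ → ℝ≥0∞) (x : ℝ) : ℝ≥0∞ :=
  ∑' e : Fin 3 × Fin 3 × ℤ,
    ((peetre k (x - node j e.2.1 e.2.2))⁻¹) ^ M * avgOp n u (node j e.1 e.2.2)

lemma two_pow_mul_inv_min (j k : ℕ) :
    (2 : ℝ≥0∞) ^ j * (2 ^ (min k j))⁻¹ = 2 ^ (j - k) := by
  have e : (2 : ℝ≥0∞) ^ j = 2 ^ (j - k) * 2 ^ (min k j) := by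
    rw [← pow_add]
    congr 1
    omega
  rw [e, mul_assoc, ENNReal.mul_inv_cancel (by simp) (by simp), mul_one]

lemma tsum_nodes_le (k j : ℕ) {M : ℕ} (hM : 2 ≤ M) (x : ℝ) :
    ∑' e : Fin 3 × Fin 3 × ℤ, ((peetre k (x - node j e.2.1 e.2.2))⁻¹) ^ M ≤
      36 * decayMass * 2 ^ (j - k) := by
  have h1 : ∀ i : Fin 3, ∑' μ : ℤ, ((peetre k (x - node j i μ))⁻¹) ^ M ≤
      4 * decayMass * 2 ^ (j - k) := by
    intro i
    rw [← two_pow_mul_inv_min]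
    refine le_trans (ENNReal.tsum_le_tsum fun μ => ?_) (tsum_inv_peetre_sq_node_le k j i x)
    exact pow_le_pow_right_of_le_one' (ENNReal.inv_le_one.2 (one_le_peetre _ _)) hM
  rw [ENNReal.tsum_prod']
  simp_rw [ENNReal.tsum_prod']
  calc ∑' (_ : Fin 3), ∑' (i : Fin 3), ∑' μ : ℤ, ((peetre k (x - node j i μ))⁻¹) ^ M
      ≤ ∑' (_ : Fin 3), ∑' (_ : Fin 3), 4 * decayMass * 2 ^ (j - k) :=
        ENNReal.tsum_le_tsum fun _ => ENNReal.tsum_le_tsum fun i => h1 i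
    _ = _ := by
        simp [tsum_fintype]
        ring

lemma tsum_avgOp_nodes_le (n j : ℕ) {v : ℝ → ℝ≥0∞} (hv : Measurable v) :
    ∑' e : Fin 3 × Fin 3 × ℤ, avgOp n v (node j e.1 e.2.2) ≤
      36 * decayMass * 2 ^ (max n j) * ∫⁻ y, v y := by
  have h1 : ∀ i : Fin 3, ∑' μ : ℤ, avgOp n v (node j i μ) ≤
      4 * decayMass * 2 ^ (max n j) * ∫⁻ y, v y := by
    intro i
    unfold avgOp
    rw [← lintegral_tsum (by intro μ; fun_prop), ← lintegral_const_mul _ hv]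
    refine lintegral_mono fun y => ?_
    simp only
    rw [ENNReal.tsum_mul_right]
    gcongr
    unfold avgKer
    rw [ENNReal.tsum_mul_left]
    simp_rw [peetre_sub_comm n _ y]
    calc 2 ^ n * ∑' μ : ℤ, ((peetre n (y - node j i μ))⁻¹) ^ 2
        ≤ 2 ^ n * (4 * decayMass * (2 ^ j * (2 ^ (min n j))⁻¹)) := by
          gcongr
          exact tsum_inv_peetre_sq_node_le n j i y
      _ = 4 * decayMass * 2 ^ (max n j) := by
          rw [two_pow_mul_inv_min]
          have e : (2 : ℝ≥0∞) ^ (max n j) = 2 ^ n * 2 ^ (j - n) := by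
            rw [← pow_add]
            congr 1
            omega
          rw [e]
          ring
  rw [ENNReal.tsum_prod']
  simp_rw [ENNReal.tsum_prod']
  calc ∑' (i : Fin 3), ∑' (_ : Fin 3), ∑' μ : ℤ, avgOp n v (node j i μ)
      ≤ ∑' (_ : Fin 3), ∑' (_ : Fin 3), 4 * decayMass * 2 ^ (max n j) * ∫⁻ y, v y :=
        ENNReal.tsum_le_tsum fun i => ENNReal.tsum_le_tsum fun _ => h1 i
    _ = _ := by
        simp [tsum_fintype]
        ring

lemma abs_node_sub_node_le (j : ℕ) (i i' : Fin 3) (μ : ℤ) :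
    |node j i μ - node j i' μ| ≤ (2 : ℝ) ^ (-(j : ℤ)) := by
  have e : node j i μ - node j i' μ = (2 : ℝ) ^ (-(j : ℤ)) * (((i : ℕ) - (i' : ℕ) : ℝ) / 2) := by
    unfold node; ring
  rw [e, abs_mul, abs_of_pos (by positivity)]
  refine mul_le_of_le_one_right (by positivity) ?_
  fin_cases i <;> fin_cases i' <;> norm_num [abs_le]

/-- Weighted bound for `nodeSum`. -/
lemma lintegral_nodeSum_rpow_le {r σ : ℝ} (hσ : 0 ≤ σ) (hσr : σ + 1 ≤ r) {g : ℝ → ℝ≥0∞}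
    (hg : Measurable g) (hg0 : ∀ᵐ x, g x ≠ 0 ∧ g x ≠ ⊤) {G : ℝ≥0∞}
    (hG : ∀ m x, avgOp m g x ≤ G * g x) {u : ℝ → ℝ≥0∞} (hu : Measurable u) {M : ℕ}
    (hM : 2 * σ + 2 ≤ M) (k j n : ℕ) :
    ∫⁻ x, g x ^ (-σ) * nodeSum M k j n u x ^ r ≤
      ((36 * decayMass) ^ (r - 1) * (decayMass ^ (r - 1 - σ) * G ^ σ * 16 ^ σ) * decayMass *
        (36 * decayMass)) *
      ((2 ^ (j - k)) ^ (r - 1) * (2 ^ (n - min n (min j k))) ^ σ * (2 ^ max n j * (2 ^ k)⁻¹)) *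
      ∫⁻ y, u y ^ r * g y ^ (-σ) := by
  set m := min n (min j k) with hm
  have hr : 1 ≤ r := by linarith
  have hM2 : 2 ≤ M := by
    have : (2 : ℝ) ≤ M := by linarith
    exact_mod_cast this
  set v : ℝ → ℝ≥0∞ := fun y => u y ^ r * g y ^ (-σ) with hv
  have hvm : Measurable v := by fun_prop
  set B : ℝ≥0∞ := decayMass ^ (r - 1 - σ) * G ^ σ * 16 ^ σ with hB
  set S : ℝ≥0∞ := 36 * decayMass * 2 ^ (j - k) with hS
  have hterm : ∀ x (e : Fin 3 × Fin 3 × ℤ), ((peetre k (x - node j e.2.1 e.2.2))⁻¹) ^ M *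
      (g x ^ (-σ) * avgOp n u (node j e.1 e.2.2) ^ r) ≤
      (B * (2 ^ (n - m)) ^ σ) * (((peetre k (x - node j e.2.1 e.2.2))⁻¹) ^ 2 *
        avgOp n v (node j e.1 e.2.2)) := by
    rintro x ⟨i, i', μ⟩
    simp only
    set b := node j i μ
    set b' := node j i' μ
    set Q := peetre k (x - b')
    have hQ0 : Q ≠ 0 := peetre_ne_zero _ _
    have hQt : Q ≠ ⊤ := peetre_ne_top _ _
    have hQ1 : 1 ≤ Q := one_le_peetre _ _
    have hQ : peetre m (x - b) ≤ 2 * Q := by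
      calc peetre m (x - b) ≤ peetre m (x - b') * peetre m (b' - b) := peetre_sub_le_mul _ _ _ _
        _ ≤ Q * 2 := by
          gcongr
          · exact peetre_mono (by omega) _
          · exact peetre_le_two (by omega) (abs_node_sub_node_le j i' i μ)
        _ = _ := mul_comm _ _
    have hdec : (Q⁻¹) ^ M * (peetre m (x - b) ^ 2) ^ σ ≤ 16 ^ σ * (Q⁻¹) ^ 2 := by
      calc (Q⁻¹) ^ M * (peetre m (x - b) ^ 2) ^ σ ≤ (Q⁻¹) ^ M * ((2 * Q) ^ 2) ^ σ := by gcongr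
        _ = 4 ^ σ * Q ^ (2 * σ - M) := by
          rw [mul_pow, ENNReal.mul_rpow_of_nonneg _ _ hσ, ← ENNReal.rpow_natCast (Q⁻¹) M,
            ENNReal.inv_rpow, ← ENNReal.rpow_neg, ← ENNReal.rpow_natCast Q 2, ← ENNReal.rpow_mul,
            sub_eq_add_neg, ENNReal.rpow_add _ _ hQ0 hQt]
          norm_num
          ring
        _ ≤ 16 ^ σ * Q ^ (-(2 : ℝ)) := by
          gcongr
          · norm_num
          · linarith
        _ = _ := by
          rw [← ENNReal.rpow_natCast (Q⁻¹) 2, ENNReal.inv_rpow, ← ENNReal.rpow_neg]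
          norm_num
    calc (Q⁻¹) ^ M * (g x ^ (-σ) * avgOp n u b ^ r)
        ≤ (Q⁻¹) ^ M * (decayMass ^ (r - 1 - σ) * G ^ σ *
          ((2 ^ (n - m)) ^ σ * (peetre m (x - b) ^ 2) ^ σ) * avgOp n v b) := by
          refine mul_le_mul_right ?_ _
          exact weight_mul_avgOp_rpow_le hσ hσr hg hg0 hG hu (by omega) x b
      _ = (decayMass ^ (r - 1 - σ) * G ^ σ * (2 ^ (n - m)) ^ σ) *
          ((Q⁻¹) ^ M * (peetre m (x - b) ^ 2) ^ σ) * avgOp n v b := by ring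
      _ ≤ (decayMass ^ (r - 1 - σ) * G ^ σ * (2 ^ (n - m)) ^ σ) *
          (16 ^ σ * (Q⁻¹) ^ 2) * avgOp n v b := by gcongr
      _ = _ := by rw [hB]; ring
  have hpt : ∀ x, g x ^ (-σ) * nodeSum M k j n u x ^ r ≤
      ∑' e : Fin 3 × Fin 3 × ℤ, (S ^ (r - 1) * (B * (2 ^ (n - m)) ^ σ) *
        avgOp n v (node j e.1 e.2.2)) * ((peetre k (x - node j e.2.1 e.2.2))⁻¹) ^ 2 := by
    intro x
    calc g x ^ (-σ) * nodeSum M k j n u x ^ r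
        ≤ g x ^ (-σ) * (S ^ (r - 1) * ∑' e : Fin 3 × Fin 3 × ℤ,
          ((peetre k (x - node j e.2.1 e.2.2))⁻¹) ^ M * avgOp n u (node j e.1 e.2.2) ^ r) := by
          gcongr
          refine (tsum_mul_rpow_le hr _ _).trans ?_
          have : 0 ≤ r - 1 := by linarith
          gcongr
          exact tsum_nodes_le k j hM2 x
      _ = S ^ (r - 1) * ∑' e : Fin 3 × Fin 3 × ℤ, ((peetre k (x - node j e.2.1 e.2.2))⁻¹) ^ M *
          (g x ^ (-σ) * avgOp n u (node j e.1 e.2.2) ^ r) := by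
          rw [mul_left_comm, ← ENNReal.tsum_mul_left]
          congr 1
          exact tsum_congr fun e => by ring
      _ ≤ S ^ (r - 1) * ∑' e : Fin 3 × Fin 3 × ℤ, (B * (2 ^ (n - m)) ^ σ) *
          (((peetre k (x - node j e.2.1 e.2.2))⁻¹) ^ 2 * avgOp n v (node j e.1 e.2.2)) := by
          refine mul_le_mul_right (ENNReal.tsum_le_tsum fun e => ?_) _
          exact hterm x e
      _ = _ := by
          rw [← ENNReal.tsum_mul_left]
          exact tsum_congr fun e => by ring
  calc ∫⁻ x, g x ^ (-σ) * nodeSum M k j n u x ^ r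
      ≤ ∫⁻ x, ∑' e : Fin 3 × Fin 3 × ℤ, (S ^ (r - 1) * (B * (2 ^ (n - m)) ^ σ) *
        avgOp n v (node j e.1 e.2.2)) * ((peetre k (x - node j e.2.1 e.2.2))⁻¹) ^ 2 :=
        lintegral_mono hpt
    _ = ∑' e : Fin 3 × Fin 3 × ℤ, (S ^ (r - 1) * (B * (2 ^ (n - m)) ^ σ) *
        ((2 ^ k)⁻¹ * decayMass)) * avgOp n v (node j e.1 e.2.2) := by
        rw [lintegral_tsum (by intro e; fun_prop)]
        refine tsum_congr fun e => ?_
        rw [lintegral_const_mul _ (by fun_prop), lintegral_inv_peetre_sq]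
        ring
    _ ≤ (S ^ (r - 1) * (B * (2 ^ (n - m)) ^ σ) * ((2 ^ k)⁻¹ * decayMass)) *
        (36 * decayMass * 2 ^ (max n j) * ∫⁻ y, v y) := by
        rw [ENNReal.tsum_mul_left]
        gcongr
        exact tsum_avgOp_nodes_le n j hvm
    _ = _ := by
        rw [hS, ENNReal.mul_rpow_of_nonneg _ _ (by linarith : 0 ≤ r - 1)]
        ring

/-- The maximal function associated with the averages at scales `2^{-t}`, `t ≥ 0`. -/
def maxOp (u : ℝ → ℝ≥0∞) (x : ℝ) : ℝ≥0∞ := ⨆ t : ℕ, avgOp t u x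

@[fun_prop]
lemma measurable_maxOp {u : ℝ → ℝ≥0∞} (hu : Measurable u) : Measurable (maxOp u) := by
  unfold maxOp
  exact Measurable.iSup fun t => measurable_avgOp t hu

lemma inv_peetre_sq_le_tsum_indicator (t : ℕ) (z : ℝ) :
    ((peetre t z)⁻¹) ^ 2 ≤ ∑' i : ℕ, 4 * ((4 : ℝ≥0∞)⁻¹) ^ i *
      (Metric.closedBall (0 : ℝ) (2 ^ i / 2 ^ t)).indicator 1 z := by
  have hex : ∃ i : ℕ, 2 ^ t * |z| ≤ 2 ^ i := by
    obtain ⟨i, hi⟩ := pow_unbounded_of_one_lt (2 ^ t * |z|) (one_lt_two (α := ℝ))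
    exact ⟨i, hi.le⟩
  classical
  set i := Nat.find hex with hi_def
  have hi : 2 ^ t * |z| ≤ 2 ^ i := Nat.find_spec hex
  refine le_trans ?_ (ENNReal.le_tsum i)
  have hmem : z ∈ Metric.closedBall (0 : ℝ) (2 ^ i / 2 ^ t) := by
    rw [mem_closedBall_zero_iff, Real.norm_eq_abs, le_div_iff₀ (by positivity)]
    linarith
  rw [Set.indicator_of_mem hmem, Pi.one_apply, mul_one]
  rcases Nat.eq_zero_or_pos i with h0 | hpos
  · rw [h0, pow_zero, mul_one]
    calc ((peetre t z)⁻¹) ^ 2 ≤ 1 ^ 2 := by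
          gcongr
          exact ENNReal.inv_le_one.2 (one_le_peetre _ _)
      _ ≤ 4 := by norm_num
  · have hlt : (2 : ℝ) ^ (i - 1) < 2 ^ t * |z| := by
      have := Nat.find_min hex (m := i - 1) (by omega)
      exact not_le.1 this
    have hE : (2 : ℝ≥0∞) ^ (i - 1) ≤ peetre t z := by
      have h := ENNReal.ofReal_le_ofReal hlt.le
      rw [ENNReal.ofReal_mul (by positivity), ENNReal.ofReal_pow (by norm_num),
        ENNReal.ofReal_pow (by norm_num), ← Real.enorm_eq_ofReal_abs] at h
      unfold peetre
      refine le_trans ?_ le_add_self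
      simpa using h
    have e4 : (4 : ℝ≥0∞) * (4⁻¹) ^ i = ((2 ^ (i - 1))⁻¹) ^ 2 := by
      obtain ⟨l, hl⟩ : ∃ l, i = l + 1 := ⟨i - 1, by omega⟩
      rw [hl, Nat.add_sub_cancel, pow_succ, mul_comm, mul_assoc,
        ENNReal.inv_mul_cancel (by norm_num) (by norm_num), mul_one, ← ENNReal.inv_pow,
        ← ENNReal.inv_pow, ← pow_mul, mul_comm l 2, pow_mul]
      norm_num
    rw [e4]
    gcongr

lemma avgOp_le_of_ball_average_le (t : ℕ) {u : ℝ → ℝ≥0∞} (hu : Measurable u) (x : ℝ) (a : ℝ≥0∞)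
    (h : ∀ R : ℝ, 0 < R → ∫⁻ y in Metric.closedBall x R, u y ≤ a * ENNReal.ofReal (2 * R)) :
    avgOp t u x ≤ 16 * a := by
  have h1 : avgOp t u x ≤ ∑' i : ℕ, 2 ^ t * (4 * ((4 : ℝ≥0∞)⁻¹) ^ i) *
      ∫⁻ y in Metric.closedBall x (2 ^ i / 2 ^ t), u y := by
    unfold avgOp
    calc ∫⁻ y, avgKer t (x - y) * u y
        ≤ ∫⁻ y, ∑' i : ℕ, 2 ^ t * (4 * ((4 : ℝ≥0∞)⁻¹) ^ i) *
          (Metric.closedBall x (2 ^ i / 2 ^ t)).indicator u y := by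
          refine lintegral_mono fun y => ?_
          unfold avgKer
          calc 2 ^ t * ((peetre t (x - y))⁻¹) ^ 2 * u y
              ≤ 2 ^ t * (∑' i : ℕ, 4 * ((4 : ℝ≥0∞)⁻¹) ^ i *
                (Metric.closedBall (0 : ℝ) (2 ^ i / 2 ^ t)).indicator 1 (x - y)) * u y := by
                gcongr
                exact inv_peetre_sq_le_tsum_indicator t (x - y)
            _ = _ := by
                rw [← ENNReal.tsum_mul_left, ← ENNReal.tsum_mul_right]
                refine tsum_congr fun i => ?_
                by_cases hy : y ∈ Metric.closedBall x (2 ^ i / 2 ^ t)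
                · have hy' : x - y ∈ Metric.closedBall (0 : ℝ) (2 ^ i / 2 ^ t) := by
                    rw [mem_closedBall_zero_iff, ← dist_eq_norm, dist_comm]
                    exact hy
                  simp [Set.indicator_of_mem hy, Set.indicator_of_mem hy']
                · have hy' : x - y ∉ Metric.closedBall (0 : ℝ) (2 ^ i / 2 ^ t) := by
                    rw [mem_closedBall_zero_iff, ← dist_eq_norm, dist_comm]
                    exact hy
                  simp [Set.indicator_of_notMem hy, Set.indicator_of_notMem hy']
      _ = _ := by
          rw [lintegral_tsum fun i =>
            ((hu.indicator measurableSet_closedBall).const_mul _).aemeasurable]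
          refine tsum_congr fun i => ?_
          rw [lintegral_const_mul _ (hu.indicator measurableSet_closedBall),
            lintegral_indicator measurableSet_closedBall]
  refine h1.trans ?_
  calc ∑' i : ℕ, 2 ^ t * (4 * ((4 : ℝ≥0∞)⁻¹) ^ i) *
        ∫⁻ y in Metric.closedBall x (2 ^ i / 2 ^ t), u y
      ≤ ∑' i : ℕ, 8 * a * ((2 : ℝ≥0∞)⁻¹) ^ i := by
        refine ENNReal.tsum_le_tsum fun i => ?_
        calc 2 ^ t * (4 * ((4 : ℝ≥0∞)⁻¹) ^ i) *
              ∫⁻ y in Metric.closedBall x (2 ^ i / 2 ^ t), u y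
            ≤ 2 ^ t * (4 * ((4 : ℝ≥0∞)⁻¹) ^ i) * (a * ENNReal.ofReal (2 * (2 ^ i / 2 ^ t))) := by
              gcongr
              exact h _ (by positivity)
          _ = 8 * a * ((2 : ℝ≥0∞)⁻¹) ^ i := by
              have e : ENNReal.ofReal (2 * (2 ^ i / 2 ^ t)) = 2 * (2 ^ i * (2 ^ t)⁻¹) := by
                rw [ENNReal.ofReal_mul (by norm_num), ENNReal.ofReal_div_of_pos (by positivity),
                  ENNReal.ofReal_pow (by norm_num), ENNReal.ofReal_pow (by norm_num)]
                simp [div_eq_mul_inv]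
              have e4 : ((4 : ℝ≥0∞)⁻¹) ^ i = ((2 : ℝ≥0∞)⁻¹) ^ i * ((2 : ℝ≥0∞)⁻¹) ^ i := by
                rw [← mul_pow, ← ENNReal.mul_inv (by simp) (by simp)]
                norm_num
              have e2 : ((2 : ℝ≥0∞)⁻¹) ^ i * 2 ^ i = 1 := by
                rw [← mul_pow, ENNReal.inv_mul_cancel (by simp) (by simp), one_pow]
              have et : (2 : ℝ≥0∞) ^ t * (2 ^ t)⁻¹ = 1 :=
                ENNReal.mul_inv_cancel (by simp) (by simp)
              rw [e, e4]
              calc 2 ^ t * (4 * (((2 : ℝ≥0∞)⁻¹) ^ i * ((2 : ℝ≥0∞)⁻¹) ^ i)) *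
                    (a * (2 * (2 ^ i * (2 ^ t)⁻¹)))
                  = 8 * a * ((2 : ℝ≥0∞)⁻¹) ^ i * (((2 : ℝ≥0∞)⁻¹) ^ i * 2 ^ i) *
                    (2 ^ t * (2 ^ t)⁻¹) := by ring
                _ = _ := by rw [e2, et, mul_one, mul_one]
    _ = 16 * a := by
        rw [ENNReal.tsum_mul_left, ENNReal.tsum_geometric, ENNReal.one_sub_inv_two, inv_inv]
        ring

lemma volume_ball_average_gt_le {u : ℝ → ℝ≥0∞} (hfin : ∫⁻ y, u y ≠ ⊤)
    {a : ℝ≥0∞} (ha0 : a ≠ 0) (hat : a ≠ ⊤) :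
    volume {x : ℝ | ∃ R : ℝ, 0 < R ∧
      a * ENNReal.ofReal (2 * R) < ∫⁻ y in Metric.closedBall x R, u y} ≤
      4 * a⁻¹ * ∫⁻ y, u y := by
  set S := {x : ℝ | ∃ R : ℝ, 0 < R ∧
      a * ENNReal.ofReal (2 * R) < ∫⁻ y in Metric.closedBall x R, u y} with hS
  have hch : ∀ x : ℝ, ∃ R : ℝ, x ∈ S → 0 < R ∧
      a * ENNReal.ofReal (2 * R) < ∫⁻ y in Metric.closedBall x R, u y := by
    intro x
    by_cases hx : x ∈ S
    · obtain ⟨R, hR⟩ := hx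
      exact ⟨R, fun _ => hR⟩
    · exact ⟨0, fun h => absurd h hx⟩
  choose R hR using hch
  have hbound : ∀ x ∈ S, R x ≤ (a⁻¹ * ∫⁻ y, u y).toReal := by
    intro x hx
    obtain ⟨hpos, hlt⟩ := hR x hx
    have h1 : a * ENNReal.ofReal (2 * R x) ≤ ∫⁻ y, u y :=
      hlt.le.trans (setLIntegral_le_lintegral _ _)
    have h2 : ENNReal.ofReal (2 * R x) ≤ a⁻¹ * ∫⁻ y, u y := by
      rw [← one_mul (ENNReal.ofReal _), ← ENNReal.inv_mul_cancel ha0 hat, mul_assoc]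
      gcongr
    have h3 := (ENNReal.ofReal_le_iff_le_toReal (by finiteness)).1 h2
    linarith
  obtain ⟨U, hUS, hdisj, hcov⟩ :=
    Vitali.exists_disjoint_subfamily_covering_enlargement_closedBall S (fun x => x) R _ hbound 4
      (by norm_num)
  have hUc : U.Countable := by
    refine hdisj.countable_of_nonempty_interior fun x hx => ?_
    rw [interior_closedBall _ (hR x (hUS hx)).1.ne']
    exact ⟨x, Metric.mem_ball_self (hR x (hUS hx)).1⟩
  have hsub : S ⊆ ⋃ x ∈ U, Metric.closedBall x (4 * R x) := by
    intro x hx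
    obtain ⟨b, hb, hsub⟩ := hcov x hx
    exact Set.mem_biUnion hb (hsub (Metric.mem_closedBall_self (hR x hx).1.le))
  have := hUc.to_subtype
  calc volume S ≤ volume (⋃ x ∈ U, Metric.closedBall x (4 * R x)) := measure_mono hsub
    _ ≤ ∑' x : U, volume (Metric.closedBall (x : ℝ) (4 * R x)) := measure_biUnion_le _ hUc _
    _ ≤ ∑' x : U, 4 * a⁻¹ * ∫⁻ y in Metric.closedBall (x : ℝ) (R x), u y := by
        refine ENNReal.tsum_le_tsum fun x => ?_
        obtain ⟨hpos, hlt⟩ := hR x (hUS x.2)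
        rw [Real.volume_closedBall]
        calc ENNReal.ofReal (2 * (4 * R x)) = 4 * ENNReal.ofReal (2 * R x) := by
              rw [show 2 * (4 * R x) = 4 * (2 * R x) by ring, ENNReal.ofReal_mul (by norm_num)]
              simp
          _ = 4 * a⁻¹ * (a * ENNReal.ofReal (2 * R x)) := by
              rw [mul_assoc, ← mul_assoc a⁻¹, ENNReal.inv_mul_cancel ha0 hat, one_mul]
          _ ≤ _ := by gcongr
    _ = 4 * a⁻¹ * ∫⁻ y in ⋃ x ∈ U, Metric.closedBall x (R x), u y := by
        rw [ENNReal.tsum_mul_left, lintegral_biUnion hUc (fun _ _ => measurableSet_closedBall)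
          hdisj]
    _ ≤ _ := by
        gcongr
        exact Measure.restrict_le_self

/-- Weak type inequality for the maximal function. -/
lemma volume_maxOp_gt_le {u : ℝ → ℝ≥0∞} (hu : Measurable u) {a : ℝ≥0∞} (ha0 : a ≠ 0)
    (hat : a ≠ ⊤) : volume {x | 16 * a < maxOp u x} ≤ 4 * a⁻¹ * ∫⁻ y, u y := by
  by_cases hfin : ∫⁻ y, u y = ⊤
  · rw [hfin, ENNReal.mul_top]
    · exact le_top
    · simp [hat]
  refine le_trans (measure_mono fun x hx => ?_) (volume_ball_average_gt_le hfin ha0 hat)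
  by_contra hcon
  simp only [Set.mem_ofPred_eq, not_exists, not_and, not_lt] at hcon hx
  exact absurd hx (not_lt.2 (iSup_le fun t => avgOp_le_of_ball_average_le t hu x a hcon))

/-- Weak type inequality where only the large values of the function enter. -/
lemma volume_maxOp_gt_le_setLIntegral {u : ℝ → ℝ≥0∞} (hu : Measurable u) {a : ℝ≥0∞}
    (ha0 : a ≠ 0) (hat : a ≠ ⊤) :
    volume {x | (16 + decayMass) * a < maxOp u x} ≤ 4 * a⁻¹ * ∫⁻ y in {y | a < u y}, u y := by
  have hs : MeasurableSet {y | a < u y} := measurableSet_lt measurable_const hu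
  rw [← lintegral_indicator hs]
  refine le_trans (measure_mono fun x hx => ?_)
    (volume_maxOp_gt_le (hu.indicator hs) ha0 hat)
  simp only [Set.mem_ofPred_eq] at hx ⊢
  by_contra hcon
  rw [not_lt] at hcon
  refine absurd hx (not_lt.2 (iSup_le fun t => ?_))
  calc avgOp t u x ≤ ∫⁻ y, (avgKer t (x - y) * ({y | a < u y}.indicator u y) +
        avgKer t (x - y) * a) := by
        refine lintegral_mono fun y => ?_
        simp only
        rw [← mul_add]
        gcongr
        by_cases hy : y ∈ {y | a < u y}
        · rw [Set.indicator_of_mem hy]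
          exact le_self_add
        · rw [Set.indicator_of_notMem hy, zero_add]
          exact not_lt.1 hy
    _ = avgOp t ({y | a < u y}.indicator u) x + decayMass * a := by
        rw [lintegral_add_right _ (by fun_prop), lintegral_mul_const _ (by fun_prop),
          lintegral_avgKer_sub]
        rfl
    _ ≤ 16 * a + decayMass * a := by
        gcongr
        exact (le_iSup (fun t => avgOp t ({y | a < u y}.indicator u) x) t).trans hcon
    _ = _ := by ring

lemma lintegral_rpow_eq_layer_cake {μ : Measure ℝ} {w : ℝ → ℝ≥0∞} (hw : Measurable w)
    (hfin : ∀ᵐ x ∂μ, w x ≠ ⊤) {p : ℝ} (hp : 0 < p) :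
    ∫⁻ x, w x ^ p ∂μ = ENNReal.ofReal p *
      ∫⁻ t in Set.Ioi 0, μ {x | ENNReal.ofReal t < w x} * ENNReal.ofReal (t ^ (p - 1)) := by
  have h := lintegral_rpow_eq_lintegral_meas_lt_mul μ (f := fun x => (w x).toReal)
    (ae_of_all _ fun x => ENNReal.toReal_nonneg) hw.ennreal_toReal.aemeasurable hp
  have e1 : ∫⁻ x, w x ^ p ∂μ = ∫⁻ x, ENNReal.ofReal ((w x).toReal ^ p) ∂μ := by
    refine lintegral_congr_ae ?_
    filter_upwards [hfin] with x hx
    rw [← ENNReal.ofReal_rpow_of_nonneg ENNReal.toReal_nonneg hp.le, ENNReal.ofReal_toReal hx]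
  rw [e1, h]
  congr 1
  refine setLIntegral_congr_fun measurableSet_Ioi fun t ht => ?_
  congr 1
  refine measure_congr ?_
  filter_upwards [hfin] with x hx
  exact propext (ENNReal.ofReal_lt_iff_lt_toReal (le_of_lt ht) hx).symm

lemma lintegral_rpow_le_layer_cake {μ : Measure ℝ} {w : ℝ → ℝ≥0∞} (hw : Measurable w)
    {p : ℝ} (hp : 0 < p) :
    ∫⁻ x, w x ^ p ∂μ ≤ ENNReal.ofReal p *
      ∫⁻ t in Set.Ioi 0, μ {x | ENNReal.ofReal t < w x} * ENNReal.ofReal (t ^ (p - 1)) := by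
  have hsup : ∀ x, w x ^ p = ⨆ N : ℕ, (min (w x) N) ^ p := by
    intro x
    have hmono : Monotone fun y : ℝ≥0∞ => y ^ p := ENNReal.monotone_rpow_of_nonneg hp.le
    refine le_antisymm ?_ (iSup_le fun N => hmono (min_le_left _ _))
    have h1 : w x = ⨆ N : ℕ, min (w x) N := by
      rw [← inf_iSup_eq, ENNReal.iSup_natCast, inf_top_eq]
    conv_lhs => rw [h1]
    rw [← ENNReal.orderIsoRpow_apply p hp, OrderIso.map_iSup]
    rfl
  simp_rw [hsup]
  rw [lintegral_iSup (fun N => by fun_prop)]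
  · refine iSup_le fun N => ?_
    rw [lintegral_rpow_eq_layer_cake (by fun_prop) (ae_of_all _ fun x =>
      ne_top_of_le_ne_top (ENNReal.natCast_ne_top N) (min_le_right _ _)) hp]
    gcongr
    exact min_le_left _ _
  · intro a b hab x
    simp only
    gcongr

/-- The maximal function is bounded on `L^p` for `p > 1`. -/
lemma exists_lintegral_maxOp_rpow_le {p : ℝ} (hp : 1 < p) :
    ∃ C : ℝ≥0∞, C ≠ ⊤ ∧ ∀ u : ℝ → ℝ≥0∞, Measurable u →
      ∫⁻ x, maxOp u x ^ p ≤ C * ∫⁻ x, u x ^ p := by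
  set c : ℝ≥0∞ := 16 + decayMass with hc
  have hct : c ≠ ⊤ := by
    have := decayMass_ne_top
    finiteness
  have hc0 : c ≠ 0 := by simp [hc]
  have hp1 : 0 < p - 1 := by linarith
  refine ⟨ENNReal.ofReal p * (4 * c * ((ENNReal.ofReal (p - 1))⁻¹ * c ^ (p - 1))), ?_, ?_⟩
  · have : ENNReal.ofReal (p - 1) ≠ 0 := by simpa using hp
    finiteness
  intro u hu
  by_cases hfin : ∫⁻ x, u x ^ p = ⊤
  · rw [hfin, ENNReal.mul_top]
    · exact le_top
    · simp only [ne_eq, mul_eq_zero, not_or, ENNReal.inv_eq_zero, ENNReal.rpow_eq_zero_iff]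
      refine ⟨by simp; linarith, ⟨by simp, hc0⟩, by simp, by simp [hc0, hct]⟩
  have hae : ∀ᵐ x, u x ≠ ⊤ := by
    filter_upwards [ae_lt_top (by fun_prop) hfin] with x hx h
    rw [h, ENNReal.top_rpow_of_pos (by linarith)] at hx
    exact lt_irrefl _ hx
  set ν := volume.withDensity u with hν
  have hac : ν ≪ volume := withDensity_absolutelyContinuous _ _
  have hlc := lintegral_rpow_eq_layer_cake (μ := ν) (w := fun x => c * u x) (by fun_prop)
    (by filter_upwards [hac.ae_le hae] with x hx using ENNReal.mul_ne_top hct hx) hp1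
  have hweak : ∀ t ∈ Set.Ioi (0 : ℝ),
      volume {x | ENNReal.ofReal t < maxOp u x} * ENNReal.ofReal (t ^ (p - 1)) ≤
      4 * c * (ν {x | ENNReal.ofReal t < c * u x} * ENNReal.ofReal (t ^ (p - 1 - 1))) := by
    intro t ht
    have ht0 : ENNReal.ofReal t ≠ 0 := by simpa using ht
    have htt : ENNReal.ofReal t ≠ ⊤ := ENNReal.ofReal_ne_top
    have e := volume_maxOp_gt_le_setLIntegral hu (a := ENNReal.ofReal t / c)
      (ENNReal.div_ne_zero.2 ⟨ht0, hct⟩) (ENNReal.div_ne_top htt hc0)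
    rw [← hc, ENNReal.mul_div_cancel hc0 hct] at e
    have hset : {x | ENNReal.ofReal t < c * u x} = {y | ENNReal.ofReal t / c < u y} := by
      ext x
      rw [Set.mem_ofPred_eq, Set.mem_ofPred_eq,
        ENNReal.div_lt_iff (Or.inl hc0) (Or.inl hct), mul_comm]
    rw [hset, hν, withDensity_apply _ (measurableSet_lt (by fun_prop) hu)]
    have hpow : ENNReal.ofReal (t ^ (p - 1)) = ENNReal.ofReal t * ENNReal.ofReal (t ^ (p - 1 - 1)) := by
      rw [← ENNReal.ofReal_mul (le_of_lt ht)]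
      congr 1
      rw [← Real.rpow_one_add' (le_of_lt ht) (by linarith)]
      ring_nf
    rw [hpow]
    calc volume {x | ENNReal.ofReal t < maxOp u x} *
          (ENNReal.ofReal t * ENNReal.ofReal (t ^ (p - 1 - 1)))
        ≤ (4 * (ENNReal.ofReal t / c)⁻¹ * ∫⁻ y in {y | ENNReal.ofReal t / c < u y}, u y) *
          (ENNReal.ofReal t * ENNReal.ofReal (t ^ (p - 1 - 1))) := by gcongr
      _ = 4 * c * ((∫⁻ y in {y | ENNReal.ofReal t / c < u y}, u y) *
          ENNReal.ofReal (t ^ (p - 1 - 1))) * ((ENNReal.ofReal t)⁻¹ * ENNReal.ofReal t) := by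
          rw [ENNReal.inv_div (Or.inl hct) (Or.inl hc0), div_eq_mul_inv]
          ring
      _ = _ := by rw [ENNReal.inv_mul_cancel ht0 htt, mul_one]
  have hp10 : ENNReal.ofReal (p - 1) ≠ 0 := by simpa using hp
  have hfinal : ∫⁻ t in Set.Ioi 0, ν {x | ENNReal.ofReal t < c * u x} *
      ENNReal.ofReal (t ^ (p - 1 - 1)) =
      (ENNReal.ofReal (p - 1))⁻¹ * (c ^ (p - 1) * ∫⁻ x, u x ^ p) := by
    have e2 : ∫⁻ x, (c * u x) ^ (p - 1) ∂ν = c ^ (p - 1) * ∫⁻ x, u x ^ p := by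
      rw [hν, lintegral_withDensity_eq_lintegral_mul _ hu (by fun_prop),
        ← lintegral_const_mul _ (by fun_prop)]
      refine lintegral_congr fun x => ?_
      rw [Pi.mul_apply, ENNReal.mul_rpow_of_nonneg _ _ hp1.le, mul_left_comm]
      congr 1
      conv_rhs => rw [show p = 1 + (p - 1) by ring,
        ENNReal.rpow_add_of_nonneg _ _ zero_le_one hp1.le, ENNReal.rpow_one]
    rw [← e2, hlc, ← mul_assoc, ENNReal.inv_mul_cancel hp10 ENNReal.ofReal_ne_top, one_mul]
  calc ∫⁻ x, maxOp u x ^ p ≤ _ := lintegral_rpow_le_layer_cake (measurable_maxOp hu) (by linarith)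
    _ ≤ ENNReal.ofReal p * ∫⁻ t in Set.Ioi 0, 4 * c *
        (ν {x | ENNReal.ofReal t < c * u x} * ENNReal.ofReal (t ^ (p - 1 - 1))) := by
        gcongr ENNReal.ofReal p * ?_
        exact setLIntegral_mono' measurableSet_Ioi hweak
    _ = _ := by
        rw [lintegral_const_mul' _ _ (by finiteness), hfinal]
        ring

lemma avgOp_tsum (t : ℕ) {u : ℕ → ℝ → ℝ≥0∞} (hu : ∀ i, Measurable (u i)) (x : ℝ) :
    avgOp t (fun y => ∑' i, u i y) x = ∑' i, avgOp t (u i) x := by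
  unfold avgOp
  rw [← lintegral_tsum fun i => by have := hu i; fun_prop]
  simp_rw [ENNReal.tsum_mul_left]

lemma avgOp_const_mul (t : ℕ) {u : ℝ → ℝ≥0∞} (hu : Measurable u) (c : ℝ≥0∞) (x : ℝ) :
    avgOp t (fun y => c * u y) x = c * avgOp t u x := by
  unfold avgOp
  rw [← lintegral_const_mul _ (by fun_prop)]
  simp_rw [mul_left_comm]

/-- Every function in `L^p`, `p > 1`, has a majorant of comparable norm which is invariant under
the averaging operators, up to a constant (the Rubio de Francia construction). -/
lemma exists_majorant {p : ℝ} (hp : 1 < p) :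
    ∃ G : ℝ≥0∞, G ≠ ⊤ ∧ ∀ S : ℝ → ℝ≥0∞, Measurable S → ∃ g : ℝ → ℝ≥0∞, Measurable g ∧
      (∀ x, S x ≤ g x) ∧ (∀ m x, avgOp m g x ≤ G * g x) ∧
      ∫⁻ x, g x ^ p ≤ 2 ^ p * ∫⁻ x, S x ^ p := by
  obtain ⟨C₀, hC₀, hmax⟩ := exists_lintegral_maxOp_rpow_le hp
  set C := max 1 C₀ with hC
  have hp0 : 0 < p := by linarith
  have hCt : C ≠ ⊤ := by simp [hC, hC₀]
  have hC1 : 1 ≤ C := le_max_left _ _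
  have hC0 : C ≠ 0 := (lt_of_lt_of_le zero_lt_one hC1).ne'
  have hmax' : ∀ u : ℝ → ℝ≥0∞, Measurable u → ∫⁻ x, maxOp u x ^ p ≤ C ^ p * ∫⁻ x, u x ^ p := by
    intro u hu
    refine (hmax u hu).trans ?_
    gcongr
    calc C₀ ≤ C := le_max_right _ _
      _ = C ^ (1 : ℝ) := by simp
      _ ≤ C ^ p := ENNReal.rpow_le_rpow_of_exponent_le hC1 hp.le
  refine ⟨2 * C, by finiteness, fun S hS => ?_⟩
  set T : ℕ → ℝ → ℝ≥0∞ := fun i => maxOp^[i] S with hT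
  have hTs : ∀ i, T (i + 1) = maxOp (T i) := fun i => Function.iterate_succ_apply' _ _ _
  have hTm : ∀ i, Measurable (T i) := by
    intro i
    induction i with
    | zero => exact hS
    | succ i ih =>
      rw [hTs]
      exact measurable_maxOp ih
  have hTp : ∀ i, ∫⁻ x, T i x ^ p ≤ (C ^ p) ^ i * ∫⁻ x, S x ^ p := by
    intro i
    induction i with
    | zero => simp [hT]
    | succ i ih =>
      rw [hTs]
      refine (hmax' _ (hTm i)).trans ?_
      rw [pow_succ', mul_assoc]
      gcongr
  refine ⟨fun x => ∑' i, ((2 * C)⁻¹) ^ i * T i x, ?_, ?_, ?_, ?_⟩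
  · exact Measurable.tsum fun i => by have := hTm i; fun_prop
  · intro x
    refine le_trans ?_ (ENNReal.le_tsum 0)
    simp [hT]
  · intro m x
    rw [avgOp_tsum m (fun i => by have := hTm i; fun_prop)]
    have h2 : (2 * C) ≠ 0 := by simp [hC0]
    have h2t : (2 * C) ≠ ⊤ := by finiteness
    calc ∑' i, avgOp m (fun y => ((2 * C)⁻¹) ^ i * T i y) x
        ≤ ∑' i, 2 * C * (((2 * C)⁻¹) ^ (i + 1) * T (i + 1) x) := by
          refine ENNReal.tsum_le_tsum fun i => ?_
          rw [avgOp_const_mul m (hTm i), pow_succ', mul_assoc (2 * C)⁻¹, ← mul_assoc (2 * C),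
            ENNReal.mul_inv_cancel h2 h2t, one_mul, hTs]
          gcongr
          exact le_iSup (fun t => avgOp t (T i) x) m
      _ = 2 * C * ∑' i, (((2 * C)⁻¹) ^ (i + 1) * T (i + 1) x) := ENNReal.tsum_mul_left
      _ ≤ _ := by
          gcongr
          simp only
          rw [tsum_eq_zero_add' ENNReal.summable (f := fun i => ((2 * C)⁻¹) ^ i * T i x)]
          exact le_add_self
  · have hgeo : ∑' i : ℕ, ((2 : ℝ≥0∞)⁻¹) ^ i = 2 := by
      rw [ENNReal.tsum_geometric, ENNReal.one_sub_inv_two, inv_inv]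
    calc ∫⁻ x, (∑' i, ((2 * C)⁻¹) ^ i * T i x) ^ p
        ≤ ∫⁻ x, 2 ^ (p - 1) * ∑' i, ((2 : ℝ≥0∞)⁻¹) ^ i * ((C⁻¹) ^ i * T i x) ^ p := by
          refine lintegral_mono fun x => ?_
          have h := tsum_mul_rpow_le hp.le (fun i : ℕ => ((2 : ℝ≥0∞)⁻¹) ^ i)
            (fun i => (C⁻¹) ^ i * T i x)
          rw [hgeo] at h
          refine le_trans (le_of_eq ?_) h
          congr 1
          refine tsum_congr fun i => ?_
          rw [ENNReal.mul_inv (by simp) (by simp), mul_pow, mul_assoc]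
      _ = 2 ^ (p - 1) * ∑' i, ((2 : ℝ≥0∞)⁻¹) ^ i * (((C⁻¹) ^ i) ^ p * ∫⁻ x, T i x ^ p) := by
          rw [lintegral_const_mul _ (Measurable.tsum fun i => by have := hTm i; fun_prop),
            lintegral_tsum fun i => by have := hTm i; fun_prop]
          congr 1
          refine tsum_congr fun i => ?_
          have := hTm i
          simp_rw [ENNReal.mul_rpow_of_nonneg _ _ hp0.le]
          rw [lintegral_const_mul _ (by fun_prop), lintegral_const_mul _ (by fun_prop)]
      _ ≤ 2 ^ (p - 1) * ∑' i : ℕ, ((2 : ℝ≥0∞)⁻¹) ^ i * ∫⁻ x, S x ^ p := by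
          gcongr with i
          calc ((C⁻¹) ^ i) ^ p * ∫⁻ x, T i x ^ p
              ≤ ((C⁻¹) ^ i) ^ p * ((C ^ p) ^ i * ∫⁻ x, S x ^ p) := by
                gcongr
                exact hTp i
            _ = ∫⁻ x, S x ^ p := by
                have e : (C ^ p) ^ i = (C ^ i) ^ p := by
                  rw [← ENNReal.rpow_natCast, ← ENNReal.rpow_natCast, ← ENNReal.rpow_mul,
                    ← ENNReal.rpow_mul, mul_comm]
                rw [e, ← mul_assoc, ← ENNReal.mul_rpow_of_nonneg _ _ hp0.le, ← mul_pow,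
                  ENNReal.inv_mul_cancel hC0 hCt, one_pow, ENNReal.one_rpow, one_mul]
      _ = 2 ^ p * ∫⁻ x, S x ^ p := by
          rw [ENNReal.tsum_mul_right, hgeo, ← mul_assoc]
          congr 1
          nth_rewrite 2 [← ENNReal.rpow_one 2]
          rw [← ENNReal.rpow_add_of_nonneg _ _ (by linarith) zero_le_one]
          ring_nf

lemma node_le_node (j : ℕ) {i i' : Fin 3} (h : i ≤ i') (μ : ℤ) : node j i μ ≤ node j i' μ := by
  unfold node
  gcongr
  exact h

lemma node_one (j : ℕ) (μ : ℤ) : node j 1 μ = node j 0 μ + 2 ^ (-(j : ℤ)) / 2 := by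
  simp [node]
  ring

lemma node_two (j : ℕ) (μ : ℤ) : node j 2 μ = node j 1 μ + 2 ^ (-(j : ℤ)) / 2 := by
  simp [node]
  ring

lemma haarFn_eq (j : ℕ) (μ : ℤ) (x : ℝ) :
    haarFn j μ x = (Set.Ico (node j 0 μ) (node j 1 μ)).indicator (fun _ => (1 : ℂ)) x -
      (Set.Ico (node j 1 μ) (node j 2 μ)).indicator (fun _ => (1 : ℂ)) x := by
  simp [haarFn, node]

lemma integral_mul_haarFn {g : ℝ → ℂ} (hg : Continuous g) (j : ℕ) (μ : ℤ) :
    ∫ t, g t * haarFn j μ t =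
      (∫ t in (node j 0 μ)..(node j 1 μ), g t) - ∫ t in (node j 1 μ)..(node j 2 μ), g t := by
  have h1 : node j 0 μ ≤ node j 1 μ := node_le_node j (by decide) μ
  have h2 : node j 1 μ ≤ node j 2 μ := node_le_node j (by decide) μ
  have hi : ∀ a b : ℝ, Integrable ((Set.Ico a b).indicator g) := fun a b =>
    (hg.integrableOn_Icc.mono_set Set.Ico_subset_Icc_self).integrable_indicator measurableSet_Ico
  rw [intervalIntegral.integral_of_le h1, intervalIntegral.integral_of_le h2,
    ← integral_Ico_eq_integral_Ioc, ← integral_Ico_eq_integral_Ioc,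
    ← integral_indicator measurableSet_Ico, ← integral_indicator measurableSet_Ico,
    ← integral_sub (hi _ _) (hi _ _)]
  refine integral_congr_ae (ae_of_all _ fun t => ?_)
  simp only [haarFn_eq, mul_sub, Set.indicator_apply]
  split_ifs <;> simp

lemma integrable_haarFn (j : ℕ) (μ : ℤ) : Integrable (haarFn j μ) := by
  have hi : ∀ a b : ℝ, Integrable ((Set.Ico a b).indicator fun _ => (1 : ℂ)) := fun a b =>
    (integrableOn_const (by simp)).integrable_indicator measurableSet_Ico
  have : haarFn j μ = fun x => (Set.Ico (node j 0 μ) (node j 1 μ)).indicator (fun _ => (1 : ℂ)) x -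
      (Set.Ico (node j 1 μ) (node j 2 μ)).indicator (fun _ => (1 : ℂ)) x :=
    funext fun x => haarFn_eq j μ x
  rw [this]
  exact (hi _ _).sub (hi _ _)

lemma enorm_integral_mul_haarFn_le_of_antideriv {g V : ℝ → ℂ} (hg : Continuous g)
    (hV : ∀ t, HasDerivAt V (g t) t) (j : ℕ) (μ : ℤ) :
    ‖∫ t, g t * haarFn j μ t‖ₑ ≤ 2 * ∑ i : Fin 3, ‖V (node j i μ)‖ₑ := by
  rw [integral_mul_haarFn hg,
    intervalIntegral.integral_eq_sub_of_hasDerivAt (fun t _ => hV t) (hg.intervalIntegrable _ _),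
    intervalIntegral.integral_eq_sub_of_hasDerivAt (fun t _ => hV t) (hg.intervalIntegrable _ _),
    Fin.sum_univ_three]
  calc ‖V (node j 1 μ) - V (node j 0 μ) - (V (node j 2 μ) - V (node j 1 μ))‖ₑ
      ≤ (‖V (node j 1 μ)‖ₑ + ‖V (node j 0 μ)‖ₑ) + (‖V (node j 2 μ)‖ₑ + ‖V (node j 1 μ)‖ₑ) :=
        enorm_sub_le.trans (add_le_add enorm_sub_le enorm_sub_le)
    _ ≤ (‖V (node j 1 μ)‖ₑ + ‖V (node j 0 μ)‖ₑ) + (‖V (node j 2 μ)‖ₑ + ‖V (node j 1 μ)‖ₑ) +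
        (‖V (node j 0 μ)‖ₑ + ‖V (node j 2 μ)‖ₑ) := le_self_add
    _ = _ := by ring

lemma enorm_integral_mul_haarFn_le_of_deriv {g g' : ℝ → ℂ} (hg : ∀ t, HasDerivAt g (g' t) t)
    (j : ℕ) (μ : ℤ) {B : ℝ≥0∞} (hB : B ≠ ⊤)
    (hb : ∀ t ∈ Set.Icc (node j 0 μ) (node j 2 μ), ‖g' t‖ₑ ≤ B) :
    ‖∫ t, g t * haarFn j μ t‖ₑ ≤ ((2 ^ j)⁻¹) ^ 2 * B := by
  have hc : Continuous g := continuous_iff_continuousAt.2 fun t => (hg t).continuousAt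
  set δ : ℝ := 2 ^ (-(j : ℤ)) / 2 with hδ
  have hδ0 : 0 < δ := by positivity
  have e1 := node_one j μ
  have e2 := node_two j μ
  rw [← hδ] at e1 e2
  have hshift : ∫ t in (node j 1 μ)..(node j 2 μ), g t =
      ∫ t in (node j 0 μ)..(node j 1 μ), g (t + δ) := by
    rw [intervalIntegral.integral_comp_add_right, e2, e1]
  rw [integral_mul_haarFn hc, hshift, ← intervalIntegral.integral_sub
    (hc.intervalIntegrable _ _) (Continuous.intervalIntegrable (by fun_prop) _ _)]
  have hbr : ∀ t ∈ Set.Icc (node j 0 μ) (node j 2 μ), ‖g' t‖ ≤ B.toReal := by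
    intro t ht
    have := ENNReal.toReal_mono hB (hb t ht)
    simpa using this
  have hpt : ∀ t ∈ Set.uIoc (node j 0 μ) (node j 1 μ), ‖g t - g (t + δ)‖ ≤ B.toReal * δ := by
    intro t ht
    rw [Set.uIoc_of_le (by linarith)] at ht
    have h := (convex_Icc (node j 0 μ) (node j 2 μ)).norm_image_sub_le_of_norm_hasDerivWithin_le
      (fun y hy => (hg y).hasDerivWithinAt) hbr (x := t + δ) (y := t)
      ⟨by linarith [ht.1], by linarith [ht.2]⟩ ⟨by linarith [ht.1], by linarith [ht.2]⟩
    have e : ‖t - (t + δ)‖ = δ := by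
      rw [show t - (t + δ) = -δ by ring, norm_neg, Real.norm_of_nonneg hδ0.le]
    rwa [e] at h
  have h := intervalIntegral.norm_integral_le_of_norm_le_const hpt
  have e3 : |node j 1 μ - node j 0 μ| = δ := by
    rw [e1, add_sub_cancel_left, abs_of_pos hδ0]
  rw [e3] at h
  have hfin : ‖∫ t in (node j 0 μ)..(node j 1 μ), (g t - g (t + δ))‖ ≤
      ((2 ^ j)⁻¹) ^ 2 * B.toReal := by
    refine h.trans ?_
    have : δ ≤ (2 ^ j)⁻¹ := by
      rw [hδ, zpow_neg, zpow_natCast]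
      linarith [show (0 : ℝ) < (2 ^ j)⁻¹ by positivity]
    have hBn : 0 ≤ B.toReal := ENNReal.toReal_nonneg
    calc B.toReal * δ * δ ≤ B.toReal * (2 ^ j)⁻¹ * (2 ^ j)⁻¹ := by gcongr
      _ = _ := by ring
  rw [← ofReal_norm]
  refine (ENNReal.ofReal_le_ofReal hfin).trans (le_of_eq ?_)
  rw [ENNReal.ofReal_mul (by positivity), ENNReal.ofReal_pow (by positivity),
    ENNReal.ofReal_inv_of_pos (by positivity), ENNReal.ofReal_pow (by norm_num),
    ENNReal.ofReal_toReal hB]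
  simp

/-- A kernel of frequency `2^k`: it is smooth at scale `2^{-k}`, and for `k ≥ 1` it is the
derivative of a localized function. -/
def IsKernel (M k : ℕ) (C : ℝ≥0∞) (κ : ℝ → ℂ) : Prop :=
  (∃ κ' : ℝ → ℂ, (∀ z, HasDerivAt κ (κ' z) z) ∧
    ∀ z, ‖κ' z‖ₑ ≤ C * 2 ^ (2 * k) * ((peetre k z)⁻¹) ^ M) ∧
  (k ≠ 0 → ∃ V : ℝ → ℂ, (∀ z, HasDerivAt V (κ z) z) ∧ ∀ z, ‖V z‖ₑ ≤ C * ((peetre k z)⁻¹) ^ M)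

lemma peetre_neg (k : ℕ) (z : ℝ) : peetre k (-z) = peetre k z := by simp [peetre]

lemma IsKernel.continuous {M k : ℕ} {C : ℝ≥0∞} {κ : ℝ → ℂ} (h : IsKernel M k C κ) :
    Continuous κ := by
  obtain ⟨⟨κ', h1, -⟩, -⟩ := h
  exact continuous_iff_continuousAt.2 fun t => (h1 t).continuousAt

lemma hasDerivAt_comp_const_sub {κ : ℝ → ℂ} {d : ℂ} (x z : ℝ) (h : HasDerivAt κ d (x - z)) :
    HasDerivAt (fun z => κ (x - z)) (-d) z := by
  simpa using h.comp_const_sub x z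

lemma IsKernel.comp_neg {M k : ℕ} {C : ℝ≥0∞} {κ : ℝ → ℂ} (h : IsKernel M k C κ) :
    IsKernel M k C (fun z => κ (-z)) := by
  obtain ⟨⟨κ', h1, h2⟩, h3⟩ := h
  refine ⟨⟨fun z => -κ' (-z), fun z => ?_, fun z => ?_⟩, fun hk => ?_⟩
  · simpa using hasDerivAt_comp_const_sub 0 z (by simpa using h1 (-z))
  · rw [enorm_neg, ← peetre_neg]
    exact h2 (-z)
  · obtain ⟨V, hV1, hV2⟩ := h3 hk
    refine ⟨fun z => -V (-z), fun z => ?_, fun z => ?_⟩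
    · simpa using (hasDerivAt_comp_const_sub 0 z (by simpa using hV1 (-z))).fun_neg
    · rw [enorm_neg, ← peetre_neg]
      exact hV2 (-z)

lemma two_pow_mul_inv_sq {k j : ℕ} (h : k ≤ j) :
    ((2 ^ j)⁻¹ : ℝ≥0∞) ^ 2 * 2 ^ (2 * k) = ((2 ^ (j - k))⁻¹) ^ 2 := by
  obtain ⟨l, rfl⟩ := Nat.exists_eq_add_of_le h
  rw [Nat.add_sub_cancel_left, mul_comm 2 k, pow_mul, ← mul_pow, pow_add,
    ENNReal.mul_inv (by simp) (by simp), mul_right_comm,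
    ENNReal.inv_mul_cancel (by simp) (by simp), one_mul]

lemma IsKernel.enorm_integral_haarFn_le {M k : ℕ} {C : ℝ≥0∞} (hC : C ≠ ⊤) {κ : ℝ → ℂ}
    (h : IsKernel M k C κ) (j : ℕ) (μ : ℤ) (x : ℝ) :
    ‖∫ t, κ (x - t) * haarFn j μ t‖ₑ ≤
      2 ^ (M + 1) * C * ((2 ^ (j - k))⁻¹) ^ 2 *
        ∑ i : Fin 3, ((peetre k (x - node j i μ))⁻¹) ^ M := by
  have hcont : Continuous fun t => κ (x - t) := h.continuous.comp (by fun_prop)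
  obtain ⟨⟨κ', h1, h2⟩, h3⟩ := h
  rcases le_or_gt k j with hkj | hkj
  · set B : ℝ≥0∞ := C * 2 ^ (2 * k) * (2 * (peetre k (x - node j 0 μ))⁻¹) ^ M with hBdef
    have hB : B ≠ ⊤ := by
      have := peetre_ne_zero k (x - node j 0 μ)
      finiteness
    have key := enorm_integral_mul_haarFn_le_of_deriv
      (fun t => hasDerivAt_comp_const_sub x t (h1 (x - t))) j μ hB (fun t ht => by
        rw [enorm_neg]
        refine (h2 _).trans ?_
        rw [hBdef]
        gcongr
        have h0 : peetre k (x - node j 0 μ) ≤ peetre k (x - t) * 2 := by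
          refine (peetre_sub_le_mul k x t _).trans ?_
          gcongr
          refine peetre_le_two hkj ?_
          have e1 := node_one j μ
          have e2 := node_two j μ
          rw [abs_of_nonneg (by linarith [ht.1])]
          linarith [ht.2]
        rw [← div_eq_mul_inv, ENNReal.inv_le_iff_inv_le,
          ENNReal.inv_div (Or.inl (peetre_ne_top _ _)) (Or.inl (peetre_ne_zero _ _))]
        exact ENNReal.div_le_of_le_mul h0)
    refine key.trans ?_
    calc ((2 ^ j)⁻¹) ^ 2 * B = 2 ^ M * C * (((2 ^ j)⁻¹) ^ 2 * 2 ^ (2 * k)) *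
          ((peetre k (x - node j 0 μ))⁻¹) ^ M := by
          rw [hBdef, mul_pow]
          ring
      _ ≤ _ := by
          rw [two_pow_mul_inv_sq hkj]
          gcongr
          · norm_num
          · omega
          · exact Finset.single_le_sum (f := fun i => ((peetre k (x - node j i μ))⁻¹) ^ M)
              (fun _ _ => zero_le) (Finset.mem_univ 0)
  · obtain ⟨V, hV1, hV2⟩ := h3 (by omega)
    have key := enorm_integral_mul_haarFn_le_of_antideriv (V := fun t => -V (x - t)) hcont
      (fun t => by simpa using (hasDerivAt_comp_const_sub x t (hV1 (x - t))).fun_neg) j μ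
    refine key.trans ?_
    have e : j - k = 0 := by omega
    rw [e, pow_zero, inv_one, one_pow, mul_one]
    calc 2 * ∑ i : Fin 3, ‖-V (x - node j i μ)‖ₑ
        ≤ 2 * ∑ i : Fin 3, C * ((peetre k (x - node j i μ))⁻¹) ^ M := by
          gcongr with i
          rw [enorm_neg]
          exact hV2 _
      _ = 2 ^ 1 * C * ∑ i : Fin 3, ((peetre k (x - node j i μ))⁻¹) ^ M := by
          rw [← Finset.mul_sum]
          ring
      _ ≤ _ := by
          gcongr
          · norm_num
          · omega

lemma conv_eq_convolution (f g : SchwartzMap ℝ ℂ) :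
    conv f g = SchwartzMap.convolution (ContinuousLinearMap.mul ℂ ℂ) f g := by
  ext x
  rw [SchwartzMap.convolution_apply]
  rfl

lemma fourierInv_comp_inv_mul {c : ℝ} (hc : 0 < c) (m : ℝ → ℂ) (z : ℝ) :
    𝓕⁻ (fun ξ => m (c⁻¹ * ξ)) z = c * 𝓕⁻ m (c * z) := by
  rw [Real.fourierInv_eq', Real.fourierInv_eq']
  have h := Measure.integral_comp_mul_left
    (fun v : ℝ => Complex.exp (↑(2 * π * inner ℝ v (c * z)) * Complex.I) • m v) c⁻¹
  rw [inv_inv, abs_of_pos hc, Complex.real_smul] at h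
  rw [← h]
  refine integral_congr_ae (ae_of_all _ fun v => ?_)
  simp only [RCLike.inner_apply, conj_trivial]
  congr 5
  field_simp

lemma SchwartzMap.exists_enorm_le_inv_peetre (K : SchwartzMap ℝ ℂ) (M : ℕ) :
    ∃ C : ℝ≥0∞, C ≠ ⊤ ∧ ∀ z, ‖K z‖ₑ ≤ C * ((peetre 0 z)⁻¹) ^ M := by
  set B : ℝ := 2 ^ M * (Finset.Iic (M, 0)).sup (fun m => SchwartzMap.seminorm ℝ m.1 m.2) K
  refine ⟨ENNReal.ofReal B, ENNReal.ofReal_ne_top, fun z => ?_⟩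
  have h := SchwartzMap.one_add_le_sup_seminorm_apply (𝕜 := ℝ) (m := (M, 0)) (k := M) (n := 0)
    le_rfl le_rfl K z
  rw [norm_iteratedFDeriv_zero] at h
  have h2 := ENNReal.ofReal_le_ofReal h
  have e : peetre 0 z = ENNReal.ofReal (1 + ‖z‖) := by
    rw [ENNReal.ofReal_add zero_le_one (norm_nonneg _)]
    simp [peetre, Real.enorm_eq_ofReal_abs]
  rw [ENNReal.ofReal_mul (by positivity), ENNReal.ofReal_pow (by positivity), ← e,
    ofReal_norm] at h2
  rw [← ENNReal.inv_pow, ← div_eq_mul_inv, ENNReal.le_div_iff_mul_le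
    (Or.inl (pow_ne_zero _ (peetre_ne_zero _ _))) (Or.inl (ENNReal.pow_ne_top (peetre_ne_top _ _))),
    mul_comm]
  exact h2

lemma peetre_zero_two_pow_mul (k : ℕ) (z : ℝ) : peetre 0 (2 ^ k * z) = peetre k z := by
  have e2 : ‖(2 : ℝ)‖ₑ = 2 := by simp [Real.enorm_eq_ofReal_abs]
  simp [peetre, enorm_mul, enorm_pow, e2]

lemma hasDerivAt_two_pow_dilate {F : ℝ → ℂ} {d : ℂ} (k : ℕ) (z : ℝ)
    (h : HasDerivAt F d (2 ^ k * z)) : HasDerivAt (fun z => F (2 ^ k * z)) (2 ^ k * d) z := by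
  have h1 : HasDerivAt (fun z : ℝ => (2 : ℝ) ^ k * z) (2 ^ k) z := by
    simpa using (hasDerivAt_id z).const_mul ((2 : ℝ) ^ k)
  have := HasDerivAt.scomp z h h1
  simpa [Function.comp_def] using this

lemma SchwartzMap.hasDerivAt_derivCLM (K : SchwartzMap ℝ ℂ) (z : ℝ) :
    HasDerivAt K (SchwartzMap.derivCLM ℝ ℂ K z) z := by
  rw [SchwartzMap.derivCLM_apply]
  exact K.differentiableAt.hasDerivAt

lemma exists_isKernel_zero (K : SchwartzMap ℝ ℂ) (M : ℕ) :
    ∃ C : ℝ≥0∞, C ≠ ⊤ ∧ IsKernel M 0 C K := by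
  obtain ⟨C, hC, h⟩ := (SchwartzMap.derivCLM ℝ ℂ K).exists_enorm_le_inv_peetre M
  exact ⟨C, hC, ⟨_, K.hasDerivAt_derivCLM, fun z => by simpa using h z⟩, fun h0 => absurd rfl h0⟩

lemma exists_isKernel_dilate (K Ψ : SchwartzMap ℝ ℂ) (hΨ : ∀ z, HasDerivAt Ψ (K z) z) (M : ℕ) :
    ∃ C : ℝ≥0∞, C ≠ ⊤ ∧ ∀ k : ℕ, IsKernel M k C (fun z => (2 : ℂ) ^ k * K ((2 : ℝ) ^ k * z)) := by
  obtain ⟨C₁, hC₁, h₁⟩ := (SchwartzMap.derivCLM ℝ ℂ K).exists_enorm_le_inv_peetre M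
  obtain ⟨C₂, hC₂, h₂⟩ := Ψ.exists_enorm_le_inv_peetre M
  have e2 : ‖(2 : ℂ)‖ₑ = 2 := by
    rw [← ofReal_norm]
    simp
  refine ⟨max C₁ C₂, by simp [hC₁, hC₂], fun k => ⟨⟨fun z => 2 ^ k * (2 ^ k *
    SchwartzMap.derivCLM ℝ ℂ K (2 ^ k * z)), fun z => ?_, fun z => ?_⟩, fun _ =>
    ⟨fun z => Ψ (2 ^ k * z), fun z => hasDerivAt_two_pow_dilate k z (hΨ _), fun z => ?_⟩⟩⟩
  · exact (hasDerivAt_two_pow_dilate k z (K.hasDerivAt_derivCLM _)).const_mul _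
  · rw [enorm_mul, enorm_mul, enorm_pow, e2, ← mul_assoc, ← pow_add, ← two_mul, mul_comm (max _ _),
      mul_assoc, ← peetre_zero_two_pow_mul]
    gcongr
    refine (h₁ _).trans ?_
    gcongr
    exact le_max_left _ _
  · rw [← peetre_zero_two_pow_mul]
    refine (h₂ _).trans ?_
    gcongr
    exact le_max_right _ _

lemma hasDerivAt_fourierInv (a b : SchwartzMap ℝ ℂ) (h : ∀ ξ, b ξ = 2 * π * Complex.I * ξ * a ξ)
    (z : ℝ) : HasDerivAt (𝓕⁻ a : SchwartzMap ℝ ℂ) ((𝓕⁻ b : SchwartzMap ℝ ℂ) z) z := by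
  have h1 := SchwartzMap.lineDerivOp_fourierInv_eq a (1 : ℝ)
  have h2 : (2 * π * Complex.I) • SchwartzMap.smulLeftCLM ℂ (inner ℝ · (1 : ℝ)) a = b := by
    ext ξ
    have : (inner ℝ · (1 : ℝ)).HasTemperateGrowth := by fun_prop
    rw [smul_apply, SchwartzMap.smulLeftCLM_apply_apply this, h]
    simp
    ring
  rw [h2] at h1
  rw [← h1, SchwartzMap.lineDerivOp_apply_eq_fderiv]
  exact (SchwartzMap.differentiableAt _).hasDerivAt

/-- The family of Fourier multipliers `m₀, m(2^{-1}·), m(2^{-2}·), …`. -/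
def multiplier (m₀ m : ℝ → ℂ) (n : ℕ) (ξ : ℝ) : ℂ :=
  if n = 0 then m₀ ξ else m (((2 : ℝ) ^ n)⁻¹ * ξ)

lemma hasCompactSupport_comp_const_mul {m : ℝ → ℂ} (hc : HasCompactSupport m) {c : ℝ}
    (hc0 : c ≠ 0) : HasCompactSupport fun ξ => m (c * ξ) :=
  hc.comp_homeomorph (Homeomorph.mulLeft₀ c hc0)

lemma hasCompactSupport_multiplier {m₀ m : ℝ → ℂ} (h₀ : HasCompactSupport m₀)
    (h : HasCompactSupport m) (n : ℕ) : HasCompactSupport (multiplier m₀ m n) := by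
  unfold multiplier
  by_cases hn : n = 0
  · simpa [hn] using h₀
  · simp only [hn, if_false]
    exact hasCompactSupport_comp_const_mul h (by positivity)

lemma contDiff_multiplier {m₀ m : ℝ → ℂ} (h₀ : ContDiff ℝ (⊤ : ℕ∞) m₀)
    (h : ContDiff ℝ (⊤ : ℕ∞) m) (n : ℕ) : ContDiff ℝ (⊤ : ℕ∞) (multiplier m₀ m n) := by
  unfold multiplier
  by_cases hn : n = 0
  · simpa [hn] using h₀
  · simp only [hn, if_false]
    exact h.comp (by fun_prop)

lemma fourierInv_multiplier_of_ne_zero (m₀ m : ℝ → ℂ) {n : ℕ} (hn : n ≠ 0) (z : ℝ) :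
    𝓕⁻ (multiplier m₀ m n) z = (2 : ℂ) ^ n * 𝓕⁻ m ((2 : ℝ) ^ n * z) := by
  have := fourierInv_comp_inv_mul (c := (2 : ℝ) ^ n) (by positivity) m z
  unfold multiplier
  simp only [hn, if_false]
  rw [this]
  simp

lemma contDiff_div_of_eq_zero {m : ℝ → ℂ} (hs : ContDiff ℝ (⊤ : ℕ∞) m) {δ : ℝ} (hδ : 0 < δ)
    (h0 : ∀ ξ, |ξ| ≤ δ → m ξ = 0) :
    ContDiff ℝ (⊤ : ℕ∞) fun ξ => m ξ / (2 * π * Complex.I * ξ) := by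
  rw [contDiff_iff_contDiffAt]
  intro ξ
  by_cases hξ : ξ = 0
  · refine (contDiffAt_const (c := (0 : ℂ))).congr_of_eventuallyEq ?_
    have : Metric.ball (0 : ℝ) δ ∈ nhds ξ := by
      rw [hξ]
      exact Metric.ball_mem_nhds _ hδ
    filter_upwards [this] with y hy
    rw [mem_ball_zero_iff, Real.norm_eq_abs] at hy
    simp [h0 y hy.le]
  · simp only [div_eq_mul_inv]
    have hl : ContDiff ℝ (⊤ : ℕ∞) fun ξ : ℝ => 2 * π * Complex.I * (ξ : ℂ) :=
      contDiff_const.mul Complex.ofRealCLM.contDiff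
    refine hs.contDiffAt.mul (hl.contDiffAt.inv ?_)
    simp [hξ, Real.pi_ne_zero, Complex.I_ne_zero]

lemma exists_isKernel_multiplier {m₀ m : ℝ → ℂ} (hc₀ : HasCompactSupport m₀)
    (hs₀ : ContDiff ℝ (⊤ : ℕ∞) m₀) (hc : HasCompactSupport m) (hs : ContDiff ℝ (⊤ : ℕ∞) m) {δ : ℝ} (hδ : 0 < δ)
    (h0 : ∀ ξ, |ξ| ≤ δ → m ξ = 0) (M : ℕ) :
    ∃ C : ℝ≥0∞, C ≠ ⊤ ∧ ∀ n, IsKernel M n C (𝓕⁻ (multiplier m₀ m n)) := by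
  set a := HasCompactSupport.toSchwartzMap (f := fun ξ => m ξ / (2 * π * Complex.I * ξ))
    (by
      simp only [div_eq_mul_inv]
      exact hc.mul_right (f' := fun ξ : ℝ => (2 * π * Complex.I * (ξ : ℂ))⁻¹)) (contDiff_div_of_eq_zero hs hδ h0) with ha
  have hda := hasDerivAt_fourierInv a (hc.toSchwartzMap hs) (fun ξ => by
    change m ξ = _ * (m ξ / (2 * π * Complex.I * ξ))
    by_cases hξ : ξ = 0
    · simp [hξ, h0 0 (by simp [hδ.le])]
    · have h3 : (ξ : ℂ) ≠ 0 := by simpa using hξ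
      have h4 : (π : ℂ) ≠ 0 := by simp
      have h5 := Complex.I_ne_zero
      field_simp)
  obtain ⟨C₁, hC₁, h₁⟩ := exists_isKernel_zero (𝓕⁻ (hc₀.toSchwartzMap hs₀)) M
  obtain ⟨C₂, hC₂, h₂⟩ := exists_isKernel_dilate (𝓕⁻ (hc.toSchwartzMap hs)) (𝓕⁻ a) hda M
  have mono : ∀ {n : ℕ} {C C' : ℝ≥0∞} {κ : ℝ → ℂ}, C ≤ C' → IsKernel M n C κ →
      IsKernel M n C' κ := by
    rintro n C C' κ hCC ⟨⟨κ', k1, k2⟩, k3⟩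
    refine ⟨⟨κ', k1, fun z => (k2 z).trans (by gcongr)⟩, fun hn => ?_⟩
    obtain ⟨V, v1, v2⟩ := k3 hn
    exact ⟨V, v1, fun z => (v2 z).trans (by gcongr)⟩
  refine ⟨max C₁ C₂, by simp [hC₁, hC₂], fun n => ?_⟩
  by_cases hn : n = 0
  · subst hn
    refine mono (le_max_left _ _) ?_
    rw [SchwartzMap.fourierInv_coe] at h₁
    exact h₁
  · refine mono (le_max_right _ _) ?_
    have := h₂ n
    rw [SchwartzMap.fourierInv_coe] at this
    rw [show 𝓕⁻ (multiplier m₀ m n) = fun z => (2 : ℂ) ^ n * 𝓕⁻ m ((2 : ℝ) ^ n * z) from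
      funext fun z => fourierInv_multiplier_of_ne_zero m₀ m hn z]
    exact this

lemma convolution_reproducing (f a b : SchwartzMap ℝ ℂ) (h : ∀ ξ, b ξ * a ξ = a ξ) :
    conv (conv f (𝓕⁻ a : SchwartzMap ℝ ℂ)) (𝓕⁻ b : SchwartzMap ℝ ℂ) =
      conv f (𝓕⁻ a : SchwartzMap ℝ ℂ) := by
  rw [conv_eq_convolution, conv_eq_convolution]
  have hinj : ∀ A B : SchwartzMap ℝ ℂ, (𝓕 A : SchwartzMap ℝ ℂ) = 𝓕 B → A = B := fun A B hAB => by
    have h1 : (𝓕⁻ (𝓕 A : SchwartzMap ℝ ℂ) : SchwartzMap ℝ ℂ) = A :=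
      FourierTransform.fourierInv_fourier_eq A
    have h2 : (𝓕⁻ (𝓕 B : SchwartzMap ℝ ℂ) : SchwartzMap ℝ ℂ) = B :=
      FourierTransform.fourierInv_fourier_eq B
    rw [← h1, hAB, h2]
  refine congrArg _ (hinj _ _ ?_)
  rw [SchwartzMap.fourier_convolution, SchwartzMap.fourier_convolution]
  ext ξ
  simp only [FourierTransform.fourier_fourierInv_eq, SchwartzMap.pairing_apply_apply,
    ContinuousLinearMap.mul_apply']
  rw [mul_assoc, mul_comm (a ξ), h]

lemma LPop_eq_conv (φ₀ : ℝ → ℂ) (n : ℕ) (g : ℝ → ℂ) :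
    LPop φ₀ n g = conv g (𝓕⁻ (multiplier φ₀ (fun ξ => φ₀ ξ - φ₀ (2 * ξ)) n)) := by
  unfold LPop
  by_cases hn : n = 0
  · subst hn
    simp only [if_true]
    rfl
  · rw [if_neg hn]
    congr 1
    funext z
    rw [fourierInv_multiplier_of_ne_zero _ _ hn]

/-- The standing assumptions on the Littlewood–Paley cutoff. -/
structure IsCutoff (φ₀ : ℝ → ℂ) : Prop where
  contDiff : ContDiff ℝ (⊤ : ℕ∞) φ₀
  hasCompactSupport : HasCompactSupport φ₀
  eq_one : ∀ ξ : ℝ, |ξ| ≤ 4 / 3 → φ₀ ξ = 1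
  eq_zero : ∀ ξ : ℝ, 3 / 2 ≤ |ξ| → φ₀ ξ = 0

/-- The annular multiplier `φ = φ₀ - φ₀(2·)`. -/
abbrev annulus (φ₀ : ℝ → ℂ) (ξ : ℝ) : ℂ := φ₀ ξ - φ₀ (2 * ξ)

/-- A multiplier equal to one on the support of `annulus φ₀`. -/
abbrev fatAnnulus (φ₀ : ℝ → ℂ) (ξ : ℝ) : ℂ := φ₀ (2⁻¹ * ξ) - φ₀ (4 * ξ)

namespace IsCutoff

variable {φ₀ : ℝ → ℂ}

lemma contDiff_mul (h : IsCutoff φ₀) (c : ℝ) : ContDiff ℝ (⊤ : ℕ∞) fun ξ => φ₀ (c * ξ) :=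
  h.contDiff.comp (by fun_prop)

lemma hasCompactSupport_mul (h : IsCutoff φ₀) {c : ℝ} (hc : c ≠ 0) :
    HasCompactSupport fun ξ => φ₀ (c * ξ) :=
  hasCompactSupport_comp_const_mul h.hasCompactSupport hc

lemma contDiff_annulus (h : IsCutoff φ₀) : ContDiff ℝ (⊤ : ℕ∞) (annulus φ₀) :=
  h.contDiff.sub (h.contDiff_mul 2)

lemma contDiff_fatAnnulus (h : IsCutoff φ₀) : ContDiff ℝ (⊤ : ℕ∞) (fatAnnulus φ₀) :=
  (h.contDiff_mul _).sub (h.contDiff_mul _)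

lemma hasCompactSupport_annulus (h : IsCutoff φ₀) : HasCompactSupport (annulus φ₀) :=
  h.hasCompactSupport.sub (h.hasCompactSupport_mul two_ne_zero)

lemma hasCompactSupport_fatAnnulus (h : IsCutoff φ₀) : HasCompactSupport (fatAnnulus φ₀) :=
  (h.hasCompactSupport_mul (by norm_num)).sub (h.hasCompactSupport_mul (by norm_num))

lemma annulus_eq_zero (h : IsCutoff φ₀) (ξ : ℝ) (hξ : |ξ| ≤ 2 / 3) : annulus φ₀ ξ = 0 := by
  have h2 : |2 * ξ| = 2 * |ξ| := by simp [abs_mul]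
  rw [annulus, h.eq_one ξ (by linarith), h.eq_one (2 * ξ) (by linarith), sub_self]

lemma fatAnnulus_eq_zero (h : IsCutoff φ₀) (ξ : ℝ) (hξ : |ξ| ≤ 1 / 3) : fatAnnulus φ₀ ξ = 0 := by
  have h2 : |2⁻¹ * ξ| = 2⁻¹ * |ξ| := by simp [abs_mul]
  have h4 : |4 * ξ| = 4 * |ξ| := by simp [abs_mul]
  rw [fatAnnulus, h.eq_one (2⁻¹ * ξ) (by linarith), h.eq_one (4 * ξ) (by linarith), sub_self]

lemma fatAnnulus_mul_annulus (h : IsCutoff φ₀) (ξ : ℝ) :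
    fatAnnulus φ₀ ξ * annulus φ₀ ξ = annulus φ₀ ξ := by
  have h1 : |2⁻¹ * ξ| = 2⁻¹ * |ξ| := by simp [abs_mul]
  have h2 : |2 * ξ| = 2 * |ξ| := by simp [abs_mul]
  have h4 : |4 * ξ| = 4 * |ξ| := by simp [abs_mul]
  rcases le_or_gt |ξ| (2 / 3) with h5 | h5
  · rw [h.annulus_eq_zero ξ h5, mul_zero]
  rcases le_or_gt (3 / 2) |ξ| with h6 | h6
  · rw [annulus, h.eq_zero ξ h6, h.eq_zero (2 * ξ) (by linarith)]
    simp
  · rw [fatAnnulus, h.eq_one (2⁻¹ * ξ) (by linarith), h.eq_zero (4 * ξ) (by linarith)]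
    simp

lemma cutoff_mul_cutoff (h : IsCutoff φ₀) (ξ : ℝ) : φ₀ (2⁻¹ * ξ) * φ₀ ξ = φ₀ ξ := by
  have h1 : |2⁻¹ * ξ| = 2⁻¹ * |ξ| := by simp [abs_mul]
  rcases le_or_gt (3 / 2) |ξ| with h6 | h6
  · simp [h.eq_zero ξ h6]
  · rw [h.eq_one (2⁻¹ * ξ) (by linarith), one_mul]

lemma multiplier_mul_multiplier (h : IsCutoff φ₀) (n : ℕ) (ξ : ℝ) :
    multiplier (fun ξ => φ₀ (2⁻¹ * ξ)) (fatAnnulus φ₀) n ξ * multiplier φ₀ (annulus φ₀) n ξ =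
      multiplier φ₀ (annulus φ₀) n ξ := by
  unfold multiplier
  by_cases hn : n = 0
  · simpa [hn] using h.cutoff_mul_cutoff ξ
  · simpa only [hn, if_false] using h.fatAnnulus_mul_annulus _

/-- The Littlewood–Paley multipliers as Schwartz functions. -/
def lpMultiplier (h : IsCutoff φ₀) (n : ℕ) : SchwartzMap ℝ ℂ :=
  (hasCompactSupport_multiplier h.hasCompactSupport h.hasCompactSupport_annulus n).toSchwartzMap
    (contDiff_multiplier h.contDiff h.contDiff_annulus n)

/-- The reproducing multipliers as Schwartz functions. -/
def fatMultiplier (h : IsCutoff φ₀) (n : ℕ) : SchwartzMap ℝ ℂ :=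
  (hasCompactSupport_multiplier (h.hasCompactSupport_mul (c := 2⁻¹) (by norm_num))
    h.hasCompactSupport_fatAnnulus n).toSchwartzMap
    (contDiff_multiplier (h.contDiff_mul _) h.contDiff_fatAnnulus n)

lemma LPop_eq_conv_schwartz (h : IsCutoff φ₀) (n : ℕ) (g : ℝ → ℂ) :
    LPop φ₀ n g = conv g (𝓕⁻ (h.lpMultiplier n) : SchwartzMap ℝ ℂ) := by
  rw [LPop_eq_conv, SchwartzMap.fourierInv_coe]
  rfl

/-- The Littlewood–Paley pieces of a Schwartz function as Schwartz functions. -/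
def piece (h : IsCutoff φ₀) (n : ℕ) (f : SchwartzMap ℝ ℂ) : SchwartzMap ℝ ℂ :=
  SchwartzMap.convolution (ContinuousLinearMap.mul ℂ ℂ) f (𝓕⁻ (h.lpMultiplier n))

lemma coe_piece (h : IsCutoff φ₀) (n : ℕ) (f : SchwartzMap ℝ ℂ) :
    ⇑(h.piece n f) = LPop φ₀ n f := by
  rw [h.LPop_eq_conv_schwartz, conv_eq_convolution, piece]

lemma conv_piece (h : IsCutoff φ₀) (n : ℕ) (f : SchwartzMap ℝ ℂ) :
    conv (h.piece n f) (𝓕⁻ (h.fatMultiplier n) : SchwartzMap ℝ ℂ) = h.piece n f := by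
  rw [coe_piece, h.LPop_eq_conv_schwartz]
  exact convolution_reproducing f (h.lpMultiplier n) (h.fatMultiplier n)
    (h.multiplier_mul_multiplier n)

lemma piece_apply (h : IsCutoff φ₀) (n : ℕ) (f : SchwartzMap ℝ ℂ) (x : ℝ) :
    h.piece n f x = ∫ ξ, Complex.exp (↑(2 * π * inner ℝ ξ x) * Complex.I) •
      (𝓕 (f : ℝ → ℂ) ξ * multiplier φ₀ (annulus φ₀) n ξ) := by
  have h1 : (𝓕⁻ (𝓕 (h.piece n f) : SchwartzMap ℝ ℂ) : SchwartzMap ℝ ℂ) = h.piece n f :=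
    FourierTransform.fourierInv_fourier_eq _
  rw [← h1, SchwartzMap.fourierInv_coe, Real.fourierInv_eq']
  refine integral_congr_ae (ae_of_all _ fun ξ => ?_)
  simp only
  rw [piece, SchwartzMap.fourier_convolution]
  simp only [FourierTransform.fourier_fourierInv_eq, SchwartzMap.pairing_apply_apply,
    ContinuousLinearMap.mul_apply', SchwartzMap.fourier_coe]
  rfl

lemma sum_multiplier (N : ℕ) (ξ : ℝ) :
    ∑ n ∈ Finset.range (N + 1), multiplier φ₀ (annulus φ₀) n ξ = φ₀ ((2 ^ N)⁻¹ * ξ) := by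
  induction N with
  | zero => simp [multiplier]
  | succ N ih =>
    rw [Finset.sum_range_succ, ih]
    simp only [multiplier, annulus, Nat.add_eq_zero_iff, one_ne_zero, and_false, if_false]
    rw [show (2 : ℝ) * ((2 ^ (N + 1))⁻¹ * ξ) = (2 ^ N)⁻¹ * ξ by
      rw [pow_succ]
      field_simp]
    ring

end IsCutoff

namespace IsCutoff

variable {φ₀ : ℝ → ℂ}

lemma sum_piece_apply (h : IsCutoff φ₀) (N : ℕ) (f : SchwartzMap ℝ ℂ) (x : ℝ) :
    ∑ n ∈ Finset.range (N + 1), h.piece n f x =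
      ∫ ξ, Complex.exp (↑(2 * π * inner ℝ ξ x) * Complex.I) •
        (𝓕 (f : ℝ → ℂ) ξ * φ₀ ((2 ^ N)⁻¹ * ξ)) := by
  simp_rw [piece_apply]
  rw [← integral_finsetSum]
  · simp_rw [← Finset.smul_sum, ← Finset.mul_sum, sum_multiplier]
  · intro n _
    have h1 : Integrable fun ξ => 𝓕 (f : ℝ → ℂ) ξ * multiplier φ₀ (annulus φ₀) n ξ := by
      have := (SchwartzMap.pairing (ContinuousLinearMap.mul ℂ ℂ) (𝓕 f) (h.lpMultiplier n)).integrable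
        (μ := volume)
      refine this.congr (ae_of_all _ fun ξ => ?_)
      simp only [SchwartzMap.pairing_apply_apply, ContinuousLinearMap.mul_apply',
        SchwartzMap.fourier_coe]
      rfl
    simp only [smul_eq_mul]
    refine h1.bdd_mul (c := 1) (by fun_prop) (ae_of_all _ fun ξ => ?_)
    rw [Complex.norm_exp_ofReal_mul_I]

lemma exists_norm_le (h : IsCutoff φ₀) : ∃ K, ∀ ξ, ‖φ₀ ξ‖ ≤ K :=
  h.hasCompactSupport.exists_bound_of_continuous h.contDiff.continuous

lemma norm_exp_smul_le (f : SchwartzMap ℝ ℂ) {K : ℝ} (hK : ∀ ξ, ‖φ₀ ξ‖ ≤ K) (N : ℕ) (x ξ : ℝ) :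
    ‖Complex.exp (↑(2 * π * inner ℝ ξ x) * Complex.I) •
      (𝓕 (f : ℝ → ℂ) ξ * φ₀ ((2 ^ N)⁻¹ * ξ))‖ ≤ ‖(𝓕 f : SchwartzMap ℝ ℂ) ξ‖ * K := by
  rw [norm_smul, Complex.norm_exp_ofReal_mul_I, one_mul, norm_mul, SchwartzMap.fourier_coe]
  gcongr
  exact hK _

lemma tendsto_sum_piece (h : IsCutoff φ₀) (f : SchwartzMap ℝ ℂ) (x : ℝ) :
    Filter.Tendsto (fun N => ∑ n ∈ Finset.range (N + 1), h.piece n f x) Filter.atTop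
      (nhds (f x)) := by
  obtain ⟨K, hK⟩ := h.exists_norm_le
  have h1 : (𝓕⁻ (𝓕 f : SchwartzMap ℝ ℂ) : SchwartzMap ℝ ℂ) = f :=
    FourierTransform.fourierInv_fourier_eq _
  have h2 : f x = ∫ ξ, Complex.exp (↑(2 * π * inner ℝ ξ x) * Complex.I) • 𝓕 (f : ℝ → ℂ) ξ := by
    conv_lhs => rw [← h1, SchwartzMap.fourierInv_coe, Real.fourierInv_eq', SchwartzMap.fourier_coe]
  simp_rw [h.sum_piece_apply]
  rw [h2]
  have hc := (𝓕 f : SchwartzMap ℝ ℂ).continuous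
  rw [SchwartzMap.fourier_coe] at hc
  have hc' := h.contDiff.continuous
  refine tendsto_integral_of_dominated_convergence _ (fun N => ?_)
    ((𝓕 f : SchwartzMap ℝ ℂ).integrable.norm.mul_const K)
    (fun N => ae_of_all _ fun ξ => norm_exp_smul_le f hK N x ξ) (ae_of_all _ fun ξ => ?_)
  · refine Continuous.aestronglyMeasurable ?_
    fun_prop
  · refine Filter.Tendsto.const_smul ?_ _
    have h3 : Filter.Tendsto (fun N : ℕ => ((2 : ℝ) ^ N)⁻¹ * ξ) Filter.atTop (nhds 0) := by
      have := (tendsto_pow_atTop_nhds_zero_of_lt_one (r := (2 : ℝ)⁻¹) (by norm_num)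
        (by norm_num)).mul_const ξ
      simpa [inv_pow] using this
    have h4 := (hc'.tendsto 0).comp h3
    rw [h.eq_one 0 (by norm_num)] at h4
    simpa using h4.const_mul (𝓕 (f : ℝ → ℂ) ξ)

lemma norm_haarFn_mul_integrable (w : SchwartzMap ℝ ℂ) (j : ℕ) (μ : ℤ) :
    Integrable fun t => w t * haarFn j μ t :=
  (integrable_haarFn j μ).bdd_mul w.continuous.aestronglyMeasurable
    (ae_of_all _ (SchwartzMap.norm_le_seminorm ℝ w))

lemma enorm_integral_haarFn_le_tsum (h : IsCutoff φ₀) (f : SchwartzMap ℝ ℂ) (j : ℕ) (μ : ℤ) :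
    ‖∫ t, f t * haarFn j μ t‖ₑ ≤ ∑' n, ‖∫ t, LPop φ₀ n f t * haarFn j μ t‖ₑ := by
  obtain ⟨K, hK⟩ := h.exists_norm_le
  have h1 : Filter.Tendsto (fun N => ∫ t, (∑ n ∈ Finset.range (N + 1), h.piece n f t) *
      haarFn j μ t) Filter.atTop (nhds (∫ t, f t * haarFn j μ t)) := by
    refine tendsto_integral_of_dominated_convergence
      (fun t => (∫ ξ, ‖(𝓕 f : SchwartzMap ℝ ℂ) ξ‖ * K) * ‖haarFn j μ t‖) (fun N => ?_)
      ((integrable_haarFn j μ).norm.const_mul _) (fun N => ae_of_all _ fun t => ?_)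
      (ae_of_all _ fun t => (h.tendsto_sum_piece f t).mul_const _)
    · refine AEStronglyMeasurable.mul ?_ (integrable_haarFn j μ).1
      exact (continuous_finsetSum _ fun n _ => (h.piece n f).continuous).aestronglyMeasurable
    · rw [norm_mul, h.sum_piece_apply]
      gcongr
      exact norm_integral_le_of_norm_le ((𝓕 f : SchwartzMap ℝ ℂ).integrable.norm.mul_const K)
        (ae_of_all _ fun ξ => norm_exp_smul_le f hK N t ξ)
  refine le_of_tendsto h1.enorm (Filter.Eventually.of_forall fun N => ?_)
  simp_rw [Finset.sum_mul]
  rw [integral_finsetSum _ fun n _ => norm_haarFn_mul_integrable _ j μ]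
  refine (enorm_sum_le _ _).trans ?_
  simp_rw [coe_piece]
  exact ENNReal.sum_le_tsum _

end IsCutoff

lemma two_pow_sub_inv_identity (j n : ℕ) :
    (2 : ℝ≥0∞) ^ j * ((2 ^ (j - n))⁻¹) ^ 2 = (2 ^ (j - n))⁻¹ * (2 ^ (n - j))⁻¹ * 2 ^ n := by
  rcases le_total j n with h | h
  · obtain ⟨l, rfl⟩ := Nat.exists_eq_add_of_le h
    rw [Nat.sub_eq_zero_of_le h, Nat.add_sub_cancel_left, pow_add, mul_comm (2 ^ j) (2 ^ l),
      ← mul_assoc, mul_assoc _ _ ((2 : ℝ≥0∞) ^ l), ENNReal.inv_mul_cancel (by simp) (by simp)]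
    simp
  · obtain ⟨l, rfl⟩ := Nat.exists_eq_add_of_le h
    rw [Nat.sub_eq_zero_of_le h, Nat.add_sub_cancel_left, pow_add, sq, mul_assoc, ← mul_assoc (2 ^ l),
      ENNReal.mul_inv_cancel (by simp) (by simp)]
    simp [mul_comm]

lemma enorm_integral_haarFn_le_of_conv {w κ : SchwartzMap ℝ ℂ} {n : ℕ} {C : ℝ≥0∞} (hC : C ≠ ⊤)
    (hκ : IsKernel 2 n C κ) (hw : conv w κ = w) (j : ℕ) (μ : ℤ) :
    2 ^ j * ‖∫ t, w t * haarFn j μ t‖ₑ ≤ 8 * C * ((2 ^ (j - n))⁻¹ * (2 ^ (n - j))⁻¹) *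
      ∑ i, avgOp n (fun s => ‖w s‖ₑ) (node j i μ) := by
  have h1 : ∫ t, w t * haarFn j μ t =
      ∫ s, w s * ∫ t, κ (-(s - t)) * haarFn j μ t := by
    calc ∫ t, w t * haarFn j μ t
        = ∫ t, ∫ s, κ (t - s) * (haarFn j μ t * w s) := by
          refine integral_congr_ae (ae_of_all _ fun t => ?_)
          simp only
          conv_lhs => rw [← hw]
          rw [conv, ← integral_mul_const]
          congr 1
          ext s
          ring
      _ = ∫ s, ∫ t, κ (t - s) * (haarFn j μ t * w s) := by
          refine integral_integral_swap ?_
          refine ((integrable_haarFn j μ).mul_prod w.integrable).bdd_mul ?_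
            (ae_of_all _ fun z => SchwartzMap.norm_le_seminorm ℝ κ _)
          have := κ.continuous
          exact Continuous.aestronglyMeasurable (by fun_prop)
      _ = _ := by
          congr 1
          ext s
          rw [← integral_const_mul]
          congr 1
          ext t
          rw [neg_sub]
          ring
  rw [h1]
  calc 2 ^ j * ‖∫ s, w s * ∫ t, κ (-(s - t)) * haarFn j μ t‖ₑ
      ≤ 2 ^ j * ∫⁻ s, ‖w s‖ₑ * (2 ^ (2 + 1) * C * ((2 ^ (j - n))⁻¹) ^ 2 *
          ∑ i, ((peetre n (s - node j i μ))⁻¹) ^ 2) := by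
        gcongr
        refine (enorm_integral_le_lintegral_enorm _).trans (lintegral_mono fun s => ?_)
        rw [enorm_mul]
        gcongr
        exact hκ.comp_neg.enorm_integral_haarFn_le hC j μ s
    _ = ∫⁻ s, 8 * C * ((2 ^ (j - n))⁻¹ * (2 ^ (n - j))⁻¹) *
          ∑ i, avgKer n (node j i μ - s) * ‖w s‖ₑ := by
        rw [← lintegral_const_mul' _ _ (by simp)]
        congr 1
        ext s
        simp only [avgKer, ← Finset.sum_mul, ← Finset.mul_sum, peetre_sub_comm n s]
        have e := two_pow_sub_inv_identity j n
        have e8 : (2 : ℝ≥0∞) ^ (2 + 1) = 8 := by norm_num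
        rw [e8]
        generalize (∑ i : Fin 3, ((peetre n (node j i μ - s))⁻¹) ^ 2) = X
        calc _ = 8 * C * (2 ^ j * ((2 ^ (j - n))⁻¹) ^ 2) * X * ‖w s‖ₑ := by ring
          _ = _ := by rw [e]; ring
    _ = _ := by
        have hm : Measurable fun s => ‖w s‖ₑ := w.continuous.measurable.enorm
        rw [lintegral_const_mul _ (by fun_prop), lintegral_finsetSum _ (by fun_prop)]
        rfl

lemma nodeSum_eq_tsum (M k j n : ℕ) (u : ℝ → ℝ≥0∞) (x : ℝ) :
    nodeSum M k j n u x = ∑' μ : ℤ, (∑ i, avgOp n u (node j i μ)) *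
      ∑ i, ((peetre k (x - node j i μ))⁻¹) ^ M := by
  unfold nodeSum
  simp only [ENNReal.tsum_prod']
  simp only [tsum_fintype]
  simp_rw [Finset.sum_mul_sum]
  rw [Summable.tsum_finsetSum fun _ _ => ENNReal.summable]
  refine Finset.sum_congr rfl fun a _ => ?_
  rw [Summable.tsum_finsetSum fun _ _ => ENNReal.summable]
  simp_rw [mul_comm]

lemma sum_le_sum_HFset_tsum (E : Finset (ℕ × ℤ)) (F : ℕ → ℤ → ℝ≥0∞) :
    ∑ e ∈ E, F e.1 e.2 ≤ ∑ j ∈ HFset E, ∑' μ, F j μ := by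
  calc ∑ e ∈ E, F e.1 e.2 ≤ ∑ e ∈ HFset E ×ˢ E.image Prod.snd, F e.1 e.2 := by
        refine Finset.sum_le_sum_of_subset fun e he => ?_
        exact Finset.mem_product.2 ⟨Finset.mem_image_of_mem _ he, Finset.mem_image_of_mem _ he⟩
    _ = ∑ j ∈ HFset E, ∑ μ ∈ E.image Prod.snd, F j μ := Finset.sum_product _ _ _
    _ ≤ _ := Finset.sum_le_sum fun j _ => ENNReal.sum_le_tsum _

lemma conv_haarProj_apply (E : Finset (ℕ × ℤ)) (f : ℝ → ℂ) (κ : SchwartzMap ℝ ℂ) (x : ℝ) :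
    conv (haarProj E f) κ x = ∑ e ∈ E, (2 : ℂ) ^ e.1 * (∫ y, f y * haarFn e.1 e.2 y) *
      ∫ t, κ (x - t) * haarFn e.1 e.2 t := by
  unfold conv haarProj
  simp_rw [Finset.sum_mul]
  have hi : ∀ e : ℕ × ℤ, Integrable fun t => κ (x - t) * haarFn e.1 e.2 t := fun e =>
    (integrable_haarFn e.1 e.2).bdd_mul (κ.continuous.comp (by fun_prop)).aestronglyMeasurable
      (ae_of_all _ fun t => SchwartzMap.norm_le_seminorm ℝ κ _)
  rw [integral_finsetSum]
  · refine Finset.sum_congr rfl fun e _ => ?_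
    rw [← integral_const_mul ((2 : ℂ) ^ e.1 * ∫ y, f y * haarFn e.1 e.2 y)]
    refine integral_congr_ae (ae_of_all _ fun t => ?_)
    simp only
    ring
  · intro e _
    refine ((hi e).const_mul ((2 : ℂ) ^ e.1 * ∫ y, f y * haarFn e.1 e.2 y)).congr
      (ae_of_all _ fun t => ?_)
    simp only
    ring

/-- Pointwise domination of the Littlewood–Paley pieces of a Haar projection. -/
lemma IsCutoff.exists_enorm_LPop_haarProj_le {φ₀ : ℝ → ℂ} (h : IsCutoff φ₀) (M : ℕ) :
    ∃ C : ℝ≥0∞, C ≠ ⊤ ∧ ∀ (E : Finset (ℕ × ℤ)) (f : SchwartzMap ℝ ℂ) (k : ℕ) (x : ℝ),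
      ‖LPop φ₀ k (haarProj E f) x‖ₑ ≤ C * ∑ j ∈ HFset E, ∑' n,
        ((2 ^ (j - k))⁻¹) ^ 2 * ((2 ^ (j - n))⁻¹ * (2 ^ (n - j))⁻¹) *
          nodeSum M k j n (fun s => ‖LPop φ₀ n f s‖ₑ) x := by
  obtain ⟨C₁, hC₁, h₁⟩ := exists_isKernel_multiplier h.hasCompactSupport h.contDiff
    h.hasCompactSupport_annulus h.contDiff_annulus (δ := 2 / 3) (by norm_num) h.annulus_eq_zero M
  obtain ⟨C₂, hC₂, h₂⟩ := exists_isKernel_multiplier (h.hasCompactSupport_mul (c := 2⁻¹)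
    (by norm_num)) (h.contDiff_mul _) h.hasCompactSupport_fatAnnulus h.contDiff_fatAnnulus
    (δ := 1 / 3) (by norm_num) h.fatAnnulus_eq_zero 2
  have e2 : ‖(2 : ℂ)‖ₑ = 2 := by
    rw [← ofReal_norm]
    simp
  refine ⟨8 * C₂ * (2 ^ (M + 1) * C₁), by finiteness, fun E f k x => ?_⟩
  have hcoef : ∀ (j : ℕ) (μ : ℤ), 2 ^ j * ‖∫ y, f y * haarFn j μ y‖ₑ ≤ ∑' n, 8 * C₂ *
      ((2 ^ (j - n))⁻¹ * (2 ^ (n - j))⁻¹) *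
        ∑ i, avgOp n (fun s => ‖LPop φ₀ n f s‖ₑ) (node j i μ) := by
    intro j μ
    refine (mul_le_mul_right (h.enorm_integral_haarFn_le_tsum f j μ) _).trans ?_
    rw [← ENNReal.tsum_mul_left]
    refine ENNReal.tsum_le_tsum fun n => ?_
    rw [← h.coe_piece]
    refine enorm_integral_haarFn_le_of_conv hC₂ ?_ (h.conv_piece n f) j μ
    rw [SchwartzMap.fourierInv_coe]
    exact h₂ n
  calc ‖LPop φ₀ k (haarProj E f) x‖ₑ
      ≤ ∑ e ∈ E, 2 ^ e.1 * ‖∫ y, f y * haarFn e.1 e.2 y‖ₑ *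
          ‖∫ t, 𝓕⁻ (multiplier φ₀ (annulus φ₀) k) (x - t) * haarFn e.1 e.2 t‖ₑ := by
        rw [h.LPop_eq_conv_schwartz, conv_haarProj_apply, SchwartzMap.fourierInv_coe]
        refine (enorm_sum_le _ _).trans (le_of_eq (Finset.sum_congr rfl fun e _ => ?_))
        rw [enorm_mul, enorm_mul, enorm_pow, e2]
        rfl
    _ ≤ ∑ e ∈ E, (∑' n, 8 * C₂ * ((2 ^ (e.1 - n))⁻¹ * (2 ^ (n - e.1))⁻¹) *
          ∑ i, avgOp n (fun s => ‖LPop φ₀ n f s‖ₑ) (node e.1 i e.2)) *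
          (2 ^ (M + 1) * C₁ * ((2 ^ (e.1 - k))⁻¹) ^ 2 *
            ∑ i, ((peetre k (x - node e.1 i e.2))⁻¹) ^ M) := by
        gcongr with e _
        · exact hcoef _ _
        · exact (h₁ k).enorm_integral_haarFn_le hC₁ _ _ _
    _ ≤ ∑ j ∈ HFset E, ∑' μ, (∑' n, 8 * C₂ * ((2 ^ (j - n))⁻¹ * (2 ^ (n - j))⁻¹) *
          ∑ i, avgOp n (fun s => ‖LPop φ₀ n f s‖ₑ) (node j i μ)) *
          (2 ^ (M + 1) * C₁ * ((2 ^ (j - k))⁻¹) ^ 2 *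
            ∑ i, ((peetre k (x - node j i μ))⁻¹) ^ M) :=
        sum_le_sum_HFset_tsum E fun j μ =>
          (∑' n, 8 * C₂ * ((2 ^ (j - n))⁻¹ * (2 ^ (n - j))⁻¹) *
          ∑ i, avgOp n (fun s => ‖LPop φ₀ n f s‖ₑ) (node j i μ)) *
          (2 ^ (M + 1) * C₁ * ((2 ^ (j - k))⁻¹) ^ 2 *
            ∑ i, ((peetre k (x - node j i μ))⁻¹) ^ M)
    _ = _ := by
        rw [Finset.mul_sum]
        refine Finset.sum_congr rfl fun j _ => ?_
        simp_rw [nodeSum_eq_tsum, ← ENNReal.tsum_mul_right]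
        rw [ENNReal.tsum_comm, ← ENNReal.tsum_mul_left]
        refine tsum_congr fun n => ?_
        rw [← ENNReal.tsum_mul_left, ← ENNReal.tsum_mul_left]
        refine tsum_congr fun μ => ?_
        ring

lemma measurable_nodeSum (M k j n : ℕ) (u : ℝ → ℝ≥0∞) :
    Measurable (nodeSum M k j n u) := by
  unfold nodeSum
  refine Measurable.tsum fun e => ?_
  fun_prop

lemma tsum_rpow_le_tsum_rpow {s : ℝ} (hs : 0 < s) (hs1 : s ≤ 1) (b : ℕ → ℝ≥0∞) :
    (∑' k, b k) ^ s ≤ ∑' k, b k ^ s := by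
  have hfin : ∀ t : Finset ℕ, (∑ k ∈ t, b k) ^ s ≤ ∑ k ∈ t, b k ^ s := by
    intro t
    induction t using Finset.induction_on with
    | empty => simp [hs]
    | insert a t ha ih =>
      rw [Finset.sum_insert ha, Finset.sum_insert ha]
      exact (ENNReal.rpow_add_le_add_rpow _ _ hs.le hs1).trans (by gcongr)
  refine le_of_tendsto ((ENNReal.continuous_rpow_const.tendsto _).comp
    (ENNReal.tendsto_nat_tsum b)) (Filter.Eventually.of_forall fun N => ?_)
  exact (hfin _).trans (ENNReal.sum_le_tsum _)

lemma lintegral_mul_sum_tsum_rpow_le {r : ℝ} (hr : 1 ≤ r) (A : Finset ℕ) {α : ℕ → ℕ → ℝ≥0∞}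
    (hα0 : ∀ j n, α j n ≠ 0) (hα : ∀ j n, α j n ≠ ⊤) {U : ℕ → ℕ → ℝ → ℝ≥0∞}
    (hU : ∀ j n, Measurable (U j n)) {w : ℝ → ℝ≥0∞} (hw : Measurable w) {K : ℝ≥0∞}
    {b : ℕ → ℝ≥0∞} (h : ∀ j ∈ A, ∀ n, ∫⁻ x, w x * U j n x ^ r ≤ K * α j n ^ r * b n) :
    ∫⁻ x, w x * (∑ j ∈ A, ∑' n, U j n x) ^ r ≤
      K * (∑ j ∈ A, ∑' n, α j n) ^ (r - 1) * ∑ j ∈ A, ∑' n, α j n * b n := by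
  have hsum : ∀ F : ℕ → ℕ → ℝ≥0∞, ∑ j ∈ A, ∑' n, F j n = ∑' e : A × ℕ, F e.1 e.2 := by
    intro F
    rw [ENNReal.tsum_prod', tsum_fintype]
    exact (Finset.sum_coe_sort A fun j => ∑' n, F j n).symm
  simp_rw [hsum]
  have hr0 : 0 ≤ r := by linarith
  calc ∫⁻ x, w x * (∑' e : A × ℕ, U e.1 e.2 x) ^ r
      ≤ ∫⁻ x, (∑' e : A × ℕ, α e.1 e.2) ^ (r - 1) *
          ∑' e : A × ℕ, w x * (α e.1 e.2 * ((α e.1 e.2)⁻¹ * U e.1 e.2 x) ^ r) := by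
        refine lintegral_mono fun x => ?_
        have := tsum_mul_rpow_le hr (fun e : A × ℕ => α e.1 e.2)
          (fun e => (α e.1 e.2)⁻¹ * U e.1 e.2 x)
        simp only [ENNReal.mul_inv_cancel_left (hα0 _ _) (hα _ _)] at this
        rw [ENNReal.tsum_mul_left, mul_left_comm]
        gcongr
    _ = (∑' e : A × ℕ, α e.1 e.2) ^ (r - 1) *
          ∑' e : A × ℕ, ∫⁻ x, w x * (α e.1 e.2 * ((α e.1 e.2)⁻¹ * U e.1 e.2 x) ^ r) := by
        rw [lintegral_const_mul _ (Measurable.tsum fun e => by have := hU e.1 e.2; fun_prop),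
          lintegral_tsum fun e => by have := hU e.1 e.2; fun_prop]
    _ ≤ (∑' e : A × ℕ, α e.1 e.2) ^ (r - 1) * ∑' e : A × ℕ, K * (α e.1 e.2 * b e.2) := by
        gcongr with e
        have hm := hU e.1 e.2
        calc ∫⁻ x, w x * (α e.1 e.2 * ((α e.1 e.2)⁻¹ * U e.1 e.2 x) ^ r)
            = (α e.1 e.2 * (α e.1 e.2)⁻¹ ^ r) * ∫⁻ x, w x * U e.1 e.2 x ^ r := by
              rw [← lintegral_const_mul _ (by fun_prop)]
              refine lintegral_congr fun x => ?_
              rw [ENNReal.mul_rpow_of_nonneg _ _ hr0]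
              ring
          _ ≤ (α e.1 e.2 * (α e.1 e.2)⁻¹ ^ r) * (K * α e.1 e.2 ^ r * b e.2) := by
              gcongr
              exact h _ e.1.2 _
          _ = α e.1 e.2 * ((α e.1 e.2)⁻¹ * α e.1 e.2) ^ r * (K * b e.2) := by
              rw [ENNReal.mul_rpow_of_nonneg _ _ hr0]
              ring
          _ = _ := by
              rw [ENNReal.inv_mul_cancel (hα0 _ _) (hα _ _), ENNReal.one_rpow]
              ring
    _ = _ := by
        rw [ENNReal.tsum_mul_left]
        ring

/-- Real powers of two in `[0, ∞]`. -/
abbrev twoPow (t : ℝ) : ℝ≥0∞ := (2 : ℝ≥0∞) ^ t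

lemma twoPow_add (s t : ℝ) : twoPow (s + t) = twoPow s * twoPow t :=
  ENNReal.rpow_add _ _ (by simp) (by simp)

lemma twoPow_ne_zero (t : ℝ) : twoPow t ≠ 0 := by simp [twoPow]

lemma twoPow_ne_top (t : ℝ) : twoPow t ≠ ⊤ := by simp [twoPow]

lemma twoPow_mono {s t : ℝ} (h : s ≤ t) : twoPow s ≤ twoPow t :=
  ENNReal.rpow_le_rpow_of_exponent_le (by norm_num) h

lemma twoPow_rpow (s t : ℝ) : twoPow s ^ t = twoPow (s * t) := (ENNReal.rpow_mul _ _ _).symm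

lemma pow_eq_twoPow (n : ℕ) : (2 : ℝ≥0∞) ^ n = twoPow n := (ENNReal.rpow_natCast _ _).symm

lemma inv_twoPow (t : ℝ) : (twoPow t)⁻¹ = twoPow (-t) := (ENNReal.rpow_neg _ _).symm

/-- Two-sided geometric series. -/
def geo (η : ℝ) : ℝ≥0∞ := ∑' z : ℤ, twoPow (-(η * |(z : ℝ)|))

lemma geo_ne_top {η : ℝ} (hη : 0 < η) : geo η ≠ ⊤ := by
  set c : ℝ≥0∞ := twoPow (-η)
  have hc : c < 1 := by
    have : c = (2 ^ η)⁻¹ := ENNReal.rpow_neg _ _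
    rw [this]
    exact ENNReal.inv_lt_one.2 (ENNReal.one_lt_rpow (by norm_num) hη)
  have hf : ∑' n : ℕ, c ^ n ≠ ⊤ := by
    rw [ENNReal.tsum_geometric]
    exact ENNReal.inv_ne_top.2 (tsub_pos_of_lt hc).ne'
  have he : ∀ z : ℤ, twoPow (-(η * |(z : ℝ)|)) = c ^ z.natAbs := by
    intro z
    rw [← ENNReal.rpow_natCast, twoPow_rpow, Nat.cast_natAbs, Int.cast_abs, neg_mul]
  have hle : geo η ≤ ∑' n : ℕ, c ^ n + ∑' n : ℕ, c ^ n := by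
    unfold geo
    simp_rw [he]
    have := tsum_of_nat_of_neg_add_one (f := fun z : ℤ => c ^ z.natAbs) ENNReal.summable
      ENNReal.summable
    rw [this]
    refine add_le_add (le_of_eq (by simp)) (ENNReal.tsum_le_tsum fun n => ?_)
    exact pow_le_pow_right_of_le_one' hc.le (by omega)
  exact ne_top_of_le_ne_top (ENNReal.add_ne_top.2 ⟨hf, hf⟩) hle

lemma tsum_twoPow_le_geo (η : ℝ) (m : ℤ) :
    ∑' n : ℕ, twoPow (-(η * |((n : ℝ) - m)|)) ≤ geo η := by
  have hinj : Function.Injective fun n : ℕ => (n : ℤ) - m := fun a b h => by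
    simp only at h
    omega
  have := ENNReal.tsum_comp_le_tsum_of_injective hinj fun z : ℤ => twoPow (-(η * |(z : ℝ)|))
  simpa [geo] using this

lemma sum_twoPow_le_geo (η : ℝ) (m : ℤ) (s : Finset ℕ) :
    ∑ n ∈ s, twoPow (-(η * |((n : ℝ) - m)|)) ≤ geo η :=
  (ENNReal.sum_le_tsum s).trans (tsum_twoPow_le_geo η m)

lemma card_filter_window_le_Zbar (A : Finset ℕ) (n : ℤ) :
    (A.filter fun j : ℕ => |(j : ℝ) - n| ≤ Real.logb 2 (A.card : ℝ)).card ≤ Zbar A := by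
  unfold Zbar
  refine le_csSup ⟨A.card, ?_⟩ ⟨n, rfl⟩
  rintro c ⟨m, rfl⟩
  exact Finset.card_filter_le _ _

lemma natLog_two_le_logb (c : ℕ) : (Nat.log 2 c : ℝ) ≤ Real.logb 2 c := by
  have := Real.natLog_le_logb c 2
  exact_mod_cast this

lemma one_le_Zbar {A : Finset ℕ} (hA : 2 ≤ A.card) : 1 ≤ Zbar A := by
  obtain ⟨a, ha⟩ : A.Nonempty := Finset.card_pos.1 (by omega)
  refine le_trans ?_ (card_filter_window_le_Zbar A a)
  refine Finset.card_pos.2 ⟨a, Finset.mem_filter.2 ⟨ha, ?_⟩⟩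
  have := (Nat.cast_nonneg (α := ℝ) _).trans (natLog_two_le_logb A.card)
  simpa using this

lemma card_filter_le_mul_Zbar {A : Finset ℕ} (hA : 2 ≤ A.card) (B k : ℕ) :
    (A.filter fun j => j ≤ k ∧ k ≤ j + B * Nat.log 2 A.card).card ≤ (B + 1) * Zbar A := by
  set L := Nat.log 2 A.card with hL
  have hL1 : 0 < L := Nat.log_pos (by norm_num) hA
  have hsub : (A.filter fun j => j ≤ k ∧ k ≤ j + B * L) ⊆ (Finset.range (B + 1)).biUnion fun i =>
      A.filter fun j : ℕ => |(j : ℝ) - ((k - i * L : ℤ) : ℝ)| ≤ Real.logb 2 (A.card : ℝ) := by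
    intro j hj
    obtain ⟨hjA, hjk, hkj⟩ := Finset.mem_filter.1 hj
    refine Finset.mem_biUnion.2 ⟨(k - j) / L, Finset.mem_range.2 ?_, Finset.mem_filter.2 ⟨hjA, ?_⟩⟩
    · have : (k - j) / L ≤ B := Nat.div_le_of_le_mul (by rw [mul_comm]; omega)
      omega
    · have h1 := Nat.div_add_mod (k - j) L
      have h2 := Nat.mod_lt (k - j) hL1
      generalize (k - j) / L = i at h1 ⊢
      generalize (k - j) % L = m at h1 h2
      have h3 : (L : ℝ) * i + m = k - j := by
        rw [← Nat.cast_sub hjk]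
        exact_mod_cast h1
      have h4 : (m : ℝ) ≤ L := by exact_mod_cast h2.le
      refine le_trans ?_ (natLog_two_le_logb _)
      rw [← hL]
      push_cast
      have h5 : (j : ℝ) - (k - i * L) = -(m : ℝ) := by linarith
      rw [h5, abs_neg, abs_of_nonneg (by positivity)]
      exact h4
  calc _ ≤ _ := Finset.card_le_card hsub
    _ ≤ ∑ i ∈ Finset.range (B + 1), Zbar A := Finset.card_biUnion_le.trans
        (Finset.sum_le_sum fun i _ => card_filter_window_le_Zbar A _)
    _ = _ := by simp

lemma twoPow_sub_le (η : ℝ) {j k R : ℕ} (h : k ≤ j + R) :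
    twoPow (-(η * ((j - k : ℕ) : ℝ))) ≤
      twoPow (-(η * |(j : ℝ) - k|)) + if j ≤ k ∧ k ≤ j + R then 1 else 0 := by
  rcases le_total j k with hjk | hjk
  · simp [hjk, h, twoPow]
  · rw [Nat.cast_sub hjk, abs_of_nonneg (by simpa using hjk)]
    exact le_self_add

lemma sum_near_le (η : ℝ) (A : Finset ℕ) (R k : ℕ) :
    ∑ j ∈ A with k ≤ j + R, ∑' n : ℕ,
        twoPow (-(η * ((j - k : ℕ) : ℝ))) * twoPow (-(η * |(n : ℝ) - j|)) ≤
      (geo η + (A.filter fun j => j ≤ k ∧ k ≤ j + R).card) * geo η := by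
  simp_rw [ENNReal.tsum_mul_left]
  calc _ ≤ ∑ j ∈ A with k ≤ j + R, (twoPow (-(η * |(j : ℝ) - k|)) +
        if j ≤ k ∧ k ≤ j + R then 1 else 0) * geo η := by
        refine Finset.sum_le_sum fun j hj => mul_le_mul' ?_ ?_
        · exact twoPow_sub_le η (Finset.mem_filter.1 hj).2
        · exact_mod_cast tsum_twoPow_le_geo η j
    _ ≤ ∑ j ∈ A, (twoPow (-(η * |(j : ℝ) - k|)) +
        if j ≤ k ∧ k ≤ j + R then 1 else 0) * geo η :=
        Finset.sum_le_sum_of_subset (Finset.filter_subset _ _)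
    _ ≤ _ := by
        rw [← Finset.sum_mul, Finset.sum_add_distrib, Finset.sum_boole]
        gcongr
        exact_mod_cast sum_twoPow_le_geo η k A

lemma tsum_near_le (η : ℝ) (A : Finset ℕ) (R n : ℕ) :
    ∑' k : ℕ, ∑ j ∈ A with k ≤ j + R,
        twoPow (-(η * ((j - k : ℕ) : ℝ))) * twoPow (-(η * |(n : ℝ) - j|)) ≤
      (geo η + (R + 1)) * geo η := by
  have hcount : ∀ j : ℕ, ∑' k : ℕ, (if j ≤ k ∧ k ≤ j + R then (1 : ℝ≥0∞) else 0) = R + 1 := by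
    intro j
    rw [tsum_eq_sum (s := Finset.Icc j (j + R)) fun k hk => by simpa using hk]
    rw [Finset.sum_boole, Finset.filter_true_of_mem fun k hk => by simpa using hk]
    rw [Nat.card_Icc, show j + R + 1 - j = R + 1 by omega]
    push_cast
    rfl
  calc _ ≤ ∑' k : ℕ, ∑ j ∈ A, (twoPow (-(η * |(k : ℝ) - j|)) +
        if j ≤ k ∧ k ≤ j + R then 1 else 0) * twoPow (-(η * |(j : ℝ) - n|)) := by
        refine ENNReal.tsum_le_tsum fun k => ?_
        refine le_trans (Finset.sum_le_sum fun j hj => ?_)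
          (Finset.sum_le_sum_of_subset (Finset.filter_subset _ _))
        rw [abs_sub_comm (k : ℝ), abs_sub_comm (j : ℝ) n]
        gcongr
        exact twoPow_sub_le η (Finset.mem_filter.1 hj).2
    _ = ∑ j ∈ A, ∑' k : ℕ, (twoPow (-(η * |(k : ℝ) - j|)) +
        if j ≤ k ∧ k ≤ j + R then 1 else 0) * twoPow (-(η * |(j : ℝ) - n|)) :=
        Summable.tsum_finsetSum fun _ _ => ENNReal.summable
    _ ≤ ∑ j ∈ A, (geo η + (R + 1)) * twoPow (-(η * |(j : ℝ) - n|)) := by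
        refine Finset.sum_le_sum fun j _ => ?_
        rw [ENNReal.tsum_mul_right, ENNReal.tsum_add, hcount]
        gcongr
        exact_mod_cast tsum_twoPow_le_geo η j
    _ ≤ _ := by
        rw [← Finset.mul_sum]
        gcongr
        exact_mod_cast sum_twoPow_le_geo η n A

lemma twoPow_far_eq (η : ℝ) {j k R : ℕ} (h : ¬k ≤ j + R) :
    twoPow (-(η * |(k : ℝ) - j|)) =
      twoPow (-(η * R)) * twoPow (-(η * |(k : ℝ) - (j + R : ℕ)|)) := by
  have h' : ((j + R : ℕ) : ℝ) ≤ k := by exact_mod_cast (not_le.1 h).le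
  have hR : (0 : ℝ) ≤ R := Nat.cast_nonneg R
  have h2 : |(k : ℝ) - (j + R : ℕ)| = k - (j + R : ℕ) := abs_of_nonneg (by linarith)
  push_cast at h' h2 ⊢
  rw [← twoPow_add, h2, abs_of_nonneg (by linarith)]
  congr 1
  ring

lemma sum_far_le {η : ℝ} (hη : 0 ≤ η) (A : Finset ℕ) (R k : ℕ) :
    ∑ j ∈ A with ¬k ≤ j + R, ∑' n : ℕ,
        twoPow (-(η * |(k : ℝ) - j|)) * twoPow (-(η * |(n : ℝ) - j|)) ≤
      A.card * twoPow (-(η * R)) * geo η := by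
  simp_rw [ENNReal.tsum_mul_left]
  calc _ ≤ ∑ j ∈ A with ¬k ≤ j + R, twoPow (-(η * R)) * geo η := by
        refine Finset.sum_le_sum fun j hj => ?_
        rw [twoPow_far_eq η (Finset.mem_filter.1 hj).2]
        gcongr
        · refine mul_le_of_le_one_right' ?_
          rw [← ENNReal.rpow_zero (x := 2)]
          exact twoPow_mono (by simpa using mul_nonneg hη (abs_nonneg _))
        · exact_mod_cast tsum_twoPow_le_geo η j
    _ ≤ ∑ j ∈ A, twoPow (-(η * R)) * geo η :=
        Finset.sum_le_sum_of_subset (Finset.filter_subset _ _)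
    _ = _ := by
        rw [Finset.sum_const, nsmul_eq_mul, mul_assoc]

lemma tsum_far_le (η : ℝ) (A : Finset ℕ) (R : ℕ) :
    ∑' k : ℕ, ∑ j ∈ A with ¬k ≤ j + R, ∑' n : ℕ,
        twoPow (-(η * |(k : ℝ) - j|)) * twoPow (-(η * |(n : ℝ) - j|)) ≤
      A.card * twoPow (-(η * R)) * geo η * geo η := by
  simp_rw [ENNReal.tsum_mul_left]
  calc _ ≤ ∑' k : ℕ, ∑ j ∈ A, twoPow (-(η * R)) *
          twoPow (-(η * |(k : ℝ) - (j + R : ℕ)|)) * geo η := by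
        refine ENNReal.tsum_le_tsum fun k => ?_
        refine le_trans (Finset.sum_le_sum fun j hj => ?_)
          (Finset.sum_le_sum_of_subset (Finset.filter_subset _ _))
        rw [twoPow_far_eq η (Finset.mem_filter.1 hj).2]
        gcongr
        exact_mod_cast tsum_twoPow_le_geo η j
    _ = ∑ j ∈ A, ∑' k : ℕ, twoPow (-(η * R)) *
          twoPow (-(η * |(k : ℝ) - (j + R : ℕ)|)) * geo η :=
        Summable.tsum_finsetSum fun _ _ => ENNReal.summable
    _ ≤ ∑ j ∈ A, twoPow (-(η * R)) * geo η * geo η := by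
        refine Finset.sum_le_sum fun j _ => ?_
        rw [ENNReal.tsum_mul_right, ENNReal.tsum_mul_left]
        gcongr
        exact_mod_cast tsum_twoPow_le_geo η (j + R : ℕ)
    _ = _ := by
        rw [Finset.sum_const, nsmul_eq_mul]
        ring

lemma card_mul_twoPow_le_one {c B : ℕ} (hc : 2 ≤ c) {η : ℝ} (hB : 2 ≤ η * B) :
    (c : ℝ≥0∞) * twoPow (-(η * (B * Nat.log 2 c : ℕ))) ≤ 1 := by
  have h1 : 1 ≤ Nat.log 2 c := Nat.log_pos (by norm_num) hc
  have h2 : c ≤ 2 ^ (2 * Nat.log 2 c) :=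
    (Nat.lt_pow_succ_log_self (by norm_num) c).le.trans
      (Nat.pow_le_pow_right (by norm_num) (by omega))
  have h3 : (c : ℝ≥0∞) ≤ twoPow (2 * Nat.log 2 c : ℕ) := by
    rw [← pow_eq_twoPow]
    exact_mod_cast h2
  calc _ ≤ twoPow (2 * Nat.log 2 c : ℕ) * twoPow (-(η * (B * Nat.log 2 c : ℕ))) := by gcongr
    _ = twoPow ((2 * Nat.log 2 c : ℕ) + -(η * (B * Nat.log 2 c : ℕ))) := (twoPow_add _ _).symm
    _ ≤ twoPow 0 := by
        refine twoPow_mono ?_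
        push_cast
        have : (0 : ℝ) ≤ Nat.log 2 c := Nat.cast_nonneg _
        nlinarith
    _ = 1 := ENNReal.rpow_zero

/-- The decay factor coming from the cancellation of Haar functions against band-limited ones. -/
def haarCoef (k j n : ℕ) : ℝ≥0∞ :=
  ((2 ^ (j - k))⁻¹) ^ 2 * ((2 ^ (j - n))⁻¹ * (2 ^ (n - j))⁻¹)

lemma abs_sub_eq_tsub_add_tsub (n j : ℕ) :
    |(n : ℝ) - j| = ((n - j : ℕ) : ℝ) + ((j - n : ℕ) : ℝ) := by
  rcases le_total j n with h | h
  · have : (j : ℝ) ≤ n := by exact_mod_cast h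
    rw [Nat.sub_eq_zero_of_le h, Nat.cast_sub h, abs_of_nonneg (by linarith)]
    simp
  · have : (n : ℝ) ≤ j := by exact_mod_cast h
    rw [Nat.sub_eq_zero_of_le h, Nat.cast_sub h, abs_of_nonpos (by linarith)]
    simp

lemma haarCoef_near_le {p q η : ℝ} (hpq : p < q) (hη : η * q ≤ p)
    (hη' : η * q ≤ q - 1) (k j n : ℕ) :
    2 ^ k * haarCoef k j n ^ q * ((2 ^ (j - k)) ^ (q - 1) * (2 ^ (n - min n (min j k))) ^ (q - p) *
      (2 ^ max n j * (2 ^ k)⁻¹)) ≤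
    (twoPow (-(η * ((j - k : ℕ) : ℝ))) * twoPow (-(η * |(n : ℝ) - j|))) ^ q * 2 ^ n := by
  have hmax : ((max n j : ℕ) : ℝ) = n + ((j - n : ℕ) : ℝ) := by
    have : max n j = n + (j - n) := by omega
    exact_mod_cast this
  have hmin : ((n - min n (min j k) : ℕ) : ℝ) ≤ ((n - j : ℕ) : ℝ) + ((j - k : ℕ) : ℝ) := by
    have : n - min n (min j k) ≤ (n - j) + (j - k) := by omega
    exact_mod_cast this
  simp only [haarCoef, sq, pow_eq_twoPow, inv_twoPow, ← twoPow_add, twoPow_rpow]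
  refine twoPow_mono ?_
  rw [hmax, abs_sub_eq_tsub_add_tsub]
  have hx : (0 : ℝ) ≤ ((j - k : ℕ) : ℝ) := Nat.cast_nonneg _
  have hy : (0 : ℝ) ≤ ((n - j : ℕ) : ℝ) := Nat.cast_nonneg _
  have hz : (0 : ℝ) ≤ ((j - n : ℕ) : ℝ) := Nat.cast_nonneg _
  generalize ((n - min n (min j k) : ℕ) : ℝ) = m at *
  generalize ((j - k : ℕ) : ℝ) = x at *
  generalize ((n - j : ℕ) : ℝ) = y at *
  generalize ((j - n : ℕ) : ℝ) = z at *
  have e1 := mul_le_mul_of_nonneg_right hmin (sub_nonneg.2 hpq.le)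
  have e2 : 0 ≤ x * (p + 1 - η * q) := mul_nonneg hx (by linarith)
  have e3 : 0 ≤ y * (p - η * q) := mul_nonneg hy (by linarith)
  have e4 : 0 ≤ z * (q - 1 - η * q) := mul_nonneg hz (by linarith)
  nlinarith

lemma haarCoef_far_le {p q η : ℝ} (hp : 1 < p) (hpq : p < q) (hη : η * p ≤ 1 - p / q)
    (hη' : η * p ≤ p - 1) {k j : ℕ} (hjk : j ≤ k) (n : ℕ) :
    twoPow (k * (p / q)) * haarCoef k j n ^ p *
      ((2 ^ (j - k)) ^ (p - 1) * (2 ^ (n - min n (min j k))) ^ (0 : ℝ) *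
      (2 ^ max n j * (2 ^ k)⁻¹)) ≤
    (twoPow (-(η * |(k : ℝ) - j|)) * twoPow (-(η * |(n : ℝ) - j|))) ^ p * twoPow (n * (p / q)) := by
  have hmax : ((max n j : ℕ) : ℝ) = j + ((n - j : ℕ) : ℝ) := by
    have : max n j = j + (n - j) := by omega
    exact_mod_cast this
  have hn : (n : ℝ) = j + ((n - j : ℕ) : ℝ) - ((j - n : ℕ) : ℝ) := by
    have : n + (j - n) = j + (n - j) := by omega
    have : (n : ℝ) + ((j - n : ℕ) : ℝ) = j + ((n - j : ℕ) : ℝ) := by exact_mod_cast this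
    linarith
  have hjk' : (j : ℝ) ≤ k := by exact_mod_cast hjk
  simp only [haarCoef, sq, pow_eq_twoPow, inv_twoPow, ← twoPow_add, twoPow_rpow]
  refine twoPow_mono ?_
  rw [hmax, abs_sub_eq_tsub_add_tsub n j, abs_of_nonneg (by linarith), Nat.sub_eq_zero_of_le hjk]
  have hy : (0 : ℝ) ≤ ((n - j : ℕ) : ℝ) := Nat.cast_nonneg _
  have hz : (0 : ℝ) ≤ ((j - n : ℕ) : ℝ) := Nat.cast_nonneg _
  generalize ((n - j : ℕ) : ℝ) = y at *
  generalize ((j - n : ℕ) : ℝ) = z at *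
  have hs1 : p / q < 1 := (div_lt_one (by linarith)).2 hpq
  have hs0 : 0 < p / q := div_pos (by linarith) (by linarith)
  generalize p / q = s at *
  rw [hn]
  have e1 := mul_nonneg (sub_nonneg.2 hjk') (sub_nonneg.2 hη)
  have e3 : 0 ≤ y * (p - 1 - η * p) := mul_nonneg hy (by linarith)
  have e4 : 0 ≤ z * (p - 1 - η * p) := mul_nonneg hz (by linarith)
  have e5 : 0 ≤ y * s := mul_nonneg hy hs0.le
  have e6 : 0 ≤ z * (1 - s) := mul_nonneg hz (by linarith)
  push_cast
  nlinarith

/-- The constant in the weighted estimate for `nodeSum`. -/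
def nodeConst (r σ : ℝ) (G : ℝ≥0∞) : ℝ≥0∞ :=
  (36 * decayMass) ^ (r - 1) * (decayMass ^ (r - 1 - σ) * G ^ σ * 16 ^ σ) * decayMass *
    (36 * decayMass)

lemma nodeConst_ne_top {r σ : ℝ} (hσ : 0 ≤ σ) (hσr : σ + 1 ≤ r) {G : ℝ≥0∞} (hG : G ≠ ⊤) :
    nodeConst r σ G ≠ ⊤ := by
  have hD := decayMass_ne_top
  unfold nodeConst
  have h1 : (36 * decayMass) ^ (r - 1) ≠ ⊤ :=
    ENNReal.rpow_ne_top_of_nonneg (by linarith) (by finiteness)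
  have h2 : decayMass ^ (r - 1 - σ) ≠ ⊤ := ENNReal.rpow_ne_top_of_nonneg (by linarith) hD
  have h3 : G ^ σ ≠ ⊤ := ENNReal.rpow_ne_top_of_nonneg hσ hG
  have h4 : (16 : ℝ≥0∞) ^ σ ≠ ⊤ := ENNReal.rpow_ne_top_of_nonneg hσ (by simp)
  finiteness

/-- The part of the dominating sum with Haar frequencies in a given set. -/
def haarSum (M : ℕ) (A : Finset ℕ) (k : ℕ) (u : ℕ → ℝ → ℝ≥0∞) (x : ℝ) : ℝ≥0∞ :=
  ∑ j ∈ A, ∑' n, haarCoef k j n * nodeSum M k j n (u n) x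

lemma measurable_haarSum (M : ℕ) (A : Finset ℕ) (k : ℕ) (u : ℕ → ℝ → ℝ≥0∞) :
    Measurable (haarSum M A k u) := by
  unfold haarSum
  refine Finset.measurable_fun_sum _ fun j _ => Measurable.tsum fun n => ?_
  exact (measurable_nodeSum M k j n (u n)).const_mul _

lemma lintegral_haarSum_rpow_le {r σ : ℝ} (hσ : 0 ≤ σ) (hσr : σ + 1 ≤ r) {g : ℝ → ℝ≥0∞}
    (hg : Measurable g) (hg0 : ∀ᵐ x, g x ≠ 0 ∧ g x ≠ ⊤) {G : ℝ≥0∞}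
    (hG : ∀ m x, avgOp m g x ≤ G * g x) {u : ℕ → ℝ → ℝ≥0∞} (hu : ∀ n, Measurable (u n)) {M : ℕ}
    (hM : 2 * σ + 2 ≤ M) (A : Finset ℕ) (k : ℕ) {α : ℕ → ℕ → ℝ≥0∞} (hα0 : ∀ j n, α j n ≠ 0)
    (hα : ∀ j n, α j n ≠ ⊤) {c : ℝ≥0∞} {d : ℕ → ℝ≥0∞}
    (h : ∀ j ∈ A, ∀ n, c * haarCoef k j n ^ r * ((2 ^ (j - k)) ^ (r - 1) *
      (2 ^ (n - min n (min j k))) ^ σ * (2 ^ max n j * (2 ^ k)⁻¹)) ≤ α j n ^ r * d n) :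
    ∫⁻ x, c * g x ^ (-σ) * haarSum M A k u x ^ r ≤
      nodeConst r σ G * (∑ j ∈ A, ∑' n, α j n) ^ (r - 1) *
        ∑ j ∈ A, ∑' n, α j n * (d n * ∫⁻ y, u n y ^ r * g y ^ (-σ)) := by
  have hr : 1 ≤ r := by linarith
  refine lintegral_mul_sum_tsum_rpow_le hr A hα0 hα
    (fun j n => (measurable_nodeSum M k j n (u n)).const_mul _) (by fun_prop) fun j hj n => ?_
  have hm := measurable_nodeSum M k j n (u n)
  calc ∫⁻ x, c * g x ^ (-σ) * (haarCoef k j n * nodeSum M k j n (u n) x) ^ r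
      = c * haarCoef k j n ^ r * ∫⁻ x, g x ^ (-σ) * nodeSum M k j n (u n) x ^ r := by
        rw [← lintegral_const_mul _ (by fun_prop)]
        refine lintegral_congr fun x => ?_
        rw [ENNReal.mul_rpow_of_nonneg _ _ (by linarith)]
        ring
    _ ≤ c * haarCoef k j n ^ r * (nodeConst r σ G * ((2 ^ (j - k)) ^ (r - 1) *
          (2 ^ (n - min n (min j k))) ^ σ * (2 ^ max n j * (2 ^ k)⁻¹)) *
          ∫⁻ y, u n y ^ r * g y ^ (-σ)) := by
        gcongr
        exact lintegral_nodeSum_rpow_le hσ hσr hg hg0 hG (hu n) hM k j n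
    _ = nodeConst r σ G * (c * haarCoef k j n ^ r * ((2 ^ (j - k)) ^ (r - 1) *
          (2 ^ (n - min n (min j k))) ^ σ * (2 ^ max n j * (2 ^ k)⁻¹))) *
          ∫⁻ y, u n y ^ r * g y ^ (-σ) := by ring
    _ ≤ nodeConst r σ G * (α j n ^ r * d n) * ∫⁻ y, u n y ^ r * g y ^ (-σ) := by
        exact mul_le_mul' (mul_le_mul' le_rfl (h j hj n)) le_rfl
    _ = _ := by ring

lemma lintegral_near_le {p q η : ℝ} (hp : 1 < p) (hpq : p < q) (hη : η * q ≤ p)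
    (hη' : η * q ≤ q - 1) {g : ℝ → ℝ≥0∞} (hg : Measurable g) (hg0 : ∀ᵐ x, g x ≠ 0 ∧ g x ≠ ⊤)
    {G : ℝ≥0∞} (hG : ∀ m x, avgOp m g x ≤ G * g x) {u : ℕ → ℝ → ℝ≥0∞}
    (hu : ∀ n, Measurable (u n)) {M : ℕ} (hM : 2 * (q - p) + 2 ≤ M) (A : Finset ℕ) (R : ℕ)
    {Z : ℝ≥0∞} (hZ : ∀ k, (geo η + (A.filter fun j => j ≤ k ∧ k ≤ j + R).card) * geo η ≤ Z) :
    ∫⁻ x, (∑' k, 2 ^ k * haarSum M {j ∈ A | k ≤ j + R} k u x ^ q) * g x ^ (-(q - p)) ≤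
      nodeConst q (q - p) G * Z ^ (q - 1) * ((geo η + (R + 1)) * geo η) *
        ∫⁻ x, (∑' n, 2 ^ n * u n x ^ q) * g x ^ (-(q - p)) := by
  have hms := fun k => measurable_haarSum M {j ∈ A | k ≤ j + R} k u
  set α : ℕ → ℕ → ℕ → ℝ≥0∞ := fun k j n =>
    twoPow (-(η * ((j - k : ℕ) : ℝ))) * twoPow (-(η * |(n : ℝ) - j|)) with hα
  set b : ℕ → ℝ≥0∞ := fun n => 2 ^ n * ∫⁻ y, u n y ^ q * g y ^ (-(q - p)) with hb
  have hb' : ∫⁻ x, (∑' n, 2 ^ n * u n x ^ q) * g x ^ (-(q - p)) = ∑' n, b n := by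
    simp_rw [← ENNReal.tsum_mul_right, hb]
    rw [lintegral_tsum fun n => by have := hu n; fun_prop]
    refine tsum_congr fun n => ?_
    have := hu n
    rw [← lintegral_const_mul _ (by fun_prop)]
    simp_rw [mul_assoc]
  have hk : ∀ k, ∫⁻ x, 2 ^ k * g x ^ (-(q - p)) * haarSum M {j ∈ A | k ≤ j + R} k u x ^ q ≤
      nodeConst q (q - p) G * Z ^ (q - 1) * ∑ j ∈ A with k ≤ j + R, ∑' n, α k j n * b n := by
    intro k
    refine (lintegral_haarSum_rpow_le (by linarith) (by linarith) hg hg0 hG hu hM _ k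
      (α := α k) (d := fun n => 2 ^ n)
      (fun j n => mul_ne_zero (twoPow_ne_zero _) (twoPow_ne_zero _))
      (fun j n => ENNReal.mul_ne_top (twoPow_ne_top _) (twoPow_ne_top _))
      fun j _ n => haarCoef_near_le hpq hη hη' k j n).trans ?_
    gcongr
    · linarith
    · exact (sum_near_le η A R k).trans (hZ k)
  calc ∫⁻ x, (∑' k, 2 ^ k * haarSum M {j ∈ A | k ≤ j + R} k u x ^ q) * g x ^ (-(q - p))
      = ∑' k, ∫⁻ x, 2 ^ k * g x ^ (-(q - p)) * haarSum M {j ∈ A | k ≤ j + R} k u x ^ q := by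
        simp_rw [← ENNReal.tsum_mul_right]
        rw [lintegral_tsum fun k => by have := hms k; fun_prop]
        simp_rw [mul_right_comm]
    _ ≤ ∑' k, nodeConst q (q - p) G * Z ^ (q - 1) *
          ∑ j ∈ A with k ≤ j + R, ∑' n, α k j n * b n := ENNReal.tsum_le_tsum hk
    _ = nodeConst q (q - p) G * Z ^ (q - 1) *
          ∑' n, (∑' k, ∑ j ∈ A with k ≤ j + R, α k j n) * b n := by
        rw [ENNReal.tsum_mul_left]
        congr 1
        simp_rw [← ENNReal.tsum_mul_right, Finset.sum_mul]
        rw [ENNReal.tsum_comm]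
        refine tsum_congr fun k => ?_
        rw [Summable.tsum_finsetSum fun _ _ => ENNReal.summable]
    _ ≤ nodeConst q (q - p) G * Z ^ (q - 1) * ∑' n, ((geo η + (R + 1)) * geo η) * b n := by
        gcongr with n
        exact tsum_near_le η A R n
    _ = _ := by
        rw [ENNReal.tsum_mul_left, hb']
        ring

lemma lintegral_rpow_le_weighted {p q : ℝ} (hp : 0 < p) (hpq : p < q) {H g : ℝ → ℝ≥0∞}
    (hH : Measurable H) (hg : Measurable g) (hg0 : ∀ᵐ x, g x ≠ 0 ∧ g x ≠ ⊤) :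
    ∫⁻ x, H x ^ (p / q) ≤
      (∫⁻ x, H x * g x ^ (-(q - p))) ^ (p / q) * (∫⁻ x, g x ^ p) ^ (1 - p / q) := by
  have hq : 0 < q := by linarith
  have hs1 : p / q < 1 := (div_lt_one hq).2 hpq
  have hs0 : 0 < p / q := div_pos hp hq
  refine le_trans (le_of_eq ?_) (ENNReal.lintegral_mul_norm_pow_le
    (f := fun x => H x * g x ^ (-(q - p))) (g := fun x => g x ^ p)
    (by fun_prop) (by fun_prop) hs0.le (sub_nonneg.2 hs1.le) (by ring))
  refine lintegral_congr_ae ?_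
  filter_upwards [hg0] with x hx
  rw [ENNReal.mul_rpow_of_nonneg _ _ hs0.le, ← ENNReal.rpow_mul, ← ENNReal.rpow_mul, mul_assoc,
    ← ENNReal.rpow_add _ _ hx.1 hx.2]
  have : -(q - p) * (p / q) + p * (1 - p / q) = 0 := by
    field_simp
    ring
  rw [this, ENNReal.rpow_zero, mul_one]

lemma lintegral_inv_peetre_rpow_le {p : ℝ} (hp : 1 ≤ p) :
    ∫⁻ x, (((peetre 0 x)⁻¹) ^ 2) ^ p ≤ decayMass := by
  unfold decayMass
  refine lintegral_mono fun x => ?_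
  refine ENNReal.rpow_le_self_of_le_one ?_ hp
  exact pow_le_one₀ zero_le (ENNReal.inv_le_one.2 (one_le_peetre 0 x))

lemma exists_lintegral_near_rpow_le {p q η : ℝ} (hp : 1 < p) (hpq : p < q) (hη : η * q ≤ p)
    (hη' : η * q ≤ q - 1) {M : ℕ} (hM : 2 * (q - p) + 2 ≤ M) :
    ∃ K : ℝ≥0∞, K ≠ ⊤ ∧ ∀ (u : ℕ → ℝ → ℝ≥0∞), (∀ n, Measurable (u n)) →
      ∫⁻ x, (∑' n, 2 ^ n * u n x ^ q) ^ (p / q) ≠ ⊤ → ∀ (A : Finset ℕ) (R : ℕ) (Z : ℝ≥0∞), Z ≠ ⊤ →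
      (geo η + (R + 1)) * geo η ≠ ⊤ →
      (∀ k, (geo η + (A.filter fun j => j ≤ k ∧ k ≤ j + R).card) * geo η ≤ Z) →
      ∫⁻ x, (∑' k, 2 ^ k * haarSum M {j ∈ A | k ≤ j + R} k u x ^ q) ^ (p / q) ≤
        K * (Z ^ (q - 1) * ((geo η + (R + 1)) * geo η)) ^ (p / q) *
          ∫⁻ x, (∑' n, 2 ^ n * u n x ^ q) ^ (p / q) := by
  have hp0 : 0 < p := by linarith
  have hq : 0 < q := by linarith
  have hs1 : p / q < 1 := (div_lt_one hq).2 hpq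
  have hs0 : 0 < p / q := div_pos hp0 hq
  obtain ⟨G, hG, hmaj⟩ := exists_majorant hp
  have hK0 : nodeConst q (q - p) G ≠ ⊤ := nodeConst_ne_top (by linarith) (by linarith) hG
  refine ⟨nodeConst q (q - p) G ^ (p / q) * (2 ^ p * 2 ^ (p - 1)), ?_,
    fun u hu hI A R Z hZt hΛt hZ => ?_⟩
  · have h1 : nodeConst q (q - p) G ^ (p / q) ≠ ⊤ := ENNReal.rpow_ne_top_of_nonneg hs0.le hK0
    have h2 : (2 : ℝ≥0∞) ^ p ≠ ⊤ := twoPow_ne_top _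
    have h3 : (2 : ℝ≥0∞) ^ (p - 1) ≠ ⊤ := twoPow_ne_top _
    finiteness
  set Q : ℝ → ℝ≥0∞ := fun x => ∑' n, 2 ^ n * u n x ^ q with hQ
  have hQm : Measurable Q := Measurable.tsum fun n => by have := hu n; fun_prop
  set Λ : ℝ≥0∞ := (geo η + (R + 1)) * geo η
  set I := ∫⁻ x, Q x ^ (p / q) with hIdef
  have hms := fun k => measurable_haarSum M {j ∈ A | k ≤ j + R} k u
  have hHm : Measurable fun x => ∑' k, 2 ^ k * haarSum M {j ∈ A | k ≤ j + R} k u x ^ q :=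
    Measurable.tsum fun k => by have := hms k; fun_prop
  have key : ∀ m : ℕ, ∫⁻ x, (∑' k, 2 ^ k * haarSum M {j ∈ A | k ≤ j + R} k u x ^ q) ^ (p / q) ≤
      nodeConst q (q - p) G ^ (p / q) * (2 ^ p * 2 ^ (p - 1)) * (Z ^ (q - 1) * Λ) ^ (p / q) *
        (I + (((m + 1 : ℕ) : ℝ≥0∞)⁻¹) ^ p * decayMass) := by
    intro m
    set ε : ℝ≥0∞ := ((m + 1 : ℕ) : ℝ≥0∞)⁻¹ with hε
    have hε0 : ε ≠ 0 := ENNReal.inv_ne_zero.2 (ENNReal.natCast_ne_top _)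
    have hεt : ε ≠ ⊤ := ENNReal.inv_ne_top.2 (Nat.cast_ne_zero.2 (Nat.succ_ne_zero m))
    obtain ⟨g, hg, hSg, hGg, hgp⟩ := hmaj
      (fun x => Q x ^ (1 / q) + ε * ((peetre 0 x)⁻¹) ^ 2) (by fun_prop)
    have hgI : ∫⁻ x, g x ^ p ≤ 2 ^ p * 2 ^ (p - 1) * (I + ε ^ p * decayMass) := by
      refine hgp.trans ?_
      rw [mul_assoc]
      gcongr
      calc ∫⁻ x, (Q x ^ (1 / q) + ε * ((peetre 0 x)⁻¹) ^ 2) ^ p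
          ≤ ∫⁻ x, 2 ^ (p - 1) * (Q x ^ (p / q) + ε ^ p * (((peetre 0 x)⁻¹) ^ 2) ^ p) := by
            refine lintegral_mono fun x => ?_
            refine (ENNReal.rpow_add_le_mul_rpow_add_rpow _ _ hp.le).trans (le_of_eq ?_)
            rw [ENNReal.mul_rpow_of_nonneg _ _ hp0.le, ← ENNReal.rpow_mul, one_div_mul_eq_div]
        _ = 2 ^ (p - 1) * (I + ε ^ p * ∫⁻ x, (((peetre 0 x)⁻¹) ^ 2) ^ p) := by
            rw [lintegral_const_mul _ (by fun_prop), lintegral_add_left (by fun_prop),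
              lintegral_const_mul _ (by fun_prop)]
        _ ≤ _ := by
            gcongr
            exact lintegral_inv_peetre_rpow_le hp.le
    have hgt : ∫⁻ x, g x ^ p ≠ ⊤ := by
      refine ne_top_of_le_ne_top ?_ hgI
      have h1 : ε ^ p ≠ ⊤ := ENNReal.rpow_ne_top_of_nonneg hp0.le hεt
      have h2 : (2 : ℝ≥0∞) ^ p ≠ ⊤ := twoPow_ne_top _
      have h3 : (2 : ℝ≥0∞) ^ (p - 1) ≠ ⊤ := twoPow_ne_top _
      have h4 := decayMass_ne_top
      finiteness
    have hg0 : ∀ᵐ x, g x ≠ 0 ∧ g x ≠ ⊤ := by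
      filter_upwards [ae_lt_top (by fun_prop) hgt] with x hx
      refine ⟨fun h0 => ?_, fun ht => ?_⟩
      · have := hSg x
        rw [h0, nonpos_iff_eq_zero, add_eq_zero] at this
        exact mul_ne_zero hε0 (pow_ne_zero _ (ENNReal.inv_ne_zero.2 (peetre_ne_top 0 x))) this.2
      · rw [ht, ENNReal.top_rpow_of_pos hp0] at hx
        exact lt_irrefl _ hx
    have hQg : ∫⁻ x, Q x * g x ^ (-(q - p)) ≤ ∫⁻ x, g x ^ p := by
      refine lintegral_mono_ae ?_
      filter_upwards [hg0] with x hx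
      have h1 : Q x ≤ g x ^ q := by
        calc Q x = (Q x ^ (1 / q)) ^ q := by
              rw [← ENNReal.rpow_mul, one_div_mul_cancel hq.ne', ENNReal.rpow_one]
          _ ≤ g x ^ q := by
              gcongr
              exact le_self_add.trans (hSg x)
      calc Q x * g x ^ (-(q - p)) ≤ g x ^ q * g x ^ (-(q - p)) := by gcongr
        _ = g x ^ p := by
            rw [← ENNReal.rpow_add _ _ hx.1 hx.2]
            congr 1
            ring
    calc _ ≤ (∫⁻ x, (∑' k, 2 ^ k * haarSum M {j ∈ A | k ≤ j + R} k u x ^ q) *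
            g x ^ (-(q - p))) ^ (p / q) * (∫⁻ x, g x ^ p) ^ (1 - p / q) :=
          lintegral_rpow_le_weighted hp0 hpq hHm hg hg0
      _ ≤ (nodeConst q (q - p) G * (Z ^ (q - 1) * Λ) * ∫⁻ x, g x ^ p) ^ (p / q) *
            (∫⁻ x, g x ^ p) ^ (1 - p / q) := by
          gcongr
          refine (lintegral_near_le hp hpq hη hη' hg hg0 hGg hu hM A R hZ).trans ?_
          rw [mul_assoc (nodeConst _ _ _)]
          gcongr
      _ = nodeConst q (q - p) G ^ (p / q) * (Z ^ (q - 1) * Λ) ^ (p / q) * ∫⁻ x, g x ^ p := by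
          rw [ENNReal.mul_rpow_of_nonneg _ _ hs0.le, ENNReal.mul_rpow_of_nonneg _ _ hs0.le,
            mul_assoc, ← ENNReal.rpow_add_of_nonneg _ _ hs0.le (by linarith), add_sub_cancel,
            ENNReal.rpow_one]
      _ ≤ nodeConst q (q - p) G ^ (p / q) * (Z ^ (q - 1) * Λ) ^ (p / q) *
            (2 ^ p * 2 ^ (p - 1) * (I + ε ^ p * decayMass)) := by gcongr
      _ = _ := by ring
  have hlim : Filter.Tendsto (fun m : ℕ => (((m + 1 : ℕ) : ℝ≥0∞)⁻¹) ^ p * decayMass)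
      Filter.atTop (nhds 0) := by
    have h1 := ENNReal.tendsto_inv_nat_nhds_zero.comp (Filter.tendsto_add_atTop_nat 1)
    have h2 := (ENNReal.continuous_rpow_const (y := p)).tendsto 0 |>.comp h1
    rw [ENNReal.zero_rpow_of_pos hp0] at h2
    simpa using ENNReal.Tendsto.mul_const h2 (Or.inr decayMass_ne_top)
  have hlim' := ENNReal.Tendsto.const_mul (a := nodeConst q (q - p) G ^ (p / q) *
    (2 ^ p * 2 ^ (p - 1)) * (Z ^ (q - 1) * Λ) ^ (p / q)) (tendsto_const_nhds (x := I) |>.add hlim)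
    (Or.inr ?_)
  · rw [add_zero] at hlim'
    exact ge_of_tendsto' hlim' key
  · have h1 : nodeConst q (q - p) G ^ (p / q) ≠ ⊤ := ENNReal.rpow_ne_top_of_nonneg hs0.le hK0
    have h2 : (2 : ℝ≥0∞) ^ p ≠ ⊤ := twoPow_ne_top _
    have h3 : (2 : ℝ≥0∞) ^ (p - 1) ≠ ⊤ := twoPow_ne_top _
    have h4 : Z ^ (q - 1) ≠ ⊤ := ENNReal.rpow_ne_top_of_nonneg (by linarith) hZt
    have h5 : (Z ^ (q - 1) * Λ) ^ (p / q) ≠ ⊤ :=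
      ENNReal.rpow_ne_top_of_nonneg hs0.le (ENNReal.mul_ne_top h4 hΛt)
    finiteness

lemma lintegral_far_rpow_le {p q η : ℝ} (hp : 1 < p) (hpq : p < q) (hη0 : 0 ≤ η)
    (hη : η * p ≤ 1 - p / q) (hη' : η * p ≤ p - 1) {M : ℕ} (hM : 2 ≤ M) {u : ℕ → ℝ → ℝ≥0∞}
    (hu : ∀ n, Measurable (u n)) (A : Finset ℕ) (R : ℕ) (hA : A.card * twoPow (-(η * R)) ≤ 1) :
    ∫⁻ x, (∑' k, 2 ^ k * haarSum M {j ∈ A | ¬k ≤ j + R} k u x ^ q) ^ (p / q) ≤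
      nodeConst p 0 decayMass * geo η ^ (p - 1) * (geo η * geo η) *
        ∫⁻ x, (∑' n, 2 ^ n * u n x ^ q) ^ (p / q) := by
  have hp0 : 0 < p := by linarith
  have hq : 0 < q := by linarith
  have hs1 : p / q < 1 := (div_lt_one hq).2 hpq
  have hs0 : 0 < p / q := div_pos hp0 hq
  have hpow : ∀ (k : ℕ) (a : ℝ≥0∞), (2 ^ k * a ^ q) ^ (p / q) = twoPow (k * (p / q)) * a ^ p := by
    intro k a
    rw [ENNReal.mul_rpow_of_nonneg _ _ hs0.le, pow_eq_twoPow, twoPow_rpow, ← ENNReal.rpow_mul,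
      mul_div_cancel₀ _ hq.ne']
  have hms := fun k => measurable_haarSum M {j ∈ A | ¬k ≤ j + R} k u
  set I := ∫⁻ x, (∑' n, 2 ^ n * u n x ^ q) ^ (p / q) with hI
  set α : ℕ → ℕ → ℕ → ℝ≥0∞ := fun k j n =>
    twoPow (-(η * |(k : ℝ) - j|)) * twoPow (-(η * |(n : ℝ) - j|)) with hα
  have hterm : ∀ n : ℕ, twoPow (n * (p / q)) * ∫⁻ y, u n y ^ p * (1 : ℝ≥0∞) ^ (-(0 : ℝ)) ≤ I := by
    intro n
    have := hu n
    simp only [ENNReal.one_rpow, mul_one]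
    rw [← lintegral_const_mul _ (by fun_prop)]
    refine lintegral_mono fun x => ?_
    simp only
    rw [← hpow]
    gcongr
    exact ENNReal.le_tsum n
  have hk : ∀ k, ∫⁻ x, (2 ^ k * haarSum M {j ∈ A | ¬k ≤ j + R} k u x ^ q) ^ (p / q) ≤
      nodeConst p 0 decayMass * geo η ^ (p - 1) *
        ((∑ j ∈ A with ¬k ≤ j + R, ∑' n, α k j n) * I) := by
    intro k
    have := lintegral_haarSum_rpow_le (r := p) (σ := 0) le_rfl (by linarith)
      (g := fun _ => 1) measurable_const (by simp) (G := decayMass)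
      (fun m x => by simp [avgOp, lintegral_avgKer_sub]) hu (M := M)
      (by simpa using hM) {j ∈ A | ¬k ≤ j + R} k
      (α := α k) (c := twoPow (k * (p / q))) (d := fun n => twoPow (n * (p / q)))
      (fun j n => mul_ne_zero (twoPow_ne_zero _) (twoPow_ne_zero _))
      (fun j n => ENNReal.mul_ne_top (twoPow_ne_top _) (twoPow_ne_top _))
      fun j hj n => haarCoef_far_le hp hpq hη hη'
        (by have := (Finset.mem_filter.1 hj).2; omega) n
    simp only [ENNReal.one_rpow, mul_one] at this
    simp_rw [hpow]
    refine this.trans ?_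
    have hsum : ∑ j ∈ A with ¬k ≤ j + R, ∑' n, α k j n ≤ geo η :=
      (sum_far_le hη0 A R k).trans (mul_le_of_le_one_left' hA)
    simp_rw [Finset.sum_mul, ← ENNReal.tsum_mul_right]
    gcongr with j _ n
    simpa using hterm n
  calc _ ≤ ∫⁻ x, ∑' k, (2 ^ k * haarSum M {j ∈ A | ¬k ≤ j + R} k u x ^ q) ^ (p / q) :=
        lintegral_mono fun x => tsum_rpow_le_tsum_rpow hs0 hs1.le _
    _ = ∑' k, ∫⁻ x, (2 ^ k * haarSum M {j ∈ A | ¬k ≤ j + R} k u x ^ q) ^ (p / q) :=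
        lintegral_tsum fun k => by have := hms k; fun_prop
    _ ≤ _ := ENNReal.tsum_le_tsum hk
    _ = nodeConst p 0 decayMass * geo η ^ (p - 1) *
        ((∑' k, ∑ j ∈ A with ¬k ≤ j + R, ∑' n, α k j n) * I) := by
      rw [ENNReal.tsum_mul_left, ENNReal.tsum_mul_right]
    _ ≤ nodeConst p 0 decayMass * geo η ^ (p - 1) * (geo η * geo η * I) := by
      gcongr
      refine (tsum_far_le η A R).trans ?_
      rw [mul_assoc]
      exact mul_le_of_le_one_left' hA
    _ = _ := by ring

/-- The bound for a sequence of nonnegative functions in place of the Littlewood–Paley pieces. -/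
lemma exists_lintegral_haarSum_rpow_le {p q : ℝ} (hp : 1 < p) (hpq : p < q) :
    ∃ (M : ℕ) (K : ℝ≥0∞), K ≠ ⊤ ∧ ∀ (u : ℕ → ℝ → ℝ≥0∞), (∀ n, Measurable (u n)) →
      ∫⁻ x, (∑' n, 2 ^ n * u n x ^ q) ^ (p / q) ≠ ⊤ → ∀ A : Finset ℕ, 2 ≤ A.card →
      ∫⁻ x, (∑' k, 2 ^ k * haarSum M A k u x ^ q) ^ (p / q) ≤
        K * ((Zbar A : ℝ≥0∞) ^ (q - 1) * ENNReal.ofReal (Real.logb 2 A.card)) ^ (p / q) *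
          ∫⁻ x, (∑' n, 2 ^ n * u n x ^ q) ^ (p / q) := by
  have hp0 : 0 < p := by linarith
  have hq : 0 < q := by linarith
  have hs1 : p / q < 1 := (div_lt_one hq).2 hpq
  have hs0 : 0 < p / q := div_pos hp0 hq
  obtain ⟨η, hη0, hη, hη'⟩ : ∃ η : ℝ, 0 < η ∧ η * q ≤ p ∧ η * q ≤ q - 1 := by
    refine ⟨min p (q - 1) / q, div_pos (lt_min hp0 (by linarith)) hq, ?_, ?_⟩ <;>
      rw [div_mul_cancel₀ _ hq.ne']
    exacts [min_le_left _ _, min_le_right _ _]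
  obtain ⟨θ, hθ0, hθ, hθ'⟩ : ∃ θ : ℝ, 0 < θ ∧ θ * p ≤ 1 - p / q ∧ θ * p ≤ p - 1 := by
    refine ⟨min (1 - p / q) (p - 1) / p,
      div_pos (lt_min (by linarith) (by linarith)) hp0, ?_, ?_⟩ <;>
      rw [div_mul_cancel₀ _ hp0.ne']
    exacts [min_le_left _ _, min_le_right _ _]
  obtain ⟨B, hB⟩ := exists_nat_ge (2 / θ)
  replace hB : 2 ≤ θ * B := by rwa [div_le_iff₀' hθ0] at hB
  obtain ⟨M, hM⟩ := exists_nat_ge (2 * (q - p) + 2)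
  have hM2 : 2 ≤ M := by
    have : (2 : ℝ) ≤ M := by linarith
    exact_mod_cast this
  obtain ⟨K, hK, hnear⟩ := exists_lintegral_near_rpow_le hp hpq hη hη' hM
  set D : ℝ≥0∞ := (geo η + (B + 1)) * geo η with hD
  set F : ℝ≥0∞ := nodeConst p 0 decayMass * geo θ ^ (p - 1) * (geo θ * geo θ) with hF
  have hgη := geo_ne_top hη0
  have hgθ := geo_ne_top hθ0
  have hDt : D ≠ ⊤ := by finiteness
  refine ⟨M, (2 ^ (q - 1)) ^ (p / q) * (K * (D ^ (q - 1) * D) ^ (p / q) + F), ?_,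
    fun u hu hI A hA => ?_⟩
  · have h1 : ((2 : ℝ≥0∞) ^ (q - 1)) ^ (p / q) ≠ ⊤ :=
      ENNReal.rpow_ne_top_of_nonneg hs0.le (twoPow_ne_top _)
    have h2 : D ^ (q - 1) ≠ ⊤ := ENNReal.rpow_ne_top_of_nonneg (by linarith) hDt
    have h3 : (D ^ (q - 1) * D) ^ (p / q) ≠ ⊤ := ENNReal.rpow_ne_top_of_nonneg hs0.le (by finiteness)
    have h4 : nodeConst p 0 decayMass ≠ ⊤ := nodeConst_ne_top le_rfl (by linarith) decayMass_ne_top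
    have h5 : geo θ ^ (p - 1) ≠ ⊤ := ENNReal.rpow_ne_top_of_nonneg (by linarith) hgθ
    finiteness
  set I := ∫⁻ x, (∑' n, 2 ^ n * u n x ^ q) ^ (p / q) with hIdef
  set L := Nat.log 2 A.card with hL
  set ℓ := ENNReal.ofReal (Real.logb 2 A.card) with hℓ
  set z : ℝ≥0∞ := (Zbar A : ℝ≥0∞) with hz
  have hL1 : 1 ≤ L := Nat.log_pos (by norm_num) hA
  have hLℓ : (L : ℝ≥0∞) ≤ ℓ := by
    rw [hℓ, ← ENNReal.ofReal_natCast]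
    exact ENNReal.ofReal_le_ofReal (natLog_two_le_logb _)
  have hℓ1 : 1 ≤ ℓ := le_trans (by exact_mod_cast hL1) hLℓ
  have hz1 : 1 ≤ z := Nat.one_le_cast.2 (one_le_Zbar hA)
  set R := B * L with hR
  have hΛ : (geo η + ((R : ℝ≥0∞) + 1)) * geo η ≤ D * ℓ := by
    calc (geo η + ((R : ℝ≥0∞) + 1)) * geo η ≤ (geo η * ℓ + (B * ℓ + 1 * ℓ)) * geo η := by
          rw [hR, Nat.cast_mul]
          gcongr
          · exact le_mul_of_one_le_right' hℓ1
          · simpa using hℓ1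
      _ = D * ℓ := by rw [hD]; ring
  have hZ : ∀ k, (geo η + (A.filter fun j => j ≤ k ∧ k ≤ j + R).card) * geo η ≤ D * z := by
    intro k
    have hc : ((A.filter fun j => j ≤ k ∧ k ≤ j + R).card : ℝ≥0∞) ≤ (B + 1) * z := by
      rw [hz]
      exact_mod_cast card_filter_le_mul_Zbar hA B k
    calc _ ≤ (geo η * z + (B + 1) * z) * geo η := by
          gcongr
          exact le_mul_of_one_le_right' hz1
      _ = D * z := by rw [hD]; ring
  have hN := hnear u hu hI A R (D * z) (ENNReal.mul_ne_top hDt (ENNReal.natCast_ne_top _))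
    (by finiteness) hZ
  have hfar := lintegral_far_rpow_le hp hpq hθ0.le hθ hθ' hM2 hu A R
    (card_mul_twoPow_le_one hA hB)
  have hmn := fun k => measurable_haarSum M {j ∈ A | k ≤ j + R} k u
  have hW1 : 1 ≤ (z ^ (q - 1) * ℓ) ^ (p / q) := by
    refine ENNReal.one_le_rpow (one_le_mul ?_ hℓ1) hs0
    exact ENNReal.one_le_rpow hz1 (by linarith)
  have hnear' : ((D * z) ^ (q - 1) * ((geo η + ((R : ℝ≥0∞) + 1)) * geo η)) ^ (p / q) ≤
      (D ^ (q - 1) * D) ^ (p / q) * (z ^ (q - 1) * ℓ) ^ (p / q) := by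
    rw [← ENNReal.mul_rpow_of_nonneg _ _ hs0.le]
    refine ENNReal.rpow_le_rpow ?_ hs0.le
    rw [ENNReal.mul_rpow_of_nonneg _ _ (by linarith)]
    exact (mul_le_mul_right hΛ _).trans (le_of_eq (by ring))
  have hsplit : ∀ x, (∑' k, 2 ^ k * haarSum M A k u x ^ q) ^ (p / q) ≤
      (2 ^ (q - 1)) ^ (p / q) *
        ((∑' k, 2 ^ k * haarSum M {j ∈ A | k ≤ j + R} k u x ^ q) ^ (p / q) +
          (∑' k, 2 ^ k * haarSum M {j ∈ A | ¬k ≤ j + R} k u x ^ q) ^ (p / q)) := by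
    intro x
    refine le_trans ?_ (mul_le_mul_right (ENNReal.rpow_add_le_add_rpow _ _ hs0.le hs1.le) _)
    rw [← ENNReal.mul_rpow_of_nonneg _ _ hs0.le]
    gcongr
    rw [← ENNReal.tsum_add, ← ENNReal.tsum_mul_left]
    refine ENNReal.tsum_le_tsum fun k => ?_
    rw [← mul_add, mul_left_comm]
    gcongr
    have : haarSum M A k u x = haarSum M {j ∈ A | k ≤ j + R} k u x +
        haarSum M {j ∈ A | ¬k ≤ j + R} k u x :=
      (Finset.sum_filter_add_sum_filter_not _ _ _).symm
    rw [this]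
    exact ENNReal.rpow_add_le_mul_rpow_add_rpow _ _ (by linarith)
  calc _ ≤ _ := lintegral_mono hsplit
    _ = (2 ^ (q - 1)) ^ (p / q) *
        ((∫⁻ x, (∑' k, 2 ^ k * haarSum M {j ∈ A | k ≤ j + R} k u x ^ q) ^ (p / q)) +
          ∫⁻ x, (∑' k, 2 ^ k * haarSum M {j ∈ A | ¬k ≤ j + R} k u x ^ q) ^ (p / q)) := by
      have hm : Measurable fun x =>
          (∑' k, 2 ^ k * haarSum M {j ∈ A | k ≤ j + R} k u x ^ q) ^ (p / q) :=
        (Measurable.tsum fun k => by have := hmn k; fun_prop).pow_const _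
      rw [lintegral_const_mul' _ _ (ENNReal.rpow_ne_top_of_nonneg hs0.le (twoPow_ne_top _)),
        lintegral_add_left hm]
    _ ≤ (2 ^ (q - 1)) ^ (p / q) *
        (K * ((D ^ (q - 1) * D) ^ (p / q) * (z ^ (q - 1) * ℓ) ^ (p / q)) * I +
          F * (z ^ (q - 1) * ℓ) ^ (p / q) * I) := by
      gcongr
      · exact hN.trans (by gcongr)
      · exact hfar.trans (mul_le_mul_left (le_mul_of_one_le_right' hW1) _)
    _ = _ := by ring

lemma FNorm_inv_eq (φ₀ : ℝ → ℂ) {p q : ℝ} (hq : 0 < q) (g : ℝ → ℂ) :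
    FNorm φ₀ p q (1 / q) g =
      (∫⁻ x, (∑' k, 2 ^ k * ‖LPop φ₀ k g x‖ₑ ^ q) ^ (p / q)) ^ (1 / p) := by
  have hw : ∀ k : ℕ, ENNReal.ofReal ((2 : ℝ) ^ ((k : ℝ) * (1 / q) * q)) = 2 ^ k := by
    intro k
    rw [mul_assoc, one_div_mul_cancel hq.ne', mul_one, Real.rpow_natCast,
      ENNReal.ofReal_pow (by norm_num), ENNReal.ofReal_ofNat]
  simp only [FNorm, hw, ofReal_norm]

/-- Endpoint upper bound, $1<p<q<\infty$, $s=1/q$: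
$\|P_E f\|\le C(\log_2\#A)^{1/q}\,\bar{\mathcal Z}(A)^{1-1/q}\|f\|$ with $A=\mathrm{HF}(E)$. -/
theorem haar_projection_endpoint_upper_bound_pq
    (p q : ℝ) (hp : 1 < p) (hpq : p < q)
    (φ₀ : ℝ → ℂ) (hφsmooth : ContDiff ℝ (⊤ : ℕ∞) φ₀) (hφcpt : HasCompactSupport φ₀)
    (hφone : ∀ ξ : ℝ, |ξ| ≤ 4/3 → φ₀ ξ = 1)
    (hφzero : ∀ ξ : ℝ, 3/2 ≤ |ξ| → φ₀ ξ = 0) :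
    ∃ C : ℝ, 0 < C ∧ ∀ (E : Finset (ℕ × ℤ)), 2 ≤ (HFset E).card →
      ∀ f : SchwartzMap ℝ ℂ,
      FNorm φ₀ p q (1/q) (haarProj E f) ≤
        ENNReal.ofReal (C * (Real.logb 2 ((HFset E).card : ℝ))^(1/q) *
          (Zbar (HFset E) : ℝ)^(1 - 1/q)) * FNorm φ₀ p q (1/q) f := by
  have hp0 : 0 < p := by linarith
  have hq : 0 < q := by linarith
  have hs0 : 0 < p / q := div_pos hp0 hq
  have hφ : IsCutoff φ₀ := ⟨hφsmooth, hφcpt, hφone, hφzero⟩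
  obtain ⟨M, K, hK, hsum⟩ := exists_lintegral_haarSum_rpow_le hp hpq
  obtain ⟨C₀, hC₀, hpt⟩ := hφ.exists_enorm_LPop_haarProj_le M
  have hKt : C₀ * K ^ (1 / p) ≠ ⊤ :=
    ENNReal.mul_ne_top hC₀ (ENNReal.rpow_ne_top_of_nonneg (by positivity) hK)
  refine ⟨(C₀ * K ^ (1 / p)).toReal + 1, by positivity, fun E hE f => ?_⟩
  set A := HFset E
  set u : ℕ → ℝ → ℝ≥0∞ := fun n s => ‖LPop φ₀ n f s‖ₑ with hu
  have hum : ∀ n, Measurable (u n) := by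
    intro n
    simp only [hu, ← hφ.coe_piece]
    exact (hφ.piece n f).continuous.measurable.enorm
  set ℓ : ℝ := Real.logb 2 A.card with hℓ
  have hℓ1 : 1 ≤ ℓ := by
    refine le_trans ?_ (natLog_two_le_logb A.card)
    exact_mod_cast Nat.log_pos (by norm_num) hE
  have hz1 : (1 : ℝ) ≤ Zbar A := Nat.one_le_cast.2 (one_le_Zbar hE)
  have hexp : 0 ≤ 1 - 1 / q := sub_nonneg.2 ((div_le_one hq).2 (by linarith))
  rw [FNorm_inv_eq φ₀ hq, FNorm_inv_eq φ₀ hq]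
  set I := ∫⁻ x, (∑' n, 2 ^ n * u n x ^ q) ^ (p / q) with hI
  change _ ≤ _ * I ^ (1 / p)
  rcases eq_or_ne I ⊤ with hIt | hIt
  · rw [hIt, ENNReal.top_rpow_of_pos (by positivity), ENNReal.mul_top]
    · exact le_top
    · rw [ne_eq, ENNReal.ofReal_eq_zero, not_le]
      positivity
  have hC : C₀ * K ^ (1 / p) ≤ ENNReal.ofReal ((C₀ * K ^ (1 / p)).toReal + 1) := by
    rw [← ENNReal.ofReal_toReal hKt]
    exact ENNReal.ofReal_le_ofReal (by simp)
  calc (∫⁻ x, (∑' k, 2 ^ k * ‖LPop φ₀ k (haarProj E f) x‖ₑ ^ q) ^ (p / q)) ^ (1 / p)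
      ≤ (∫⁻ x, C₀ ^ p * (∑' k, 2 ^ k * haarSum M A k u x ^ q) ^ (p / q)) ^ (1 / p) := by
        refine ENNReal.rpow_le_rpow (lintegral_mono fun x => ?_) (by positivity)
        have hCq : C₀ ^ p = (C₀ ^ q) ^ (p / q) := by
          rw [← ENNReal.rpow_mul, mul_div_cancel₀ _ hq.ne']
        simp only
        rw [hCq, ← ENNReal.mul_rpow_of_nonneg _ _ hs0.le, ← ENNReal.tsum_mul_left]
        refine ENNReal.rpow_le_rpow (ENNReal.tsum_le_tsum fun k => ?_) hs0.le
        rw [mul_left_comm, ← ENNReal.mul_rpow_of_nonneg _ _ hq.le]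
        gcongr
        exact hpt E f k x
    _ = C₀ * (∫⁻ x, (∑' k, 2 ^ k * haarSum M A k u x ^ q) ^ (p / q)) ^ (1 / p) := by
        rw [lintegral_const_mul' _ _ (ENNReal.rpow_ne_top_of_nonneg hp0.le hC₀),
          ENNReal.mul_rpow_of_nonneg _ _ (by positivity), ← ENNReal.rpow_mul,
          mul_one_div_cancel hp0.ne', ENNReal.rpow_one]
    _ ≤ C₀ * (K * ((Zbar A : ℝ≥0∞) ^ (q - 1) * ENNReal.ofReal ℓ) ^ (p / q) * I) ^ (1 / p) := by
        gcongr
        exact hsum u hum hIt A hE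
    _ = C₀ * K ^ (1 / p) * ENNReal.ofReal ℓ ^ (1 / q) * (Zbar A : ℝ≥0∞) ^ (1 - 1 / q) *
          I ^ (1 / p) := by
        have e1 : p / q * (1 / p) = 1 / q := by field_simp
        have e2 : (q - 1) * (1 / q) = 1 - 1 / q := by field_simp
        have hp' : 0 ≤ 1 / p := by positivity
        rw [ENNReal.mul_rpow_of_nonneg _ _ hp', ENNReal.mul_rpow_of_nonneg _ _ hp',
          ← ENNReal.rpow_mul, e1, ENNReal.mul_rpow_of_nonneg _ _ (by positivity),
          ← ENNReal.rpow_mul, e2]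
        ring
    _ ≤ _ := by
        rw [ENNReal.ofReal_mul (by positivity), ENNReal.ofReal_mul (by positivity),
          ← ENNReal.ofReal_rpow_of_nonneg (by positivity) (by positivity),
          ← ENNReal.ofReal_rpow_of_nonneg (by positivity) hexp, ENNReal.ofReal_natCast]
        gcongr
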